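/- arXiv:2307.02021 — 15 statements merged into one kernel-verified Lean document; each statement's English description precedes it below -/
import Mathlib

section
/- Let 𝒢 be a hereditary graph class. Then for every finite nonempty simple graph G and every nonempty subset X ⊆ V(G), the 𝒢-modular cardinality of the induced subgraph satisfies 𝒢-mc(G[X]) ≤ 𝒢-mc(G). -/
namespace Stmt0

/-- A module of a graph: every outside vertex is adjacent to all or none of its vertices. -/
def IsModule {α : Type} (G : SimpleGraph α) (M : Set α) : Prop :=
  ∀ v ∉ M, (∀ u ∈ M, G.Adj v u) ∨ (∀ u ∈ M, ¬ G.Adj v u)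

/-- A graph class: a collection of graphs over arbitrary vertex types. -/
abbrev GraphClass : Type 1 := ∀ α : Type, SimpleGraph α → Prop

/-- A hereditary graph class: contains at least one nonempty graph, is closed under
isomorphism, and is closed under taking nonempty induced subgraphs. -/
def Hereditary (𝒢 : GraphClass) : Prop :=
  (∃ (α : Type) (G : SimpleGraph α), Nonempty α ∧ 𝒢 α G) ∧
  (∀ (α β : Type) (G : SimpleGraph α) (H : SimpleGraph β),
      𝒢 α G → Nonempty (G ≃g H) → 𝒢 β H) ∧
  (∀ (α : Type) (G : SimpleGraph α), 𝒢 α G →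
      ∀ s : Set α, s.Nonempty → 𝒢 ↥s (G.induce s))

/-- A `𝒢`-modular partition of `G`: a partition of the vertex set into nonempty modules,
each of which induces a graph belonging to `𝒢`. -/
def IsGModularPartition {α : Type} (𝒢 : GraphClass) (G : SimpleGraph α)
    (P : Finset (Set α)) : Prop :=
  (∀ v : α, ∃! M : Set α, M ∈ P ∧ v ∈ M) ∧
  (∀ M ∈ P, M.Nonempty) ∧
  (∀ M ∈ P, IsModule G M) ∧
  (∀ M ∈ P, 𝒢 ↥M (G.induce M))

/-- The `𝒢`-modular cardinality: the minimum number of parts of a `𝒢`-modular partition. -/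
noncomputable def gmc {α : Type} (𝒢 : GraphClass) (G : SimpleGraph α) : ℕ :=
  sInf {m | ∃ P : Finset (Set α), IsGModularPartition 𝒢 G P ∧ P.card = m}

/-- The preimage of a module of `G` is a module of an induced subgraph. -/
lemma IsModule.preimage_induce {α : Type} {G : SimpleGraph α} {M : Set α} (hM : IsModule G M)
    (X : Set α) : IsModule (G.induce X) (Subtype.val ⁻¹' M) := fun v hv =>
  (hM v hv).imp (fun h u hu => h u hu) (fun h u hu => h u hu)

/-- Inducing on `X` and then on `M` is the same as inducing on `M` and then on `X`. -/
def inducePreimageIso {α : Type} (G : SimpleGraph α) (M X : Set α) :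
    (G.induce M).induce (Subtype.val ⁻¹' X : Set M) ≃g
      (G.induce X).induce (Subtype.val ⁻¹' M : Set X) where
  toFun v := ⟨⟨v.1.1, v.2⟩, v.1.2⟩
  invFun v := ⟨⟨v.1.1, v.2⟩, v.1.2⟩
  left_inv _ := rfl
  right_inv _ := rfl
  map_rel_iff' := Iff.rfl

/-- A hereditary class contains every one-vertex graph. -/
lemma Hereditary.of_unique {𝒢 : GraphClass} (h𝒢 : Hereditary 𝒢) {β : Type} [Unique β]
    (H : SimpleGraph β) : 𝒢 β H := by
  obtain ⟨⟨α, G, ⟨a⟩, hG⟩, hiso, hind⟩ := h𝒢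
  refine hiso _ _ _ H (hind α G hG {a} (Set.singleton_nonempty a))
    ⟨⟨Equiv.ofUnique _ _, fun {x y} => ?_⟩⟩
  rw [Subsingleton.elim y x]
  exact iff_of_false (H.irrefl) (SimpleGraph.irrefl _)

/-- The partition into singletons is a `𝒢`-modular partition. -/
lemma Hereditary.exists_isGModularPartition {𝒢 : GraphClass} (h𝒢 : Hereditary 𝒢) {α : Type}
    [Fintype α] (G : SimpleGraph α) : ∃ P : Finset (Set α), IsGModularPartition 𝒢 G P := by
  classical
  refine ⟨Finset.univ.image fun v => {v}, fun v => ⟨{v}, by simp, ?_⟩, ?_, ?_, ?_⟩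
  · rintro M ⟨hM, hv⟩
    obtain ⟨w, -, rfl⟩ := Finset.mem_image.1 hM
    rw [Set.mem_singleton_iff.1 hv]
  all_goals
    intro M hM
    obtain ⟨w, -, rfl⟩ := Finset.mem_image.1 hM
  · exact Set.singleton_nonempty w
  · intro v _
    simpa using em (G.Adj v w)
  · exact h𝒢.of_unique _

open Classical in
/-- A `𝒢`-modular partition restricts to one of any induced subgraph. -/
lemma IsGModularPartition.induce {𝒢 : GraphClass} (h𝒢 : Hereditary 𝒢) {α : Type}
    {G : SimpleGraph α} {P : Finset (Set α)} (hP : IsGModularPartition 𝒢 G P) (X : Set α) :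
    IsGModularPartition 𝒢 (G.induce X)
      ((P.image fun M => (Subtype.val ⁻¹' M : Set X)).filter Set.Nonempty) := by
  obtain ⟨hpart, -, hmod, hmem⟩ := hP
  refine ⟨fun v => ?_, fun N hN => (Finset.mem_filter.1 hN).2, ?_, ?_⟩
  · obtain ⟨M, ⟨hM, hv⟩, huniq⟩ := hpart v
    refine ⟨(Subtype.val ⁻¹' M : Set X),
      ⟨Finset.mem_filter.2 ⟨Finset.mem_image_of_mem _ hM, ⟨v, hv⟩⟩, hv⟩, ?_⟩
    rintro N ⟨hN, hvN⟩
    obtain ⟨M', hM', rfl⟩ := Finset.mem_image.1 (Finset.mem_filter.1 hN).1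
    rw [huniq M' ⟨hM', hvN⟩]
  all_goals
    intro N hN
    obtain ⟨hN, v, hv⟩ := Finset.mem_filter.1 hN
    obtain ⟨M, hM, rfl⟩ := Finset.mem_image.1 hN
  · exact (hmod M hM).preimage_induce X
  · exact h𝒢.2.1 _ _ _ _ (h𝒢.2.2 _ _ (hmem M hM) (Subtype.val ⁻¹' X : Set M)
      ⟨⟨v, hv⟩, v.2⟩)
      ⟨inducePreimageIso G M X⟩

/-- for a hereditary graph class `𝒢`, the `𝒢`-modular cardinality of an
induced subgraph on a nonempty vertex subset is at most that of the whole graph. -/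
theorem gmc_induce_le (𝒢 : GraphClass) (h𝒢 : Hereditary 𝒢)
    (V : Type) [Fintype V] [Nonempty V] (G : SimpleGraph V)
    (X : Set V) (hX : X.Nonempty) :
    gmc 𝒢 (G.induce X) ≤ gmc 𝒢 G := by
  classical
  obtain ⟨P, hP, hcard⟩ : gmc 𝒢 G ∈ {m | ∃ P, IsGModularPartition 𝒢 G P ∧ P.card = m} :=
    Nat.sInf_mem ((h𝒢.exists_isGModularPartition G).imp' Finset.card fun P hP => ⟨P, hP, rfl⟩)
  rw [← hcard]
  exact le_trans (Nat.sInf_le ⟨_, hP.induce h𝒢 X, rfl⟩)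
    ((Finset.card_filter_le _ _).trans Finset.card_image_le)

end Stmt0
end

section
/- Let G be a finite simple graph with at least two vertices such that both G and its complement are connected, and let M* be a partition of V(G) into maximal strong modules of G. Then for every module M of G with M ⊊ V(G), there exists a part M' ∈ M* such that M ⊆ M'. -/
namespace Stmt2

/-- A module of a graph: every outside vertex is adjacent to all or none of its vertices. -/
def IsModule {α : Type} (G : SimpleGraph α) (M : Set α) : Prop :=
  ∀ v ∉ M, (∀ u ∈ M, G.Adj v u) ∨ (∀ u ∈ M, ¬ G.Adj v u)

/-- A strong module: a module that does not overlap any other module. -/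
def IsStrongModule {α : Type} (G : SimpleGraph α) (M : Set α) : Prop :=
  IsModule G M ∧ ∀ M' : Set α, IsModule G M' → M' ⊆ M ∨ M ⊆ M' ∨ M ∩ M' = ∅

/-- A maximal strong module: a strong module `M ⊊ V` such that the only strong module
properly containing `M` is the whole vertex set. -/
def IsMaximalStrongModule {α : Type} (G : SimpleGraph α) (M : Set α) : Prop :=
  IsStrongModule G M ∧ M ⊂ Set.univ ∧
    ∀ M' : Set α, IsStrongModule G M' → M ⊂ M' → M' = Set.univ

theorem IsModule.union {α : Type} {G : SimpleGraph α} {A B : Set α} (hA : IsModule G A)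
    (hB : IsModule G B) (h : (A ∩ B).Nonempty) : IsModule G (A ∪ B) := by
  obtain ⟨w, hwA, hwB⟩ := h
  intro v hv
  rw [Set.mem_union, not_or] at hv
  rcases hA v hv.1 with h1 | h1 <;> rcases hB v hv.2 with h2 | h2
  · exact Or.inl fun u hu => hu.elim (h1 u) (h2 u)
  · exact absurd (h1 w hwA) (h2 w hwB)
  · exact absurd (h2 w hwB) (h1 w hwA)
  · exact Or.inr fun u hu => hu.elim (h1 u) (h2 u)

theorem exists_adj_of_mem_of_notMem {α : Type} {G : SimpleGraph α} (hG : G.Connected)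
    {S : Set α} {a b : α} (ha : a ∈ S) (hb : b ∉ S) : ∃ x ∈ S, ∃ y ∉ S, G.Adj y x := by
  obtain ⟨p⟩ := hG.preconnected a b
  obtain ⟨d, -, hd1, hd2⟩ := p.exists_boundary_dart S ha hb
  exact ⟨d.fst, hd1, d.snd, hd2, d.adj.symm⟩

/-- In a connected and co-connected graph, two modules covering the vertices are never both
proper. -/
theorem IsModule.eq_univ_of_union_eq_univ {α : Type} {G : SimpleGraph α} (hG : G.Connected)
    (hGc : Gᶜ.Connected) {A B : Set α} (hA : IsModule G A) (hB : IsModule G B)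
    (hAB : A ∪ B = Set.univ) : A = Set.univ ∨ B = Set.univ := by
  by_contra! h
  obtain ⟨c, hcA⟩ := (Set.ne_univ_iff_exists_notMem A).1 h.1
  obtain ⟨a, haB⟩ := (Set.ne_univ_iff_exists_notMem B).1 h.2
  have hcov (v : α) : v ∈ A ∨ v ∈ B := by
    rw [← Set.mem_union, hAB]
    trivial
  have haA : a ∈ A := (hcov a).resolve_right haB
  obtain ⟨x, hxA, y, hyA, hyx⟩ := exists_adj_of_mem_of_notMem hG haA hcA
  obtain ⟨x', hxA', y', hyA', hyx'⟩ := exists_adj_of_mem_of_notMem hGc haA hcA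
  have hya : G.Adj y a := (hA y hyA).elim (fun h => h a haA) fun h => absurd hyx (h x hxA)
  have hya' : ¬ G.Adj y' a :=
    (hA y' hyA').elim (fun h => absurd (h x' hxA') hyx'.2) fun h => h a haA
  rcases hB a haB with h | h
  · exact hya' (h y' ((hcov y').resolve_left hyA')).symm
  · exact h y ((hcov y).resolve_left hyA) hya.symm

/-- In a connected and co-connected graph, every inclusion-maximal proper module is strong. -/
theorem isStrongModule_of_maximal {α : Type} {G : SimpleGraph α} (hG : G.Connected)
    (hGc : Gᶜ.Connected) {N : Set α}
    (hN : Maximal (fun S => IsModule G S ∧ S ≠ Set.univ) N) : IsStrongModule G N := by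
  refine ⟨hN.prop.1, fun M' hM' => ?_⟩
  by_contra! h
  obtain ⟨h1, h2, h3⟩ := h
  by_cases hu : N ∪ M' = Set.univ
  · rcases hN.prop.1.eq_univ_of_union_eq_univ hG hGc hM' hu with h | h
    · exact hN.prop.2 h
    · exact h2 (h ▸ Set.subset_univ N)
  · exact h1 (Set.subset_union_right.trans
      (hN.le_of_ge ⟨hN.prop.1.union hM' h3, hu⟩ Set.subset_union_left))

/-- if `G` has at least two vertices, both `G` and its complement are
connected, and `M*` is a partition of the vertex set into maximal strong modules,
then every module `M ⊊ V(G)` is contained in some part of `M*`. -/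
theorem module_subset_maximal_strong (V : Type) [Fintype V] (G : SimpleGraph V)
    (hcard : 2 ≤ Fintype.card V)
    (hconn : G.Connected) (hconnc : (Gᶜ).Connected)
    (P : Finset (Set V))
    (hcover : ∀ v : V, ∃! M : Set V, M ∈ P ∧ v ∈ M)
    (hne : ∀ M ∈ P, M.Nonempty)
    (hmax : ∀ M ∈ P, IsMaximalStrongModule G M)
    (M : Set V) (hM : IsModule G M) (hMV : M ⊂ Set.univ) :
    ∃ M' ∈ P, M ⊆ M' := by
  obtain ⟨N, hMN, hN⟩ := (Set.toFinite {S : Set V | IsModule G S ∧ S ≠ Set.univ}).exists_le_maximal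
    (show M ∈ {S : Set V | IsModule G S ∧ S ≠ Set.univ} from ⟨hM, hMV.ne⟩)
  have hNs : IsStrongModule G N := isStrongModule_of_maximal hconn hconnc hN
  obtain ⟨v, hv⟩ : ∃ v : V, M.Nonempty → v ∈ M := by
    rcases M.eq_empty_or_nonempty with rfl | ⟨v, hv⟩
    · exact ⟨hconn.nonempty.some, fun h => absurd h Set.not_nonempty_empty⟩
    · exact ⟨v, fun _ => hv⟩
  obtain ⟨M', ⟨hM'P, hvM'⟩, -⟩ := hcover v
  refine ⟨M', hM'P, fun u hu => ?_⟩
  have hvN : v ∈ N := hMN (hv ⟨u, hu⟩)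
  obtain ⟨hM's, -, hM'max⟩ := hmax M' hM'P
  rcases hNs.2 M' hM's.1 with h | h | h
  · rcases h.eq_or_ssubset with rfl | h
    · exact hMN hu
    · exact absurd (hM'max N hNs h) hN.prop.2
  · exact h (hMN hu)
  · exact absurd (h ▸ Set.mem_inter hvN hvM' : v ∈ (∅ : Set V)) (Set.notMem_empty v)

end Stmt2
end

section
/- Let 𝒢 be a hereditary graph class and ω ∈ ℕ such that every graph in 𝒢 belongs to MW(ω). Then every finite nonempty simple graph G belongs to MW(max(𝒢-mc(G), ω)). -/
namespace Stmt3

/-- A module of a graph: every outside vertex is adjacent to all or none of its vertices. -/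
def IsModule {α : Type} (G : SimpleGraph α) (M : Set α) : Prop :=
  ∀ v ∉ M, (∀ u ∈ M, G.Adj v u) ∨ (∀ u ∈ M, ¬ G.Adj v u)

/-- A graph class: a collection of graphs over arbitrary vertex types. -/
abbrev GraphClass : Type 1 := ∀ α : Type, SimpleGraph α → Prop

/-- A hereditary graph class: contains at least one nonempty graph, is closed under
isomorphism, and is closed under taking nonempty induced subgraphs. -/
def Hereditary (𝒢 : GraphClass) : Prop :=
  (∃ (α : Type) (G : SimpleGraph α), Nonempty α ∧ 𝒢 α G) ∧
  (∀ (α β : Type) (G : SimpleGraph α) (H : SimpleGraph β),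
      𝒢 α G → Nonempty (G ≃g H) → 𝒢 β H) ∧
  (∀ (α : Type) (G : SimpleGraph α), 𝒢 α G →
      ∀ s : Set α, s.Nonempty → 𝒢 ↥s (G.induce s))

/-- A `𝒢`-modular partition of `G`. -/
def IsGModularPartition {α : Type} (𝒢 : GraphClass) (G : SimpleGraph α)
    (P : Finset (Set α)) : Prop :=
  (∀ v : α, ∃! M : Set α, M ∈ P ∧ v ∈ M) ∧
  (∀ M ∈ P, M.Nonempty) ∧
  (∀ M ∈ P, IsModule G M) ∧
  (∀ M ∈ P, 𝒢 ↥M (G.induce M))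

/-- The `𝒢`-modular cardinality. -/
noncomputable def gmc {α : Type} (𝒢 : GraphClass) (G : SimpleGraph α) : ℕ :=
  sInf {m | ∃ P : Finset (Set α), IsGModularPartition 𝒢 G P ∧ P.card = m}

/-- Disjoint union of two graphs. -/
def sumGraph {α β : Type} (G : SimpleGraph α) (H : SimpleGraph β) : SimpleGraph (α ⊕ β) :=
  SimpleGraph.fromRel fun x y =>
    (∃ a b, x = Sum.inl a ∧ y = Sum.inl b ∧ G.Adj a b) ∨
    (∃ a b, x = Sum.inr a ∧ y = Sum.inr b ∧ H.Adj a b)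

/-- Join of two graphs: disjoint union plus all edges in between. -/
def joinGraph {α β : Type} (G : SimpleGraph α) (H : SimpleGraph β) : SimpleGraph (α ⊕ β) :=
  SimpleGraph.fromRel fun x y =>
    (∃ a b, x = Sum.inl a ∧ y = Sum.inl b ∧ G.Adj a b) ∨
    (∃ a b, x = Sum.inr a ∧ y = Sum.inr b ∧ H.Adj a b) ∨
    (∃ a b, x = Sum.inl a ∧ y = Sum.inr b)

/-- Substitution of the graphs `K v` into the vertices `v` of the quotient graph `Q`:
all edges between `K u` and `K v` when `u, v` are adjacent in `Q`, none otherwise. -/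
def substGraph {γ : Type} {δ : γ → Type} (Q : SimpleGraph γ) (K : ∀ v, SimpleGraph (δ v)) :
    SimpleGraph (Σ v, δ v) :=
  SimpleGraph.fromRel fun x y =>
    Q.Adj x.1 y.1 ∨ ∃ (v : γ) (a b : δ v), x = ⟨v, a⟩ ∧ y = ⟨v, b⟩ ∧ (K v).Adj a b

/-- `MW k`: the class of graphs of modular-width at most `k`, defined inductively:
one-vertex graphs, disjoint unions, joins, substitutions into a quotient graph with
at most `k` vertices, and closure under isomorphism. -/
inductive MW (k : ℕ) : ∀ α : Type, SimpleGraph α → Prop where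
  | single : ∀ (α : Type) (G : SimpleGraph α), (∃ a : α, ∀ b : α, b = a) → MW k α G
  | union : ∀ {α β : Type} (G : SimpleGraph α) (H : SimpleGraph β),
      MW k α G → MW k β H → MW k (α ⊕ β) (sumGraph G H)
  | join : ∀ {α β : Type} (G : SimpleGraph α) (H : SimpleGraph β),
      MW k α G → MW k β H → MW k (α ⊕ β) (joinGraph G H)
  | subst : ∀ {γ : Type} [inst : Fintype γ] {δ : γ → Type}
      (Q : SimpleGraph γ) (K : ∀ v, SimpleGraph (δ v)),
      1 ≤ Fintype.card γ → Fintype.card γ ≤ k →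
      (∀ v, MW k (δ v) (K v)) → MW k (Σ v, δ v) (substGraph Q K)
  | iso : ∀ {α β : Type} (G : SimpleGraph α) (H : SimpleGraph β),
      MW k α G → Nonempty (G ≃g H) → MW k β H

theorem MW.mono {k l : ℕ} (hkl : k ≤ l) {α : Type} {G : SimpleGraph α} (h : MW k α G) :
    MW l α G := by
  induction h with
  | single α G h => exact MW.single α G h
  | union G H _ _ ihG ihH => exact MW.union G H ihG ihH
  | join G H _ _ ihG ihH => exact MW.join G H ihG ihH
  | subst Q K h1 hk _ ih => exact MW.subst Q K h1 (hk.trans hkl) ih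
  | iso G H _ e ih => exact MW.iso G H ih e

theorem Hereditary.of_unique {𝒢 : GraphClass} (h𝒢 : Hereditary 𝒢) {β : Type} [Unique β]
    (H : SimpleGraph β) : 𝒢 β H := by
  obtain ⟨⟨α, G, ⟨a⟩, hG⟩, hiso, hind⟩ := h𝒢
  refine hiso _ _ _ _ (hind α G hG {a} (Set.singleton_nonempty a))
    ⟨⟨Equiv.ofUnique _ _, ?_⟩⟩
  intro x y
  rw [Subsingleton.elim x y]
  simp

theorem Hereditary.isGModularPartition_singletons {𝒢 : GraphClass} (h𝒢 : Hereditary 𝒢)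
    {V : Type} [Fintype V] (G : SimpleGraph V) :
    IsGModularPartition 𝒢 G
      (Finset.univ.map ⟨fun v : V => ({v} : Set V), Set.singleton_injective⟩) := by
  refine ⟨fun v => ⟨{v}, by simp, ?_⟩, ?_, ?_, ?_⟩
  · rintro M ⟨hM, hv⟩
    obtain ⟨w, rfl⟩ : ∃ w, {w} = M := by simpa using hM
    rw [Set.mem_singleton_iff.1 hv]
  all_goals
    intro M hM
    obtain ⟨w, rfl⟩ : ∃ w, {w} = M := by simpa using hM
  · exact Set.singleton_nonempty w
  · intro v _
    simpa using em (G.Adj v w)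
  · exact h𝒢.of_unique _

theorem Hereditary.exists_isGModularPartition_card_eq_gmc {𝒢 : GraphClass} (h𝒢 : Hereditary 𝒢)
    {V : Type} [Fintype V] (G : SimpleGraph V) :
    ∃ P : Finset (Set V), IsGModularPartition 𝒢 G P ∧ P.card = gmc 𝒢 G :=
  Nat.sInf_mem (s := {m | ∃ P : Finset (Set V), IsGModularPartition 𝒢 G P ∧ P.card = m})
    ⟨_, _, h𝒢.isGModularPartition_singletons G, rfl⟩

/-- Between two disjoint modules, one edge forces all edges. -/
theorem IsModule.adj_of_adj {α : Type} {G : SimpleGraph α} {M N : Set α} (hM : IsModule G M)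
    (hN : IsModule G N) (hMN : Disjoint M N) {a a' b b' : α} (ha : a ∈ M) (ha' : a' ∈ M)
    (hb : b ∈ N) (hb' : b' ∈ N) (h : G.Adj a b) : G.Adj a' b' := by
  have hab' : G.Adj a b' :=
    (hN a (Set.disjoint_left.1 hMN ha)).resolve_right (fun hn => hn b hb h) b' hb'
  exact ((hM b' (Set.disjoint_right.1 hMN hb')).resolve_right
    (fun hn => hn a ha hab'.symm) a' ha').symm

/-- The quotient of a graph by a family of vertex sets. -/
def quotientGraph {α : Type} (G : SimpleGraph α) (P : Finset (Set α)) : SimpleGraph P :=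
  SimpleGraph.fromRel fun M N => ∃ a ∈ M.1, ∃ b ∈ N.1, G.Adj a b

theorem quotientGraph_adj {α : Type} {G : SimpleGraph α} {P : Finset (Set α)} {M N : P} :
    (quotientGraph G P).Adj M N ↔ M ≠ N ∧ ∃ a ∈ M.1, ∃ b ∈ N.1, G.Adj a b := by
  rw [quotientGraph, SimpleGraph.fromRel_adj]
  refine and_congr_right fun _ => ⟨?_, Or.inl⟩
  rintro (h | ⟨a, ha, b, hb, h⟩)
  · exact h
  · exact ⟨b, hb, a, ha, h.symm⟩

theorem substGraph_adj {γ : Type} {δ : γ → Type} {Q : SimpleGraph γ}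
    {K : ∀ v, SimpleGraph (δ v)} {x y : Σ v, δ v} :
    (substGraph Q K).Adj x y ↔
      Q.Adj x.1 y.1 ∨ ∃ (v : γ) (a b : δ v), x = ⟨v, a⟩ ∧ y = ⟨v, b⟩ ∧ (K v).Adj a b := by
  rw [substGraph, SimpleGraph.fromRel_adj]
  constructor
  · rintro ⟨_, h | h | ⟨v, a, b, rfl, rfl, h⟩⟩
    · exact h
    · exact Or.inl h.symm
    · exact Or.inr ⟨v, b, a, rfl, rfl, h.symm⟩
  · intro h
    refine ⟨?_, Or.inl h⟩
    rintro rfl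
    rcases h with h | ⟨v, a, b, rfl, hb, h⟩
    · exact Q.loopless.irrefl _ h
    · cases hb
      exact (K v).loopless.irrefl _ h

namespace IsGModularPartition

variable {𝒢 : GraphClass} {α : Type} {G : SimpleGraph α} {P : Finset (Set α)}

theorem eq_of_mem (hP : IsGModularPartition 𝒢 G P) {M N : P} {a : α} (hM : a ∈ M.1)
    (hN : a ∈ N.1) : M = N :=
  Subtype.ext ((hP.1 a).unique ⟨M.2, hM⟩ ⟨N.2, hN⟩)

theorem nonempty_iso (hP : IsGModularPartition 𝒢 G P) :
    Nonempty (substGraph (quotientGraph G P) (fun M => G.induce M.1) ≃g G) := by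
  have hbij : Function.Bijective (fun x : (Σ M : P, ↥M.1) => (x.2 : α)) := by
    constructor
    · rintro ⟨M, a, ha⟩ ⟨N, b, hb⟩ (rfl : a = b)
      obtain rfl := hP.eq_of_mem ha hb
      rfl
    · intro v
      obtain ⟨M, ⟨hM, hv⟩, -⟩ := hP.1 v
      exact ⟨⟨⟨M, hM⟩, v, hv⟩, rfl⟩
  refine ⟨⟨Equiv.ofBijective _ hbij, ?_⟩⟩
  rintro ⟨M, a, ha⟩ ⟨N, b, hb⟩
  rw [substGraph_adj]
  change G.Adj a b ↔ _
  constructor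
  · intro h
    by_cases hMN : M = N
    · subst hMN
      exact Or.inr ⟨M, ⟨a, ha⟩, ⟨b, hb⟩, rfl, rfl, h⟩
    · exact Or.inl (quotientGraph_adj.2 ⟨hMN, a, ha, b, hb, h⟩)
  · rintro (h | ⟨L, a', b', h₁, h₂, h⟩)
    · obtain ⟨hMN, a', ha', b', hb', h⟩ := quotientGraph_adj.1 h
      have hdisj : Disjoint M.1 N.1 :=
        Set.disjoint_left.2 fun _ h₁ h₂ => hMN (hP.eq_of_mem h₁ h₂)
      exact (hP.2.2.1 M M.2).adj_of_adj (hP.2.2.1 N N.2) hdisj ha' ha hb' hb h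
    · cases h₁
      cases h₂
      exact h

theorem mw [Nonempty α] (hP : IsGModularPartition 𝒢 G P) {k : ℕ} (hcard : P.card ≤ k)
    (hk : ∀ M ∈ P, MW k ↥M (G.induce M)) : MW k α G := by
  obtain ⟨M, ⟨hM, -⟩, -⟩ := hP.1 (Classical.arbitrary α)
  refine MW.iso _ _ (MW.subst (quotientGraph G P) (fun M => G.induce M.1) ?_ ?_
    fun M => hk M M.2) hP.nonempty_iso
  · rw [Fintype.card_coe]
    exact Finset.card_pos.2 ⟨M, hM⟩
  · rwa [Fintype.card_coe]

end IsGModularPartition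

/-- if `𝒢` is hereditary and every graph of `𝒢` has modular-width at
most `ω`, then every finite nonempty graph `G` has modular-width at most
`max (𝒢-mc G, ω)`. -/
theorem mw_le_max_gmc (𝒢 : GraphClass) (h𝒢 : Hereditary 𝒢) (ω : ℕ)
    (hω : ∀ (α : Type) (G : SimpleGraph α), 𝒢 α G → MW ω α G)
    (V : Type) [Fintype V] [Nonempty V] (G : SimpleGraph V) :
    MW (max (gmc 𝒢 G) ω) V G := by
  obtain ⟨P, hP, hcard⟩ := h𝒢.exists_isGModularPartition_card_eq_gmc G
  exact hP.mw (hcard.le.trans (le_max_left _ _))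
    fun M hM => (hω _ _ (hP.2.2.2 M hM)).mono (le_max_right _ _)

end Stmt3
end

section
/- Let 𝒢 be a hereditary graph class and let G be a finite simple graph with at least two vertices such that G ∉ 𝒢 and both G and its complement are connected. Let M* be a partition of V(G) into maximal strong modules of G. Then 𝒢-mc(G) = Σ_{M ∈ M*} 𝒢-mc(G[M]). -/
namespace Stmt4

/-- A module of a graph: every outside vertex is adjacent to all or none of its vertices. -/
def IsModule {α : Type} (G : SimpleGraph α) (M : Set α) : Prop :=
  ∀ v ∉ M, (∀ u ∈ M, G.Adj v u) ∨ (∀ u ∈ M, ¬ G.Adj v u)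

/-- A graph class: a collection of graphs over arbitrary vertex types. -/
abbrev GraphClass : Type 1 := ∀ α : Type, SimpleGraph α → Prop

/-- A hereditary graph class: contains at least one nonempty graph, is closed under
isomorphism, and is closed under taking nonempty induced subgraphs. -/
def Hereditary (𝒢 : GraphClass) : Prop :=
  (∃ (α : Type) (G : SimpleGraph α), Nonempty α ∧ 𝒢 α G) ∧
  (∀ (α β : Type) (G : SimpleGraph α) (H : SimpleGraph β),
      𝒢 α G → Nonempty (G ≃g H) → 𝒢 β H) ∧
  (∀ (α : Type) (G : SimpleGraph α), 𝒢 α G →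
      ∀ s : Set α, s.Nonempty → 𝒢 ↥s (G.induce s))

/-- A `𝒢`-modular partition of `G`. -/
def IsGModularPartition {α : Type} (𝒢 : GraphClass) (G : SimpleGraph α)
    (P : Finset (Set α)) : Prop :=
  (∀ v : α, ∃! M : Set α, M ∈ P ∧ v ∈ M) ∧
  (∀ M ∈ P, M.Nonempty) ∧
  (∀ M ∈ P, IsModule G M) ∧
  (∀ M ∈ P, 𝒢 ↥M (G.induce M))

/-- The `𝒢`-modular cardinality. -/
noncomputable def gmc {α : Type} (𝒢 : GraphClass) (G : SimpleGraph α) : ℕ :=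
  sInf {m | ∃ P : Finset (Set α), IsGModularPartition 𝒢 G P ∧ P.card = m}

/-- A strong module: a module that does not overlap any other module. -/
def IsStrongModule {α : Type} (G : SimpleGraph α) (M : Set α) : Prop :=
  IsModule G M ∧ ∀ M' : Set α, IsModule G M' → M' ⊆ M ∨ M ⊆ M' ∨ M ∩ M' = ∅

/-- A maximal strong module: a strong module `M ⊊ V` such that the only strong module
properly containing `M` is the whole vertex set. -/
def IsMaximalStrongModule {α : Type} (G : SimpleGraph α) (M : Set α) : Prop :=
  IsStrongModule G M ∧ M ⊂ Set.univ ∧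
    ∀ M' : Set α, IsStrongModule G M' → M ⊂ M' → M' = Set.univ

section Modules

variable {α : Type} {G : SimpleGraph α}

theorem IsModule.union {M N : Set α} (hM : IsModule G M) (hN : IsModule G N)
    (h : (M ∩ N).Nonempty) : IsModule G (M ∪ N) := by
  obtain ⟨w, hwM, hwN⟩ := h
  intro v hv
  have h1 := hM v fun h => hv (Or.inl h)
  have h2 := hN v fun h => hv (Or.inr h)
  grind

/-- Modules of the graph induced on a module `M` are the modules of the graph contained in `M`. -/
theorem isModule_induce_iff {M : Set α} (hM : IsModule G M) (S : Set M) :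
    IsModule (G.induce M) S ↔ IsModule G (Subtype.val '' S) := by
  constructor
  · intro hS v hv
    by_cases hvM : v ∈ M
    · refine (hS ⟨v, hvM⟩ fun h => hv ⟨_, h, rfl⟩).imp ?_ ?_
      · rintro h _ ⟨u, hu, rfl⟩
        exact h u hu
      · rintro h _ ⟨u, hu, rfl⟩
        exact h u hu
    · refine (hM v hvM).imp ?_ ?_
      · rintro h _ ⟨u, -, rfl⟩
        exact h u u.2
      · rintro h _ ⟨u, -, rfl⟩
        exact h u u.2
  · intro hS v hv
    refine (hS v fun h => hv (by simpa using h)).imp ?_ ?_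
    · exact fun h u hu => h u ⟨u, hu, rfl⟩
    · exact fun h u hu => h u ⟨u, hu, rfl⟩

/-- In a connected graph, every nonempty proper vertex set has an outgoing edge. -/
theorem exists_adj_of_connected (hG : G.Connected) {M : Set α} (hM : M.Nonempty)
    (hM' : M ≠ Set.univ) : ∃ x ∉ M, ∃ y ∈ M, G.Adj x y := by
  obtain ⟨y, hy⟩ := hM
  obtain ⟨x, hx⟩ := (Set.ne_univ_iff_exists_notMem M).1 hM'
  obtain ⟨w⟩ := hG.preconnected y x
  obtain ⟨d, -, hd, hd'⟩ := w.exists_boundary_dart M hy hx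
  exact ⟨d.snd, hd', d.fst, hd, d.adj.symm⟩

/-- If a graph and its complement are connected, no two overlapping modules cover it. -/
theorem union_ne_univ_of_connected (hG : G.Connected) (hGc : Gᶜ.Connected) {M N : Set α}
    (hM : IsModule G M) (hN : IsModule G N) (hMN : ¬ M ⊆ N) (hMuniv : M ≠ Set.univ) :
    M ∪ N ≠ Set.univ := by
  intro h
  obtain ⟨w, hwM, hwN⟩ := Set.not_subset.1 hMN
  have hsub : ∀ x ∉ M, x ∈ N := fun x hx => (h ▸ Set.mem_univ x : x ∈ M ∪ N).resolve_left hx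
  obtain ⟨x, hx, y, hy, hxy⟩ := exists_adj_of_connected hG ⟨w, hwM⟩ hMuniv
  obtain ⟨x', hx', y', hy', hxy'⟩ := exists_adj_of_connected hGc ⟨w, hwM⟩ hMuniv
  have hnot : ¬ G.Adj x' y' := (SimpleGraph.compl_adj _ _ _ |>.1 hxy').2
  have h1 := hM x hx
  have h2 := hM x' hx'
  have hwx : G.Adj x w := by grind
  have hwx' : ¬ G.Adj x' w := by grind
  rcases hN w hwN with h3 | h3
  · exact hwx' (h3 x' (hsub x' hx')).symm
  · exact h3 x (hsub x hx) hwx.symm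

/-- If a finite graph and its complement are connected, every proper module is contained in a
proper strong module. -/
theorem IsModule.exists_strong_superset [Finite α] (hG : G.Connected) (hGc : Gᶜ.Connected)
    {N : Set α} (hN : IsModule G N) (hNuniv : N ≠ Set.univ) :
    ∃ K, N ⊆ K ∧ K ≠ Set.univ ∧ IsStrongModule G K := by
  obtain ⟨K, hNK, hK⟩ := (Set.toFinite {K : Set α | IsModule G K ∧ K ≠ Set.univ}).exists_le_maximal
    (show N ∈ {K : Set α | IsModule G K ∧ K ≠ Set.univ} from ⟨hN, hNuniv⟩)
  refine ⟨K, hNK, hK.prop.2, hK.prop.1, fun L hL => ?_⟩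
  by_contra! h
  obtain ⟨h1, h2, h3⟩ := h
  have hne := union_ne_univ_of_connected hG hGc hK.prop.1 hL h2 hK.prop.2
  exact h1 (Set.subset_union_right.trans
    (hK.le_of_ge ⟨hK.prop.1.union hL h3, hne⟩ Set.subset_union_left))

theorem IsModule.subset_of_maximalStrong [Finite α] (hG : G.Connected) (hGc : Gᶜ.Connected)
    {M N : Set α} (hN : IsModule G N) (hNuniv : N ≠ Set.univ)
    (hM : IsMaximalStrongModule G M) (hMN : (M ∩ N).Nonempty) : N ⊆ M := by
  obtain ⟨K, hNK, hK, hKs⟩ := hN.exists_strong_superset hG hGc hNuniv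
  obtain ⟨v, hvM, hvN⟩ := hMN
  rcases hM.1.2 K hKs.1 with h | h | h
  · exact hNK.trans h
  · by_cases hMK : K ⊆ M
    · exact hNK.trans hMK
    · exact absurd (hM.2.2 K hKs ⟨h, hMK⟩) hK
  · exact absurd (show v ∈ M ∩ K from ⟨hvM, hNK hvN⟩) (by simp [h])

end Modules

section Classes

variable {α : Type} {G : SimpleGraph α} {𝒢 : GraphClass}

theorem Hereditary.iso (h𝒢 : Hereditary 𝒢) {β : Type} {H : SimpleGraph β} (e : G ≃g H) :
    𝒢 α G ↔ 𝒢 β H :=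
  ⟨fun h => h𝒢.2.1 _ _ _ _ h ⟨e⟩, fun h => h𝒢.2.1 _ _ _ _ h ⟨e.symm⟩⟩

theorem Hereditary.induce_induce_iff (h𝒢 : Hereditary 𝒢) {M : Set α} (S : Set M) :
    𝒢 S ((G.induce M).induce S) ↔
      𝒢 (Subtype.val '' S : Set α) (G.induce (Subtype.val '' S)) :=
  h𝒢.iso ⟨Equiv.Set.image Subtype.val S Subtype.val_injective, by simp⟩

theorem Hereditary.induce_univ_iff (h𝒢 : Hereditary 𝒢) :
    𝒢 (Set.univ : Set α) (G.induce Set.univ) ↔ 𝒢 α G :=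
  h𝒢.iso ⟨Equiv.Set.univ α, by simp⟩

theorem Hereditary.induce_singleton (h𝒢 : Hereditary 𝒢) (v : α) :
    𝒢 ({v} : Set α) (G.induce {v}) := by
  obtain ⟨β, H, ⟨w⟩, hH⟩ := h𝒢.1
  refine h𝒢.2.1 _ _ _ _ (h𝒢.2.2 β H hH {w} ⟨w, rfl⟩)
    ⟨⟨Equiv.ofUnique ({w} : Set β) ({v} : Set α), ?_⟩⟩
  rintro ⟨_, rfl⟩ ⟨_, rfl⟩
  simp

theorem gmc_le {Q : Finset (Set α)} (hQ : IsGModularPartition 𝒢 G Q) : gmc 𝒢 G ≤ Q.card :=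
  Nat.sInf_le ⟨Q, hQ, rfl⟩

theorem Hereditary.exists_card_eq_gmc [Finite α] (h𝒢 : Hereditary 𝒢) (G : SimpleGraph α) :
    ∃ Q : Finset (Set α), IsGModularPartition 𝒢 G Q ∧ Q.card = gmc 𝒢 G := by
  refine Nat.sInf_mem (s := {m | ∃ Q : Finset (Set α), IsGModularPartition 𝒢 G Q ∧ Q.card = m}) ?_
  refine ⟨_, (Set.toFinite (Set.range fun v : α => ({v} : Set α))).toFinset, ⟨?_, ?_, ?_, ?_⟩, rfl⟩
  · intro v
    refine ⟨{v}, by simp, ?_⟩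
    simp only [Set.Finite.mem_toFinset, Set.mem_range]
    rintro _ ⟨⟨w, rfl⟩, rfl⟩
    rfl
  · simp
  · simp only [Set.Finite.mem_toFinset, Set.mem_range]
    rintro _ ⟨w, rfl⟩ v -
    simpa using em _
  · simp only [Set.Finite.mem_toFinset, Set.mem_range]
    rintro _ ⟨w, rfl⟩
    exact h𝒢.induce_singleton w

open Classical in
/-- A modular partition restricts to any module that meets only parts it contains. -/
theorem IsGModularPartition.restrict (h𝒢 : Hereditary 𝒢) {Q : Finset (Set α)}
    (hQ : IsGModularPartition 𝒢 G Q) {M : Set α} (hM : IsModule G M)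
    (hsub : ∀ N ∈ Q, (M ∩ N).Nonempty → N ⊆ M) :
    IsGModularPartition 𝒢 (G.induce M)
      ((Q.filter (· ⊆ M)).image fun N => (Subtype.val ⁻¹' N : Set M)) := by
  have himage : ∀ N ⊆ M, Subtype.val '' (Subtype.val ⁻¹' N : Set M) = N := fun N hN => by
    rw [Subtype.image_preimage_coe, Set.inter_eq_right.2 hN]
  refine ⟨?_, ?_, ?_, ?_⟩
  · intro v
    obtain ⟨N, ⟨hN, hvN⟩, huniq⟩ := hQ.1 v
    refine ⟨Subtype.val ⁻¹' N, ⟨Finset.mem_image_of_mem _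
      (Finset.mem_filter.2 ⟨hN, hsub N hN ⟨v, v.2, hvN⟩⟩), hvN⟩, ?_⟩
    simp only [Finset.mem_image, Finset.mem_filter]
    rintro _ ⟨⟨N', ⟨hN', -⟩, rfl⟩, hv⟩
    rw [huniq N' ⟨hN', hv⟩]
  all_goals
    simp only [Finset.mem_image, Finset.mem_filter]
    rintro _ ⟨N, ⟨hN, hNM⟩, rfl⟩
  · rw [← Set.image_nonempty (f := Subtype.val), himage N hNM]
    exact hQ.2.1 N hN
  · rw [isModule_induce_iff hM, himage N hNM]
    exact hQ.2.2.1 N hN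
  · rw [h𝒢.induce_induce_iff, himage N hNM]
    exact hQ.2.2.2 N hN

open Classical in
/-- Modular partitions of the parts of a partition into modules combine. -/
theorem IsGModularPartition.glue (h𝒢 : Hereditary 𝒢) {P : Finset (Set α)}
    (hcover : ∀ v : α, ∃! M : Set α, M ∈ P ∧ v ∈ M) (hP : ∀ M ∈ P, IsModule G M)
    {Q : ∀ M : Set α, Finset (Set M)} (hQ : ∀ M, IsGModularPartition 𝒢 (G.induce M) (Q M)) :
    IsGModularPartition 𝒢 G
      (P.biUnion fun M => (Q M).image fun N => (Subtype.val '' N : Set α)) := by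
  refine ⟨?_, ?_, ?_, ?_⟩
  · intro v
    obtain ⟨M, ⟨hM, hvM⟩, huniq⟩ := hcover v
    obtain ⟨N, ⟨hN, hvN⟩, huniqN⟩ := (hQ M).1 ⟨v, hvM⟩
    refine ⟨Subtype.val '' N, ⟨Finset.mem_biUnion.2 ⟨M, hM, Finset.mem_image_of_mem _ hN⟩,
      _, hvN, rfl⟩, ?_⟩
    simp only [Finset.mem_biUnion, Finset.mem_image]
    rintro _ ⟨⟨M', hM', N', hN', rfl⟩, u, hu, rfl⟩
    obtain rfl := huniq M' ⟨hM', u.2⟩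
    rw [huniqN N' ⟨hN', hu⟩]
  all_goals
    simp only [Finset.mem_biUnion, Finset.mem_image]
    rintro _ ⟨M, hM, N, hN, rfl⟩
  · exact ((hQ M).2.1 N hN).image _
  · exact (isModule_induce_iff (hP M hM) N).1 ((hQ M).2.2.1 N hN)
  · exact h𝒢.induce_induce_iff N |>.1 ((hQ M).2.2.2 N hN)

end Classes

/-- for a hereditary class `𝒢`, a graph `G ∉ 𝒢` with at least two vertices
such that both `G` and its complement are connected, and the partition `P` of the
vertices into maximal strong modules, the `𝒢`-modular cardinality of `G` equals the sum
of the `𝒢`-modular cardinalities of the factors induced by the parts. -/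
theorem gmc_eq_sum_over_maximal_strong (𝒢 : GraphClass) (h𝒢 : Hereditary 𝒢)
    (V : Type) [Fintype V] (G : SimpleGraph V)
    (hcard : 2 ≤ Fintype.card V)
    (hG𝒢 : ¬ 𝒢 V G)
    (hconn : G.Connected) (hconnc : (Gᶜ).Connected)
    (P : Finset (Set V))
    (hcover : ∀ v : V, ∃! M : Set V, M ∈ P ∧ v ∈ M)
    (hne : ∀ M ∈ P, M.Nonempty)
    (hmax : ∀ M ∈ P, IsMaximalStrongModule G M) :
    gmc 𝒢 G = ∑ M ∈ P, gmc 𝒢 (G.induce M) := by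
  classical
  have hmod : ∀ M ∈ P, IsModule G M := fun M hM => (hmax M hM).1.1
  apply le_antisymm
  · choose Q hQ hcardQ using fun M : Set V => h𝒢.exists_card_eq_gmc (G.induce M)
    calc gmc 𝒢 G ≤ _ := gmc_le (IsGModularPartition.glue h𝒢 hcover hmod hQ)
      _ ≤ ∑ M ∈ P, ((Q M).image fun N => (Subtype.val '' N : Set V)).card :=
        Finset.card_biUnion_le
      _ ≤ ∑ M ∈ P, gmc 𝒢 (G.induce M) :=
        Finset.sum_le_sum fun M _ => Finset.card_image_le.trans (hcardQ M).le
  · obtain ⟨Q, hQ, hcardQ⟩ := h𝒢.exists_card_eq_gmc G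
    have hproper : ∀ N ∈ Q, N ≠ Set.univ := by
      rintro N hN rfl
      exact hG𝒢 (h𝒢.induce_univ_iff.1 (hQ.2.2.2 _ hN))
    have hsub : ∀ M ∈ P, ∀ N ∈ Q, (M ∩ N).Nonempty → N ⊆ M := fun M hM N hN =>
      (hQ.2.2.1 N hN).subset_of_maximalStrong hconn hconnc (hproper N hN) (hmax M hM)
    have hdisj : (P : Set (Set V)).PairwiseDisjoint fun M => Q.filter (· ⊆ M) := by
      intro M hM M' hM' hne'
      refine Finset.disjoint_left.2 fun N hN hN' => hne' ?_
      rw [Finset.mem_filter] at hN hN'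
      obtain ⟨v, hv⟩ := hQ.2.1 N hN.1
      exact (hcover v).unique ⟨hM, hN.2 hv⟩ ⟨hM', hN'.2 hv⟩
    calc ∑ M ∈ P, gmc 𝒢 (G.induce M) ≤ ∑ M ∈ P, (Q.filter (· ⊆ M)).card :=
          Finset.sum_le_sum fun M hM =>
            (gmc_le (hQ.restrict h𝒢 (hmod M hM) (hsub M hM))).trans Finset.card_image_le
      _ = (P.biUnion fun M => Q.filter (· ⊆ M)).card := (Finset.card_biUnion hdisj).symm
      _ ≤ Q.card := Finset.card_le_card
          (Finset.biUnion_subset.2 fun M _ => Finset.filter_subset _ _)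
      _ = gmc 𝒢 G := hcardQ

end Stmt4
end

section
/- Let 𝒢 be a hereditary graph class and let G be a finite simple graph with G ∉ 𝒢. Suppose G is disconnected, and let 𝒞 denote the family of vertex sets of the connected components of G (alternatively, suppose the complement of G is disconnected and let 𝒞 denote the family of vertex sets of the connected components of the complement). Let 𝒞₁ = {C ∈ 𝒞 : G[C] ∈ 𝒢} and 𝒞₂ = 𝒞 \ 𝒞₁, and let m be the minimum number of parts of a partition of ⋃𝒞₁ into sets each of which is a union of members of 𝒞₁ and induces in G a subgraph belonging to 𝒢 (with m = 0 when 𝒞₁ = ∅). Then 𝒢-mc(G) = m + Σ_{C ∈ 𝒞₂} 𝒢-mc(G[C]). -/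
namespace Stmt5

/-- A module of a graph: every outside vertex is adjacent to all or none of its vertices. -/
def IsModule {α : Type} (G : SimpleGraph α) (M : Set α) : Prop :=
  ∀ v ∉ M, (∀ u ∈ M, G.Adj v u) ∨ (∀ u ∈ M, ¬ G.Adj v u)

/-- A graph class: a collection of graphs over arbitrary vertex types. -/
abbrev GraphClass : Type 1 := ∀ α : Type, SimpleGraph α → Prop

/-- A hereditary graph class: contains at least one nonempty graph, is closed under
isomorphism, and is closed under taking nonempty induced subgraphs. -/
def Hereditary (𝒢 : GraphClass) : Prop :=
  (∃ (α : Type) (G : SimpleGraph α), Nonempty α ∧ 𝒢 α G) ∧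
  (∀ (α β : Type) (G : SimpleGraph α) (H : SimpleGraph β),
      𝒢 α G → Nonempty (G ≃g H) → 𝒢 β H) ∧
  (∀ (α : Type) (G : SimpleGraph α), 𝒢 α G →
      ∀ s : Set α, s.Nonempty → 𝒢 ↥s (G.induce s))

/-- A `𝒢`-modular partition of `G`. -/
def IsGModularPartition {α : Type} (𝒢 : GraphClass) (G : SimpleGraph α)
    (P : Finset (Set α)) : Prop :=
  (∀ v : α, ∃! M : Set α, M ∈ P ∧ v ∈ M) ∧
  (∀ M ∈ P, M.Nonempty) ∧
  (∀ M ∈ P, IsModule G M) ∧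
  (∀ M ∈ P, 𝒢 ↥M (G.induce M))

/-- The `𝒢`-modular cardinality. -/
noncomputable def gmc {α : Type} (𝒢 : GraphClass) (G : SimpleGraph α) : ℕ :=
  sInf {m | ∃ P : Finset (Set α), IsGModularPartition 𝒢 G P ∧ P.card = m}

/-- A class with the closure properties of `Hereditary` contains every one-vertex graph. -/
theorem Hereditary.of_unique {𝒢 : GraphClass} (h : Hereditary 𝒢) {α : Type} [Unique α]
    (G : SimpleGraph α) : 𝒢 α G := by
  obtain ⟨⟨β, H, ⟨b⟩, hH⟩, hiso, hind⟩ := h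
  refine hiso _ _ _ _ (hind β H hH {b} ⟨b, rfl⟩) ⟨⟨Equiv.ofUnique _ _, ?_⟩⟩
  intro x y
  rw [Subsingleton.elim x y]
  simp

theorem Hereditary.induce_image_iff {𝒢 : GraphClass} (h : Hereditary 𝒢) {α : Type}
    (G : SimpleGraph α) (C : Set α) (N : Set ↥C) :
    𝒢 ↥(Subtype.val '' N) (G.induce (Subtype.val '' N)) ↔ 𝒢 ↥N ((G.induce C).induce N) := by
  have e : (G.induce C).induce N ≃g G.induce (Subtype.val '' N) :=
    ⟨Equiv.Set.image Subtype.val N Subtype.val_injective, by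
      intro x y
      simp [SimpleGraph.comap_adj]⟩
  exact ⟨fun H => h.2.1 _ _ _ _ H ⟨e.symm⟩, fun H => h.2.1 _ _ _ _ H ⟨e⟩⟩

theorem Hereditary.induce_mono {𝒢 : GraphClass} (h : Hereditary 𝒢) {α : Type}
    {G : SimpleGraph α} {M N : Set α} (hM : 𝒢 ↥M (G.induce M)) (hNM : N ⊆ M)
    (hN : N.Nonempty) : 𝒢 ↥N (G.induce N) := by
  have himage : Subtype.val '' (Subtype.val ⁻¹' N : Set ↥M) = N := by
    simpa using hNM
  have hne : (Subtype.val ⁻¹' N : Set ↥M).Nonempty := by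
    obtain ⟨x, hx⟩ := hN
    exact ⟨⟨x, hNM hx⟩, hx⟩
  have := (h.induce_image_iff G M _).2 (h.2.2 _ _ hM _ hne)
  rwa [himage] at this

theorem isModule_compl {α : Type} {G : SimpleGraph α} {M : Set α} (hM : IsModule G M) :
    IsModule Gᶜ M := by
  intro v hv
  have hne : ∀ u ∈ M, v ≠ u := fun u hu h => hv (h ▸ hu)
  rcases hM v hv with h | h
  · exact Or.inr fun u hu => by simp [h u hu]
  · exact Or.inl fun u hu => by simp [h u hu, hne u hu]

theorem IsModule.preimage {α : Type} {G : SimpleGraph α} {M : Set α} (hM : IsModule G M)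
    (C : Set α) : IsModule (G.induce C) (Subtype.val ⁻¹' M) := by
  intro v hv
  exact (hM v hv).imp (fun h u hu => h u hu) (fun h u hu => h u hu)

theorem IsModule.image {α : Type} {G : SimpleGraph α} {C : Set α} (hC : IsModule G C)
    {N : Set ↥C} (hN : IsModule (G.induce C) N) : IsModule G (Subtype.val '' N) := by
  intro v hv
  by_cases hvC : v ∈ C
  · have hvN : (⟨v, hvC⟩ : ↥C) ∉ N := fun h => hv ⟨_, h, rfl⟩
    refine (hN _ hvN).imp ?_ ?_
    · rintro h _ ⟨u, hu, rfl⟩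
      exact h u hu
    · rintro h _ ⟨u, hu, rfl⟩
      exact h u hu
  · refine (hC v hvC).imp ?_ ?_
    · rintro h _ ⟨u, -, rfl⟩
      exact h u u.2
    · rintro h _ ⟨u, -, rfl⟩
      exact h u u.2

/-- A set closed under adjacency is a module. -/
theorem isModule_of_adj_mem {α : Type} {G : SimpleGraph α} {M : Set α}
    (h : ∀ u ∈ M, ∀ v, G.Adj u v → v ∈ M) : IsModule G M :=
  fun v hv => Or.inr fun u hu huv => hv (h u hu v huv.symm)

/-- A module meeting two components contains each component that it meets. -/
theorem IsModule.mem_of_reachable {α : Type} {G : SimpleGraph α} {M : Set α}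
    (hM : IsModule G M) {x y z : α} (hx : x ∈ M) (hy : y ∈ M) (hxy : ¬ G.Reachable x y)
    (hxz : G.Reachable x z) : z ∈ M := by
  rw [SimpleGraph.reachable_iff_reflTransGen] at hxz
  induction hxz with
  | refl => exact hx
  | @tail b c hxb hbc ih =>
    by_contra hc
    rcases hM c hc with h | h
    · have hxb' := (SimpleGraph.reachable_iff_reflTransGen x b).2 hxb
      exact hxy ((hxb'.trans hbc.reachable).trans (h y hy).reachable)
    · exact h b ih hbc.symm

theorem exists_isGModularPartition_card_eq_gmc {𝒢 : GraphClass} (h : Hereditary 𝒢) {α : Type}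
    [Finite α] (G : SimpleGraph α) :
    ∃ P : Finset (Set α), IsGModularPartition 𝒢 G P ∧ P.card = gmc 𝒢 G := by
  have : Fintype α := Fintype.ofFinite α
  refine Nat.sInf_mem (s := {m | ∃ P : Finset (Set α), IsGModularPartition 𝒢 G P ∧ P.card = m})
    ⟨_, Finset.univ.map ⟨singleton, Set.singleton_injective⟩, ⟨?_, ?_, ?_, ?_⟩, rfl⟩
  · intro v
    exact ⟨{v}, by simp, by simp +contextual⟩
  · simp
  · simp only [Finset.mem_map, Finset.mem_univ, true_and, Function.Embedding.coeFn_mk,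
      forall_exists_index, forall_apply_eq_imp_iff]
    intro a v _
    simpa using em _
  · simp only [Finset.mem_map, Finset.mem_univ, true_and, Function.Embedding.coeFn_mk,
      forall_exists_index, forall_apply_eq_imp_iff]
    intro a
    exact h.of_unique _

theorem gmc_le_card {𝒢 : GraphClass} {α : Type} {G : SimpleGraph α} {P : Finset (Set α)}
    (hP : IsGModularPartition 𝒢 G P) : gmc 𝒢 G ≤ P.card :=
  Nat.sInf_le ⟨P, hP, rfl⟩

/-- let `G ∉ 𝒢` and let `G'` be `G` or its complement, with `G'`
disconnected.  Split the family of vertex sets of the connected components of `G'` into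
`C₁` (those inducing graphs of `𝒢`) and `C₂` (the rest), and let `m` be the minimum
number of parts of a partition of `⋃ C₁` into sets, each a union of members of `C₁`
inducing (in `G`) a graph of `𝒢`.  Then `𝒢-mc G = m + ∑_{C ∈ C₂} 𝒢-mc (G[C])`. -/
theorem gmc_eq_merge_add_sum (𝒢 : GraphClass) (h𝒢 : Hereditary 𝒢)
    (V : Type) [Fintype V] (G G' : SimpleGraph V)
    (hG' : G' = G ∨ G' = Gᶜ)
    (hdisc : ¬ G'.Connected)
    (hG𝒢 : ¬ 𝒢 V G)
    (C₁ C₂ : Finset (Set V))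
    (hC : ∀ C : Set V, (C ∈ C₁ ∨ C ∈ C₂) ↔ ∃ c : G'.ConnectedComponent, C = c.supp)
    (hC12 : ∀ C ∈ C₁, C ∉ C₂)
    (hC1 : ∀ C ∈ C₁, 𝒢 ↥C (G.induce C))
    (hC2 : ∀ C ∈ C₂, ¬ 𝒢 ↥C (G.induce C))
    (m : ℕ)
    (hm : m = sInf {t | ∃ Q : Finset (Set V),
        (∀ A ∈ Q, ∃ S : Set (Set V), (∀ C ∈ S, C ∈ C₁) ∧ S.Nonempty ∧ A = ⋃₀ S) ∧
        (∀ v : V, (∃ C ∈ C₁, v ∈ C) → ∃! A : Set V, A ∈ Q ∧ v ∈ A) ∧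
        (∀ A ∈ Q, 𝒢 ↥A (G.induce A)) ∧
        Q.card = t}) :
    gmc 𝒢 G = m + ∑ C ∈ C₂, gmc 𝒢 (G.induce C) := by
  classical
  have hmod : ∀ M, IsModule G' M ↔ IsModule G M := by
    intro M
    rcases hG' with rfl | rfl
    · rfl
    · exact ⟨fun h => by simpa using isModule_compl h, isModule_compl⟩
  let K : V → Set V := fun v => (G'.connectedComponentMk v).supp
  have memK : ∀ {u v}, u ∈ K v ↔ G'.Reachable u v := by
    intro u v
    simp [K, SimpleGraph.ConnectedComponent.mem_supp_iff]
  have hself : ∀ v, v ∈ K v := fun v => memK.2 (SimpleGraph.Reachable.refl v)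
  have hKeq : ∀ {u v}, u ∈ K v → K v = K u := by
    intro u v h
    ext w
    exact ⟨fun hw => memK.2 ((memK.1 hw).trans (memK.1 h).symm),
      fun hw => memK.2 ((memK.1 hw).trans (memK.1 h))⟩
  have hK : ∀ v, K v ∈ C₁ ∨ K v ∈ C₂ := fun v => (hC _).2 ⟨_, rfl⟩
  have hCK : ∀ {C}, C ∈ C₁ ∨ C ∈ C₂ → ∀ {v}, v ∈ C → C = K v := by
    intro C h v hv
    obtain ⟨c, rfl⟩ := (hC C).1 h
    simp only [K]
    rw [SimpleGraph.ConnectedComponent.mem_supp_iff] at hv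
    rw [hv]
  have hCmod : ∀ {C}, C ∈ C₁ ∨ C ∈ C₂ → IsModule G C := by
    intro C h
    refine (hmod C).1 (isModule_of_adj_mem fun u hu v huv => ?_)
    rw [hCK h hu]
    exact memK.2 huv.symm.reachable
  have hdich : ∀ {M}, IsModule G M → ∀ {x}, x ∈ M → M ⊆ K x ∨ ∀ y ∈ M, K y ⊆ M := by
    intro M hM x hx
    by_cases h : M ⊆ K x
    · exact Or.inl h
    right
    obtain ⟨z, hz, hzx⟩ := Set.not_subset.1 h
    rw [memK] at hzx
    intro y hy w hw
    rw [memK] at hw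
    by_cases hyx : G'.Reachable y x
    · exact ((hmod M).2 hM).mem_of_reachable hy hz (fun h => hzx (h.symm.trans hyx)) hw.symm
    · exact ((hmod M).2 hM).mem_of_reachable hy hx hyx hw.symm
  have hsub : ∀ {M}, IsModule G M → 𝒢 ↥M (G.induce M) → ∀ {x}, x ∈ M → K x ∈ C₂ →
      M ⊆ K x := by
    intro M hM hM𝒢 x hx hxC
    refine (hdich hM hx).resolve_right fun h => hC2 _ hxC ?_
    exact h𝒢.induce_mono hM𝒢 (h x hx) ⟨x, hself x⟩
  subst hm
  apply le_antisymm
  · obtain ⟨Q, hQ, hQu, hQ𝒢, hQc⟩ := Nat.sInf_mem (s := {t | ∃ Q : Finset (Set V),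
        (∀ A ∈ Q, ∃ S : Set (Set V), (∀ C ∈ S, C ∈ C₁) ∧ S.Nonempty ∧ A = ⋃₀ S) ∧
        (∀ v : V, (∃ C ∈ C₁, v ∈ C) → ∃! A : Set V, A ∈ Q ∧ v ∈ A) ∧
        (∀ A ∈ Q, 𝒢 ↥A (G.induce A)) ∧
        Q.card = t}) ⟨_, C₁, fun A hA => ⟨{A}, by simpa using hA, by simp, by simp⟩, by
          rintro v ⟨C, hC', hv⟩
          refine ⟨C, ⟨hC', hv⟩, ?_⟩
          rintro D ⟨hD, hvD⟩
          rw [hCK (Or.inl hD) hvD, hCK (Or.inl hC') hv], hC1, rfl⟩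
    rw [← hQc]
    choose p hp hpc using fun C : Set V =>
      exists_isGModularPartition_card_eq_gmc h𝒢 (G.induce C)
    have hQK : ∀ A ∈ Q, ∀ v ∈ A, K v ∈ C₁ ∧ K v ⊆ A := by
      intro A hA v hv
      obtain ⟨S, hS, -, rfl⟩ := hQ A hA
      obtain ⟨C, hCS, hvC⟩ := hv
      have := hCK (Or.inl (hS C hCS)) hvC
      rw [← this]
      exact ⟨hS C hCS, Set.subset_sUnion_of_mem hCS⟩
    let R : Finset (Set V) := C₂.biUnion fun C => (p C).image (Subtype.val '' ·)
    have hR : ∀ A, A ∈ R ↔ ∃ C ∈ C₂, ∃ N ∈ p C, Subtype.val '' N = A := by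
      intro A
      simp [R]
    have hRK : ∀ A ∈ R, ∀ v ∈ A, K v ∈ C₂ := by
      intro A hA v hv
      obtain ⟨C, hC', N, hN, rfl⟩ := (hR A).1 hA
      obtain ⟨u, hu, rfl⟩ := hv
      rwa [← hCK (Or.inr hC') u.2]
    have hpart : IsGModularPartition 𝒢 G (Q ∪ R) := by
      refine ⟨?_, ?_, ?_, ?_⟩
      · intro v
        rcases hK v with hv | hv
        · obtain ⟨A, hA, hAu⟩ := hQu v ⟨_, hv, hself v⟩
          refine ⟨A, ⟨Finset.mem_union_left _ hA.1, hA.2⟩, ?_⟩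
          rintro B ⟨hB, hvB⟩
          rcases Finset.mem_union.1 hB with hB | hB
          · exact hAu B ⟨hB, hvB⟩
          · exact (hC12 _ hv (hRK B hB v hvB)).elim
        · obtain ⟨N, hN, hNu⟩ := (hp (K v)).1 ⟨v, hself v⟩
          refine ⟨Subtype.val '' N, ⟨Finset.mem_union_right _ ((hR _).2 ⟨_, hv, N, hN.1, rfl⟩),
            ⟨_, hN.2, rfl⟩⟩, ?_⟩
          rintro B ⟨hB, hvB⟩
          rcases Finset.mem_union.1 hB with hB | hB
          · exact (hC12 _ (hQK B hB v hvB).1 hv).elim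
          · obtain ⟨C, hC', N', hN', rfl⟩ := (hR B).1 hB
            obtain ⟨u, hu, huv⟩ := hvB
            obtain rfl : C = K v := hCK (Or.inr hC') (huv ▸ u.2)
            rw [hNu N' ⟨hN', by convert hu; exact huv.symm⟩]
      · intro A hA
        rcases Finset.mem_union.1 hA with hA | hA
        · obtain ⟨S, hS, ⟨C, hCS⟩, rfl⟩ := hQ A hA
          obtain ⟨c, rfl⟩ := (hC C).1 (Or.inl (hS C hCS))
          obtain ⟨v, hv⟩ := c.nonempty_supp
          exact ⟨v, _, hCS, hv⟩
        · obtain ⟨C, hC', N, hN, rfl⟩ := (hR A).1 hA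
          exact ((hp C).2.1 N hN).image _
      · intro A hA
        rcases Finset.mem_union.1 hA with hA | hA
        · refine (hmod A).1 (isModule_of_adj_mem fun u hu v huv => ?_)
          exact (hQK A hA u hu).2 (memK.2 huv.symm.reachable)
        · obtain ⟨C, hC', N, hN, rfl⟩ := (hR A).1 hA
          exact (hCmod (Or.inr hC')).image ((hp C).2.2.1 N hN)
      · intro A hA
        rcases Finset.mem_union.1 hA with hA | hA
        · exact hQ𝒢 A hA
        · obtain ⟨C, hC', N, hN, rfl⟩ := (hR A).1 hA
          exact (h𝒢.induce_image_iff G C N).2 ((hp C).2.2.2 N hN)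
    calc gmc 𝒢 G ≤ (Q ∪ R).card := gmc_le_card hpart
      _ ≤ Q.card + R.card := Finset.card_union_le _ _
      _ ≤ Q.card + ∑ C ∈ C₂, gmc 𝒢 (G.induce C) := by
        refine Nat.add_le_add_left (Finset.card_biUnion_le.trans (Finset.sum_le_sum ?_)) _
        intro C _
        rw [← hpc C]
        exact Finset.card_image_le
  · obtain ⟨P, ⟨hPu, hPne, hPmod, hP𝒢⟩, hPc⟩ := exists_isGModularPartition_card_eq_gmc h𝒢 G
    rw [← hPc]
    let P₁ := P.filter fun M => ∃ v ∈ M, K v ∈ C₁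
    let p : Set V → Finset (Set V) := fun C => P.filter (· ⊆ C)
    let sat : Set V → Set V := fun M => ⋃₀ (K '' M)
    have hsubsat : ∀ M, M ⊆ sat M := fun M x hx => ⟨K x, ⟨x, hx, rfl⟩, hself x⟩
    have hP₁ : ∀ M ∈ P₁, ∀ v ∈ M, K v ∈ C₁ := by
      intro M hM v hv
      obtain ⟨hMP, u, hu, huC⟩ := Finset.mem_filter.1 hM
      refine (hK v).resolve_right fun hvC => hC12 _ huC ?_
      rwa [← hKeq (hsub (hPmod M hMP) (hP𝒢 M hMP) hv hvC hu)]
    have hsat : ∀ M ∈ P, ∀ x ∈ M, sat M = K x ∨ sat M = M := by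
      intro M hM x hx
      refine (hdich (hPmod M hM) hx).imp (fun h => ?_) (fun h => ?_)
      · refine Set.Subset.antisymm ?_ (Set.subset_sUnion_of_mem ⟨x, hx, rfl⟩)
        rintro y ⟨_, ⟨z, hz, rfl⟩, hy⟩
        rwa [hKeq (h hz)]
      · refine Set.Subset.antisymm ?_ (hsubsat M)
        rintro y ⟨_, ⟨z, hz, rfl⟩, hy⟩
        exact h z hz hy
    have hQ : sInf {t | ∃ Q : Finset (Set V),
        (∀ A ∈ Q, ∃ S : Set (Set V), (∀ C ∈ S, C ∈ C₁) ∧ S.Nonempty ∧ A = ⋃₀ S) ∧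
        (∀ v : V, (∃ C ∈ C₁, v ∈ C) → ∃! A : Set V, A ∈ Q ∧ v ∈ A) ∧
        (∀ A ∈ Q, 𝒢 ↥A (G.induce A)) ∧
        Q.card = t} ≤ P₁.card := by
      refine le_trans (Nat.sInf_le ⟨P₁.image sat, ?_, ?_, ?_, rfl⟩) Finset.card_image_le
      · intro A hA
        obtain ⟨M, hM, rfl⟩ := Finset.mem_image.1 hA
        refine ⟨K '' M, ?_, (hPne M (Finset.mem_filter.1 hM).1).image _, rfl⟩
        rintro _ ⟨v, hv, rfl⟩
        exact hP₁ M hM v hv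
      · rintro v ⟨C, hC', hv⟩
        obtain rfl := hCK (Or.inl hC') hv
        obtain ⟨M, ⟨hM, hvM⟩, hMu⟩ := hPu v
        refine ⟨sat M, ⟨Finset.mem_image_of_mem _ (Finset.mem_filter.2 ⟨hM, v, hvM, hC'⟩),
          hsubsat M hvM⟩, ?_⟩
        rintro B ⟨hB, hvB⟩
        obtain ⟨N, hN, rfl⟩ := Finset.mem_image.1 hB
        have hNP := (Finset.mem_filter.1 hN).1
        by_cases hvN : v ∈ N
        · rw [hMu N ⟨hNP, hvN⟩]
        obtain ⟨_, ⟨z, hz, rfl⟩, hvz⟩ := hvB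
        have hNK : sat N = K v := by
          rcases hsat N hNP z hz with h | h
          · rw [h, hKeq hvz]
          · exact (hvN (h ▸ ⟨K z, ⟨z, hz, rfl⟩, hvz⟩)).elim
        rcases hsat M hM v hvM with h | h
        · rw [hNK, h]
        · have hzM : z ∈ M := h ▸ ⟨K v, ⟨v, hvM, rfl⟩, by rw [← hKeq hvz]; exact hself z⟩
          obtain ⟨L, -, hL⟩ := hPu z
          rw [hL M ⟨hM, hzM⟩, hL N ⟨hNP, hz⟩]
      · intro A hA
        obtain ⟨M, hM, rfl⟩ := Finset.mem_image.1 hA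
        obtain ⟨hMP, x, hx, hxC⟩ := Finset.mem_filter.1 hM
        rcases hsat M hMP x hx with h | h
        · rw [h]
          exact hC1 _ hxC
        · rw [h]
          exact hP𝒢 M hMP
    have hp : ∀ C ∈ C₂, gmc 𝒢 (G.induce C) ≤ (p C).card := by
      intro C hC'
      refine (gmc_le_card (P := (p C).image (Subtype.val ⁻¹' ·)) ⟨?_, ?_, ?_, ?_⟩).trans
        Finset.card_image_le
      · rintro ⟨v, hv⟩
        obtain ⟨M, ⟨hM, hvM⟩, hMu⟩ := hPu v
        obtain rfl := hCK (Or.inr hC') hv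
        refine ⟨Subtype.val ⁻¹' M, ⟨Finset.mem_image_of_mem _ (Finset.mem_filter.2
          ⟨hM, hsub (hPmod M hM) (hP𝒢 M hM) hvM hC'⟩), hvM⟩, ?_⟩
        rintro B ⟨hB, hvB⟩
        obtain ⟨N, hN, rfl⟩ := Finset.mem_image.1 hB
        rw [hMu N ⟨(Finset.mem_filter.1 hN).1, hvB⟩]
      all_goals
        intro A hA
        obtain ⟨M, hM, rfl⟩ := Finset.mem_image.1 hA
        obtain ⟨hMP, hMC⟩ := Finset.mem_filter.1 hM
      · obtain ⟨x, hx⟩ := hPne M hMP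
        exact ⟨⟨x, hMC hx⟩, hx⟩
      · exact (hPmod M hMP).preimage C
      · have himage : Subtype.val '' (Subtype.val ⁻¹' M : Set ↥C) = M := by simpa using hMC
        refine (h𝒢.induce_image_iff G C _).1 ?_
        rw [himage]
        exact hP𝒢 M hMP
    have hd₁ : Disjoint P₁ (C₂.biUnion p) := by
      rw [Finset.disjoint_left]
      intro M hM hM'
      obtain ⟨C, hC', hMC⟩ := Finset.mem_biUnion.1 hM'
      obtain ⟨hMP, x, hx, hxC⟩ := Finset.mem_filter.1 hM
      rw [← hCK (Or.inr hC') ((Finset.mem_filter.1 hMC).2 hx)] at hxC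
      exact hC12 C hxC hC'
    have hd₂ : (C₂ : Set (Set V)).PairwiseDisjoint p := by
      intro C hC' D hD hCD
      refine Finset.disjoint_left.2 fun M hM hM' => hCD ?_
      obtain ⟨hMP, hMC⟩ := Finset.mem_filter.1 hM
      obtain ⟨x, hx⟩ := hPne M hMP
      rw [hCK (Or.inr hC') (hMC hx), hCK (Or.inr hD) ((Finset.mem_filter.1 hM').2 hx)]
    calc _ ≤ P₁.card + ∑ C ∈ C₂, (p C).card := Nat.add_le_add hQ (Finset.sum_le_sum hp)
      _ = (P₁ ∪ C₂.biUnion p).card := by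
        rw [Finset.card_union_of_disjoint hd₁, Finset.card_biUnion hd₂]
      _ ≤ P.card := Finset.card_le_card (Finset.union_subset (Finset.filter_subset _ _)
        (Finset.biUnion_subset.2 fun C _ => Finset.filter_subset _ _))

end Stmt5
end

section
/- Let G be a finite simple graph whose complement is disconnected, let C_1, …, C_m (m ≥ 2) be the vertex sets of the connected components of the complement of G, and assume each G[C_i] is a cluster graph. Let A be the union of those C_i for which G[C_i] is a complete graph, and let B_1, …, B_t be the remaining sets among C_1, …, C_m. Then the partition of V(G) consisting of the parts B_1, …, B_t together with the part A (the part A being omitted when A is empty) is a cluster-merge of G, and it has minimum cardinality among all cluster-merges of G. -/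
namespace Stmt6

/-- A module of a graph: every outside vertex is adjacent to all or none of its vertices. -/
def IsModule {α : Type} (G : SimpleGraph α) (M : Set α) : Prop :=
  ∀ v ∉ M, (∀ u ∈ M, G.Adj v u) ∨ (∀ u ∈ M, ¬ G.Adj v u)

/-- A cluster graph: every connected component is a complete graph, i.e. any two
distinct vertices in the same component are adjacent. -/
def IsClusterGraph {α : Type} (W : SimpleGraph α) : Prop :=
  ∀ u v : α, W.Reachable u v → u ≠ v → W.Adj u v

/-- A cluster-merge of `G` (whose complement is disconnected, with each co-component
inducing a cluster graph): a partition of the vertices into modules, each inducing a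
cluster graph, such that each co-component is contained in a single part. -/
def IsClusterMerge {V : Type} (G : SimpleGraph V) (P : Finset (Set V)) : Prop :=
  (∀ v : V, ∃! M : Set V, M ∈ P ∧ v ∈ M) ∧
  (∀ M ∈ P, M.Nonempty) ∧
  (∀ M ∈ P, IsModule G M) ∧
  (∀ M ∈ P, IsClusterGraph (G.induce M)) ∧
  (∀ c : (Gᶜ).ConnectedComponent, ∃ M ∈ P, c.supp ⊆ M)

/-- Vertices in different co-components are adjacent. -/
theorem adj_of_mem_supp_of_notMem_supp {V : Type} {G : SimpleGraph V}
    {c : (Gᶜ).ConnectedComponent} {x y : V} (hx : x ∈ c.supp) (hy : y ∉ c.supp) :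
    G.Adj x y := by
  by_contra h
  have hxy : x ≠ y := by
    rintro rfl
    exact hy hx
  have hadj : (Gᶜ).Adj y x := (G.compl_adj y x).2 ⟨hxy.symm, fun h' => h h'.symm⟩
  rw [SimpleGraph.ConnectedComponent.mem_supp_iff] at hx hy
  exact hy ((SimpleGraph.ConnectedComponent.eq.2 hadj.reachable).trans hx)

/-- A union of co-components is a module. -/
theorem isModule_of_supp_subset {V : Type} {G : SimpleGraph V} {M : Set V}
    (hM : ∀ u ∈ M, ((Gᶜ).connectedComponentMk u).supp ⊆ M) : IsModule G M :=
  fun _ hv => Or.inl fun u hu =>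
    (adj_of_mem_supp_of_notMem_supp (c := (Gᶜ).connectedComponentMk u) rfl
      fun h => hv (hM u hu h)).symm

/-- A co-component contained in a set inducing a cluster graph, with a further vertex in that
set, is a clique. -/
theorem isClique_of_isClusterGraph_induce {V : Type} {G : SimpleGraph V} {N : Set V}
    (hN : IsClusterGraph (G.induce N)) {c : (Gᶜ).ConnectedComponent} (hc : c.supp ⊆ N)
    {z : V} (hz : z ∈ N) (hzc : z ∉ c.supp) :
    ∀ x ∈ c.supp, ∀ y ∈ c.supp, x ≠ y → G.Adj x y := by
  intro x hx y hy hxy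
  have hxz : (G.induce N).Adj ⟨x, hc hx⟩ ⟨z, hz⟩ :=
    SimpleGraph.induce_adj.2 (adj_of_mem_supp_of_notMem_supp hx hzc)
  have hyz : (G.induce N).Adj ⟨y, hc hy⟩ ⟨z, hz⟩ :=
    SimpleGraph.induce_adj.2 (adj_of_mem_supp_of_notMem_supp hy hzc)
  exact hN ⟨x, hc hx⟩ ⟨y, hc hy⟩ (hxz.reachable.trans hyz.symm.reachable)
    fun h => hxy (congrArg Subtype.val h)

/-- Each part of a cluster-merge is a union of co-components. -/
theorem IsClusterMerge.supp_subset {V : Type} {G : SimpleGraph V} {Q : Finset (Set V)}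
    (hQ : IsClusterMerge G Q) {N : Set V} (hN : N ∈ Q) {c : (Gᶜ).ConnectedComponent} {v : V}
    (hvc : v ∈ c.supp) (hvN : v ∈ N) : c.supp ⊆ N := by
  obtain ⟨N', hN', hc⟩ := hQ.2.2.2.2 c
  rwa [(hQ.1 v).unique ⟨hN, hvN⟩ ⟨hN', hc hvc⟩]

/-- let `G` be a graph whose complement is disconnected, each co-component
inducing a cluster graph.  Let `A` be the union of the co-components inducing complete
graphs.  Then the partition consisting of the remaining co-components as parts,
together with the part `A` (omitted when `A` is empty), is a minimum cluster-merge. -/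
theorem cluster_merge_min (V : Type) [Fintype V] [Nonempty V] (G : SimpleGraph V)
    (hdisc : ¬ (Gᶜ).Connected)
    (hclu : ∀ c : (Gᶜ).ConnectedComponent, IsClusterGraph (G.induce c.supp))
    (A : Set V)
    (hA : A = {v | ∃ c : (Gᶜ).ConnectedComponent, v ∈ c.supp ∧
        ∀ x ∈ c.supp, ∀ y ∈ c.supp, x ≠ y → G.Adj x y})
    (P : Finset (Set V))
    (hP : ∀ M : Set V, M ∈ P ↔ ((A.Nonempty ∧ M = A) ∨
        ∃ c : (Gᶜ).ConnectedComponent, M = c.supp ∧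
          ¬ (∀ x ∈ c.supp, ∀ y ∈ c.supp, x ≠ y → G.Adj x y))) :
    IsClusterMerge G P ∧ ∀ Q : Finset (Set V), IsClusterMerge G Q → P.card ≤ Q.card := by
  have hmemA : ∀ c : (Gᶜ).ConnectedComponent, ∀ v ∈ c.supp,
      (v ∈ A ↔ ∀ x ∈ c.supp, ∀ y ∈ c.supp, x ≠ y → G.Adj x y) := by
    intro c v hv
    rw [hA]
    refine ⟨?_, fun h => ⟨c, hv, h⟩⟩
    rintro ⟨d, hd, h⟩
    rw [SimpleGraph.ConnectedComponent.mem_supp_iff] at hv hd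
    rwa [← hv, hd]
  have hclosed : ∀ M ∈ P, ∀ c : (Gᶜ).ConnectedComponent, ∀ v ∈ c.supp, v ∈ M → c.supp ⊆ M := by
    intro M hM c v hvc hvM
    rcases (hP M).1 hM with ⟨-, rfl⟩ | ⟨d, rfl, -⟩
    · exact fun w hw => (hmemA c w hw).2 ((hmemA c v hvc).1 hvM)
    · rw [SimpleGraph.ConnectedComponent.mem_supp_iff] at hvc hvM
      rw [← hvc, hvM]
  have hdisj : ∀ M ∈ P, ∀ v ∈ M, ∀ d : (Gᶜ).ConnectedComponent, v ∈ d.supp →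
      ¬ (∀ x ∈ d.supp, ∀ y ∈ d.supp, x ≠ y → G.Adj x y) → M = d.supp := by
    intro M hM v hvM d hvd hd
    rcases (hP M).1 hM with ⟨-, rfl⟩ | ⟨e, rfl, -⟩
    · exact absurd ((hmemA d v hvd).1 hvM) hd
    · rw [SimpleGraph.ConnectedComponent.mem_supp_iff] at hvd hvM
      rw [← hvd, hvM]
  have hcover : ∀ c : (Gᶜ).ConnectedComponent, ∃ M ∈ P, c.supp ⊆ M := by
    intro c
    by_cases hc : ∀ x ∈ c.supp, ∀ y ∈ c.supp, x ≠ y → G.Adj x y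
    · have hcA : c.supp ⊆ A := fun w hw => (hmemA c w hw).2 hc
      exact ⟨A, (hP A).2 (Or.inl ⟨c.nonempty_supp.mono hcA, rfl⟩), hcA⟩
    · exact ⟨c.supp, (hP _).2 (Or.inr ⟨c, rfl, hc⟩), subset_rfl⟩
  have hnonempty : ∀ M ∈ P, M.Nonempty := by
    intro M hM
    rcases (hP M).1 hM with ⟨h, rfl⟩ | ⟨d, rfl, -⟩
    · exact h
    · exact d.nonempty_supp
  refine ⟨⟨?_, hnonempty, ?_, ?_, hcover⟩, ?_⟩
  · intro v
    obtain ⟨M, hM, hvM⟩ := hcover ((Gᶜ).connectedComponentMk v)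
    have hv : v ∈ ((Gᶜ).connectedComponentMk v).supp := rfl
    refine ⟨M, ⟨hM, hvM hv⟩, ?_⟩
    rintro M' ⟨hM', hvM'⟩
    rcases (hP M').1 hM' with ⟨-, rfl⟩ | ⟨d, rfl, hd⟩
    · rcases (hP M).1 hM with ⟨-, rfl⟩ | ⟨d, rfl, hd⟩
      · rfl
      · exact hdisj _ hM' v hvM' d (hvM hv) hd
    · exact (hdisj M hM v (hvM hv) d hvM' hd).symm
  · exact fun M hM => isModule_of_supp_subset fun u hu => hclosed M hM _ u rfl hu
  · intro M hM
    rcases (hP M).1 hM with ⟨-, rfl⟩ | ⟨d, rfl, -⟩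
    · rintro ⟨u, hu⟩ ⟨v, hv⟩ - huv
      have hne : u ≠ v := fun h => huv (Subtype.ext h)
      let c := (Gᶜ).connectedComponentMk u
      by_cases hvc : v ∈ c.supp
      · exact (hmemA c u rfl).1 hu u rfl v hvc hne
      · exact adj_of_mem_supp_of_notMem_supp (c := c) rfl hvc
    · exact hclu d
  · intro Q hQ
    have hmeet : ∀ N ∈ Q, ∀ M ∈ P, ∀ d : (Gᶜ).ConnectedComponent,
        ¬ (∀ x ∈ d.supp, ∀ y ∈ d.supp, x ≠ y → G.Adj x y) →
        (d.supp ∩ N).Nonempty → (M ∩ N).Nonempty → M = d.supp := by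
      rintro N hN M hM d hd ⟨v, hvd, hvN⟩ ⟨w, hwM, hwN⟩
      by_cases hwd : w ∈ d.supp
      · exact hdisj M hM w hwM d hwd hd
      · exact absurd (isClique_of_isClusterGraph_induce (hQ.2.2.2.1 N hN)
          (hQ.supp_subset hN hvd hvN) hwN hwd) hd
    refine Finset.card_le_card_of_forall_subsingleton (fun M N => (M ∩ N).Nonempty) ?_ ?_
    · intro M hM
      obtain ⟨v, hv⟩ := hnonempty M hM
      obtain ⟨N, ⟨hN, hvN⟩, -⟩ := hQ.1 v
      exact ⟨N, hN, v, hv, hvN⟩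
    · rintro N hN M ⟨hM, hMN⟩ M' ⟨hM', hMN'⟩
      rcases (hP M').1 hM' with ⟨-, rfl⟩ | ⟨d, rfl, hd⟩
      · rcases (hP M).1 hM with ⟨-, rfl⟩ | ⟨d, rfl, hd⟩
        · rfl
        · exact (hmeet N hN _ hM' d hd hMN hMN').symm
      · exact hmeet N hN M hM d hd hMN' hMN

end Stmt6
end

section
/- Let n ≥ 1 and let a_0 > a_1 > … > a_n > 1 and 0 = c_0 < c_1 < … < c_n be integers. Let G be the disjoint union consisting of, for each i ∈ {1, …, n}, exactly c_i − c_{i−1} copies of the star K_{1,a_{i−1}}, together with one copy of the star K_{1,a_n}. Then: (1) G has maximum degree a_0 and at most (c_n + 1)(a_0 + 1) vertices; (2) for each i ∈ {1, …, n} there exists X ⊆ V(G) with |X| = c_i such that the maximum degree of G − X equals a_i; (3) for each i ∈ {1, …, n} and every X ⊆ V(G) with |X| < c_i, the maximum degree of G − X is at least a_{i−1}. -/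
namespace Stmt7

/-- The disjoint union of `N` stars, the `j`-th having `L j` leaves: vertex `⟨j, 0⟩` is
the center of the `j`-th star and is adjacent exactly to the other vertices `⟨j, b⟩`. -/
def starForest (N : ℕ) (L : Fin N → ℕ) : SimpleGraph (Σ j : Fin N, Fin (L j + 1)) :=
  SimpleGraph.fromRel fun x y =>
    ∃ (j : Fin N) (b : Fin (L j + 1)), x = ⟨j, 0⟩ ∧ y = ⟨j, b⟩ ∧ b ≠ 0

/-- The number of leaves of the `j`-th star: `c i - c (i-1)` stars with `a (i-1)` leaves
for each `i ∈ {1, …, n}` (the stars indexed by `c (i-1) ≤ j < c i`), together with one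
extra star (index `j = c n`) with `a n` leaves. -/
noncomputable def leafCount (n : ℕ) (a c : ℕ → ℕ) (j : ℕ) : ℕ :=
  if j = c n then a n else a (sInf {i | j < c i} - 1)

/-- The vertex type of the degree-deletion star graph. -/
abbrev V7 (n : ℕ) (a c : ℕ → ℕ) : Type :=
  Σ j : Fin (c n + 1), Fin (leafCount n a c j.1 + 1)

/-- The degree-deletion star graph: for each `i ∈ {1, …, n}`, exactly `c i - c (i-1)`
stars with `a (i-1)` leaves, together with one star with `a n` leaves. -/
noncomputable def G7 (n : ℕ) (a c : ℕ → ℕ) : SimpleGraph (V7 n a c) :=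
  starForest (c n + 1) fun j => leafCount n a c j.1

lemma le_of_step_le {c : ℕ → ℕ} {n : ℕ} (hc : ∀ i, i < n → c i < c (i + 1)) {i k : ℕ}
    (hik : i ≤ k) (hk : k ≤ n) : c i ≤ c k := by
  induction k, hik using Nat.le_induction with
  | base => exact le_rfl
  | succ k _ ih => exact (ih (by omega)).trans (hc k (by omega)).le

lemma le_of_step_ge {a : ℕ → ℕ} {n : ℕ} (ha : ∀ i, i < n → a (i + 1) < a i) {i k : ℕ}
    (hik : i ≤ k) (hk : k ≤ n) : a k ≤ a i := by
  induction k, hik using Nat.le_induction with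
  | base => exact le_rfl
  | succ k _ ih => exact (ha k (by omega)).le.trans (ih (by omega))

lemma leafCount_le {n : ℕ} {a c : ℕ → ℕ} (ha : ∀ i, i < n → a (i + 1) < a i)
    (hc : ∀ i, i < n → c i < c (i + 1)) {i j : ℕ} (hi : i ≤ n) (hij : c i ≤ j)
    (hj : j ≤ c n) : leafCount n a c j ≤ a i := by
  unfold leafCount
  split_ifs with h
  · exact le_of_step_ge ha hi le_rfl
  · have hn : n ∈ {i | j < c i} := lt_of_le_of_ne hj h
    have hmem : j < c (sInf {i | j < c i}) := Nat.sInf_mem ⟨n, hn⟩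
    have hle : sInf {i | j < c i} ≤ n := Nat.sInf_le hn
    have hlt : i < sInf {i | j < c i} := by
      by_contra! hcon
      have := le_of_step_le hc hcon hi
      omega
    exact le_of_step_ge ha (by omega) (by omega)

lemma le_leafCount {n : ℕ} {a c : ℕ → ℕ} (ha : ∀ i, i < n → a (i + 1) < a i)
    (hc : ∀ i, i < n → c i < c (i + 1)) {i j : ℕ} (hi : i ≤ n) (hij : j < c i) :
    a (i - 1) ≤ leafCount n a c j := by
  have := le_of_step_le hc hi le_rfl
  have hle : sInf {i | j < c i} ≤ i := Nat.sInf_le hij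
  rw [leafCount, if_neg (by omega)]
  exact le_of_step_ge ha (by omega) (by omega)

lemma leafCount_apply {n : ℕ} {a c : ℕ → ℕ} (ha : ∀ i, i < n → a (i + 1) < a i)
    (hc : ∀ i, i < n → c i < c (i + 1)) {i : ℕ} (hi : i ≤ n) :
    leafCount n a c (c i) = a i := by
  rcases hi.eq_or_lt with rfl | hlt
  · simp [leafCount]
  · exact (leafCount_le ha hc hi le_rfl (le_of_step_le hc hi le_rfl)).antisymm
      (by simpa using le_leafCount ha hc hlt (hc i hlt))

section starForest

variable {N : ℕ} {L : Fin N → ℕ}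

lemma starForest_neighborSet_center (j : Fin N) :
    (starForest N L).neighborSet ⟨j, 0⟩ = Sigma.mk j '' {0}ᶜ := by
  ext ⟨k, b⟩
  simp only [starForest, SimpleGraph.mem_neighborSet, SimpleGraph.fromRel_adj, Set.mem_image,
    Set.mem_compl_iff, Set.mem_singleton_iff]
  constructor
  · rintro ⟨hne, ⟨i, d, h1, h2, hd⟩ | ⟨i, d, h1, h2, hd⟩⟩
    · cases h1
      exact ⟨d, hd, h2.symm⟩
    · cases h2
      exact absurd rfl hd
  · rintro ⟨d, hd, h⟩
    cases h
    refine ⟨fun h => hd ?_, Or.inl ⟨j, d, rfl, rfl, hd⟩⟩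
    simpa using h.symm

lemma ncard_starForest_neighborSet_center (j : Fin N) :
    ((starForest N L).neighborSet ⟨j, 0⟩).ncard = L j := by
  rw [starForest_neighborSet_center, Set.ncard_image_of_injective _ sigma_mk_injective,
    Set.ncard_compl]
  simp

lemma ncard_starForest_neighborSet_leaf_le_one {j : Fin N} {b : Fin (L j + 1)} (hb : b ≠ 0) :
    ((starForest N L).neighborSet ⟨j, b⟩).ncard ≤ 1 := by
  have hsub : (starForest N L).neighborSet ⟨j, b⟩ ⊆ {⟨j, 0⟩} := by
    rintro x ⟨_, ⟨i, d, h1, h2, hd⟩ | ⟨i, d, h1, h2, hd⟩⟩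
    · cases h1
      exact absurd rfl hb
    · cases h2
      exact h1
  simpa using Set.ncard_le_ncard hsub

end starForest

lemma ncard_induce_neighborSet_le {V : Type*} [Finite V] (G : SimpleGraph V) {s : Set V}
    (v : s) : ((G.induce s).neighborSet v).ncard ≤ (G.neighborSet v).ncard :=
  Set.ncard_le_ncard_of_injOn Subtype.val (fun _ hx => hx) Subtype.val_injective.injOn

lemma ncard_induce_neighborSet_eq {V : Type*} (G : SimpleGraph V) {s : Set V}
    (v : s) (h : G.neighborSet v ⊆ s) :
    ((G.induce s).neighborSet v).ncard = (G.neighborSet v).ncard := by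
  rw [← Set.ncard_image_of_injective _ Subtype.val_injective]
  congr 1
  ext x
  simpa using fun hx => h hx

lemma ncard_G7_induce_center {n : ℕ} {a c : ℕ → ℕ} (j : Fin (c n + 1)) {s : Set (V7 n a c)}
    (hs : ∀ b, (⟨j, b⟩ : V7 n a c) ∈ s) :
    (((G7 n a c).induce s).neighborSet ⟨⟨j, 0⟩, hs 0⟩).ncard = leafCount n a c j := by
  rw [ncard_induce_neighborSet_eq]
  · exact ncard_starForest_neighborSet_center j
  · change (starForest _ _).neighborSet ⟨j, 0⟩ ⊆ s
    rw [starForest_neighborSet_center]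
    rintro _ ⟨b, _, rfl⟩
    exact hs b

/-- the disjoint union of stars described above satisfies:
(1) it has maximum degree `a 0` and at most `(c n + 1) * (a 0 + 1)` vertices;
(2) for each `i ∈ {1, …, n}` some set `X` of `c i` vertices can be deleted so that the
maximum degree of the remaining graph equals `a i`;
(3) for each `i ∈ {1, …, n}`, after deleting fewer than `c i` vertices the maximum
degree of the remaining graph is at least `a (i-1)`. -/
theorem starForest_deletion_table (n : ℕ) (hn : 1 ≤ n) (a c : ℕ → ℕ)
    (ha : ∀ i, i < n → a (i + 1) < a i) (han : 1 < a n)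
    (hc0 : c 0 = 0) (hc : ∀ i, i < n → c i < c (i + 1)) :
    (∀ v : V7 n a c, ((G7 n a c).neighborSet v).ncard ≤ a 0) ∧
    (∃ v : V7 n a c, ((G7 n a c).neighborSet v).ncard = a 0) ∧
    Fintype.card (V7 n a c) ≤ (c n + 1) * (a 0 + 1) ∧
    (∀ i, 1 ≤ i → i ≤ n → ∃ X : Set (V7 n a c), X.ncard = c i ∧
      (∀ v, (((G7 n a c).induce Xᶜ).neighborSet v).ncard ≤ a i) ∧
      (∃ v, (((G7 n a c).induce Xᶜ).neighborSet v).ncard = a i)) ∧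
    (∀ i, 1 ≤ i → i ≤ n → ∀ X : Set (V7 n a c), X.ncard < c i →
      ∃ v, a (i - 1) ≤ (((G7 n a c).induce Xᶜ).neighborSet v).ncard) := by
  have hone : ∀ i, i ≤ n → 1 ≤ a i := fun i hi => by
    have := le_of_step_ge ha hi le_rfl
    omega
  have hcn : ∀ i, i ≤ n → c i ≤ c n := fun i hi => le_of_step_le hc hi le_rfl
  have hleaf : ∀ j : Fin (c n + 1), leafCount n a c j ≤ a 0 := fun j =>
    leafCount_le ha hc (Nat.zero_le n) (by omega) (by omega)
  refine ⟨?_, ?_, ?_, ?_, ?_⟩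
  · rintro ⟨j, b⟩
    by_cases hb : b = 0
    · subst hb
      exact (ncard_starForest_neighborSet_center j).trans_le (hleaf j)
    · exact (ncard_starForest_neighborSet_leaf_le_one hb).trans (hone 0 (Nat.zero_le n))
  · refine ⟨⟨⟨c 0, by have := hcn 0 (Nat.zero_le n); omega⟩, 0⟩, ?_⟩
    exact (ncard_starForest_neighborSet_center _).trans (leafCount_apply ha hc (Nat.zero_le n))
  · rw [Fintype.card_sigma]
    calc _ ≤ ∑ _j : Fin (c n + 1), (a 0 + 1) :=
          Finset.sum_le_sum fun j _ => by simpa using hleaf j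
      _ = _ := by simp
  · intro i _ hi
    have hlt : c i < c n + 1 := Nat.lt_succ_of_le (hcn i hi)
    let center : Fin (c n + 1) → V7 n a c := fun j => ⟨j, 0⟩
    have hinj : Function.Injective center := fun _ _ h => congrArg Sigma.fst h
    refine ⟨center '' Set.Iio ⟨c i, hlt⟩, ?_, ?_, ?_⟩
    · rw [Set.ncard_image_of_injective _ hinj, Set.ncard_eq_toFinset_card']
      simp
    · rintro ⟨⟨j, b⟩, hv⟩
      refine (ncard_induce_neighborSet_le _ _).trans ?_
      by_cases hb : b = 0
      · subst hb
        refine (ncard_starForest_neighborSet_center j).trans_le ?_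
        refine leafCount_le ha hc hi ?_ (by omega)
        by_contra! hcon
        exact hv ⟨j, hcon, rfl⟩
      · exact (ncard_starForest_neighborSet_leaf_le_one hb).trans (hone i hi)
    · refine ⟨_, (ncard_G7_induce_center ⟨c i, hlt⟩ ?_).trans (leafCount_apply ha hc hi)⟩
      rintro b ⟨j, hj, h⟩
      exact (Set.mem_Iio.mp hj).ne (congrArg Sigma.fst h)
  · intro i _ hi X hX
    have hlt : c i < c n + 1 := Nat.lt_succ_of_le (hcn i hi)
    obtain ⟨j, hj, hjX⟩ : ∃ j ∈ Set.Iio (⟨c i, hlt⟩ : Fin (c n + 1)), j ∉ Sigma.fst '' X := by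
      refine Set.exists_mem_notMem_of_ncard_lt_ncard ?_
      rw [Set.ncard_eq_toFinset_card' (Set.Iio _)]
      simpa using (Set.ncard_image_le X.toFinite).trans_lt hX
    refine ⟨_, (le_leafCount ha hc hi hj).trans_eq
      (ncard_G7_induce_center j (s := Xᶜ) fun b hb => hjX ⟨_, hb, rfl⟩).symm⟩

end Stmt7
end

section
/- Let n ≥ 1 and let a_0 > a_1 > … > a_n > 100 and c_0 > c_1 > … > c_n = 0 be integers. Let G be the disjoint union consisting of, for each i ∈ {1, …, n}, exactly c_{i−1} − c_i copies of the star K_{1,a_i}, together with one copy of the star K_{1,a_0}, and let p = a_0 + Σ_{i=1}^{n} (c_{i−1} − c_i)·a_i be the total number of leaves of G. Then: (1) G has maximum degree a_0 and at most (c_0 + 1)(a_0 + 1) vertices; (2) for each i ∈ {0, 1, …, n} there exists X ⊊ V(G) with |X| = p + c_i such that δ(G − X, X) = a_i; (3) for each i ∈ {0, 1, …, n} and every X ⊊ V(G) with |X| < p + c_i, δ(G − X, X) ≤ a_{i+1}, where a_{n+1} := 1. -/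
namespace Stmt8

/-- The disjoint union of `N` stars, the `j`-th having `L j` leaves: vertex `⟨j, 0⟩` is
the center of the `j`-th star and is adjacent exactly to the other vertices `⟨j, b⟩`. -/
def starForest (N : ℕ) (L : Fin N → ℕ) : SimpleGraph (Σ j : Fin N, Fin (L j + 1)) :=
  SimpleGraph.fromRel fun x y =>
    ∃ (j : Fin N) (b : Fin (L j + 1)), x = ⟨j, 0⟩ ∧ y = ⟨j, b⟩ ∧ b ≠ 0

/-- The number of leaves of the `j`-th star: `c (i-1) - c i` stars with `a i` leaves for
each `i ∈ {1, …, n}` (the stars indexed by `c i ≤ j < c (i-1)`), together with one extra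
star (index `j = c 0`) with `a 0` leaves. -/
noncomputable def leafCount8 (a c : ℕ → ℕ) (j : ℕ) : ℕ :=
  if j = c 0 then a 0 else a (sInf {i | c i ≤ j})

/-- The vertex type of the degree-retention star graph. -/
abbrev V8 (a c : ℕ → ℕ) : Type :=
  Σ j : Fin (c 0 + 1), Fin (leafCount8 a c j.1 + 1)

/-- The degree-retention star graph: for each `i ∈ {1, …, n}`, exactly `c (i-1) - c i`
stars with `a i` leaves, together with one star with `a 0` leaves. -/
noncomputable def G8 (a c : ℕ → ℕ) : SimpleGraph (V8 a c) :=
  starForest (c 0 + 1) fun j => leafCount8 a c j.1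

theorem le_of_forall_succ_lt {f : ℕ → ℕ} {n i k : ℕ} (hf : ∀ i, i < n → f (i + 1) < f i)
    (hik : i ≤ k) (hk : k ≤ n) : f k ≤ f i := by
  induction k, hik using Nat.le_induction with
  | base => exact le_rfl
  | succ k _ ih => exact (hf k hk).le.trans (ih (by omega))

section StarForest

variable {N : ℕ} {L : Fin N → ℕ}

theorem starForest_adj_iff (x y : Σ j : Fin N, Fin (L j + 1)) :
    (starForest N L).Adj x y ↔ x.1 = y.1 ∧ (x.2 = 0 ∧ y.2 ≠ 0 ∨ x.2 ≠ 0 ∧ y.2 = 0) := by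
  obtain ⟨j, b⟩ := x
  obtain ⟨k, d⟩ := y
  rw [starForest, SimpleGraph.fromRel_adj]
  constructor
  · rintro ⟨-, ⟨i, e, h1, h2, he⟩ | ⟨i, e, h1, h2, he⟩⟩ <;> cases h1 <;> cases h2
    · exact ⟨rfl, Or.inl ⟨rfl, he⟩⟩
    · exact ⟨rfl, Or.inr ⟨he, rfl⟩⟩
  · rintro ⟨h, h'⟩
    dsimp only at h
    subst h
    rcases h' with ⟨h1, h2⟩ | ⟨h1, h2⟩ <;> dsimp only at h1 h2
    · obtain rfl : b = 0 := h1
      exact ⟨fun h => h2 (by simpa using h.symm), Or.inl ⟨j, d, rfl, rfl, h2⟩⟩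
    · obtain rfl : d = 0 := h2
      exact ⟨fun h => h1 (by simpa using h), Or.inr ⟨j, b, rfl, rfl, h1⟩⟩

theorem ncard_neighborSet_starForest_center (j : Fin N) :
    ((starForest N L).neighborSet ⟨j, 0⟩).ncard = L j := by
  have h : (starForest N L).neighborSet ⟨j, 0⟩ =
      Sigma.mk j '' (({0} : Set (Fin (L j + 1)))ᶜ) := by
    ext ⟨k, d⟩
    rw [SimpleGraph.mem_neighborSet, starForest_adj_iff]
    constructor
    · rintro ⟨h, h'⟩
      dsimp only at h
      subst h
      exact ⟨d, by simpa using h', rfl⟩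
    · rintro ⟨e, he, h⟩
      cases h
      exact ⟨rfl, Or.inl ⟨rfl, he⟩⟩
  rw [h, Set.ncard_image_of_injective _ sigma_mk_injective, Set.ncard_compl]
  simp

theorem ncard_neighborSet_starForest_leaf_le (j : Fin N) {b : Fin (L j + 1)} (hb : b ≠ 0) :
    ((starForest N L).neighborSet ⟨j, b⟩).ncard ≤ 1 := by
  refine (Set.ncard_le_ncard (t := {⟨j, 0⟩}) ?_ (Set.toFinite _)).trans
    (Set.ncard_singleton _).le
  rintro ⟨k, d⟩ h
  rw [SimpleGraph.mem_neighborSet, starForest_adj_iff] at h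
  obtain ⟨h, h'⟩ := h
  dsimp only at h
  subst h
  simpa [hb] using h'

/-- All leaves of a star forest, together with the centers of its first `k` stars. -/
def leavesAndCenters (L : Fin N → ℕ) (k : ℕ) : Set (Σ j : Fin N, Fin (L j + 1)) :=
  {v | v.2 ≠ 0 ∨ v.1.1 < k}

theorem ncard_leavesAndCenters {k : ℕ} (hk : k ≤ N) :
    (leavesAndCenters L k).ncard = ∑ j, L j + k := by
  have h : leavesAndCenters L k = ((Finset.univ.sigma fun j : Fin N =>
      if j.1 < k then Finset.univ else Finset.univ.erase (0 : Fin (L j + 1)) :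
      Finset (Σ j : Fin N, Fin (L j + 1))) : Set (Σ j : Fin N, Fin (L j + 1))) := by
    ext ⟨j, b⟩
    by_cases hj : j.1 < k <;> simp [leavesAndCenters, hj]
  rw [h, Set.ncard_coe_finset, Finset.card_sigma]
  have h1 : ∀ j : Fin N, (if j.1 < k then Finset.univ
      else Finset.univ.erase (0 : Fin (L j + 1))).card = L j + if j.1 < k then 1 else 0 := by
    intro j
    split_ifs <;> simp
  rw [Finset.sum_congr rfl fun j _ => h1 j, Finset.sum_add_distrib,
    Fin.sum_univ_eq_sum_range (fun j => if j < k then 1 else 0), Finset.sum_boole]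
  have h2 : (Finset.range N).filter (· < k) = Finset.range k := by
    ext j
    simp only [Finset.mem_filter, Finset.mem_range]
    omega
  simp [h2]

theorem ncard_neighborSet_starForest_inter_leavesAndCenters (j : Fin N) (k : ℕ) :
    ((starForest N L).neighborSet ⟨j, 0⟩ ∩ leavesAndCenters L k).ncard = L j := by
  rw [Set.inter_eq_left.mpr, ncard_neighborSet_starForest_center]
  intro y hy
  rw [SimpleGraph.mem_neighborSet, starForest_adj_iff] at hy
  exact Or.inl (by simpa using hy.2)

end StarForest

section LeafCount

variable {n : ℕ} {a c : ℕ → ℕ}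

theorem leafCount8_top : leafCount8 a c (c 0) = a 0 := if_pos rfl

theorem leafCount8_of_mem (hc : ∀ i, i < n → c (i + 1) < c i) {i j : ℕ} (hi : i < n)
    (hj : c (i + 1) ≤ j) (hj' : j < c i) : leafCount8 a c j = a (i + 1) := by
  have h0 : c i ≤ c 0 := le_of_forall_succ_lt hc (Nat.zero_le i) hi.le
  rw [leafCount8, if_neg (by omega)]
  congr 1
  refine le_antisymm (Nat.sInf_le hj) (le_csInf ⟨_, hj⟩ fun k (hk : c k ≤ j) => ?_)
  by_contra! hki
  have := le_of_forall_succ_lt hc (Nat.le_of_lt_succ hki) hi.le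
  omega

theorem exists_mem_level (hcn : c n = 0) {j : ℕ} (hj : j < c 0) :
    ∃ i < n, c (i + 1) ≤ j ∧ j < c i := by
  classical
  have hex : ∃ i, c i ≤ j := ⟨n, by omega⟩
  have hpos : Nat.find hex ≠ 0 := fun h => by
    have := Nat.find_spec hex
    rw [h] at this
    omega
  obtain ⟨i, hi⟩ := Nat.exists_eq_succ_of_ne_zero hpos
  have hn : Nat.find hex ≤ n := Nat.find_min' hex (by omega)
  have hmin := Nat.find_min hex (m := i) (by omega)
  have hspec := Nat.find_spec hex
  rw [hi] at hspec
  exact ⟨i, by omega, hspec, by omega⟩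

theorem leafCount8_of_eq (hc : ∀ i, i < n → c (i + 1) < c i) {i : ℕ} (hi : i ≤ n) :
    leafCount8 a c (c i) = a i := by
  cases i with
  | zero => exact leafCount8_top
  | succ i => exact leafCount8_of_mem hc hi le_rfl (hc i hi)

theorem le_leafCount8 (ha : ∀ i, i < n → a (i + 1) < a i) (hc : ∀ i, i < n → c (i + 1) < c i)
    (hcn : c n = 0) {i j : ℕ} (hi : i ≤ n) (hj : c i ≤ j) (hj' : j ≤ c 0) :
    a i ≤ leafCount8 a c j := by
  rcases hj'.eq_or_lt with rfl | hlt
  · rw [leafCount8_top]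
    exact le_of_forall_succ_lt ha (Nat.zero_le i) hi
  · obtain ⟨k, hk, hkj, hjk⟩ := exists_mem_level hcn hlt
    rw [leafCount8_of_mem hc hk hkj hjk]
    refine le_of_forall_succ_lt ha ?_ hi
    by_contra! hik
    have := le_of_forall_succ_lt hc (Nat.le_of_lt_succ hik) hk.le
    omega

theorem leafCount8_le (ha : ∀ i, i < n → a (i + 1) < a i) (hc : ∀ i, i < n → c (i + 1) < c i)
    (hcn : c n = 0) {i j : ℕ} (hi : i ≤ n) (hj : j < c i) :
    leafCount8 a c j ≤ a (i + 1) := by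
  have h0 := le_of_forall_succ_lt hc (Nat.zero_le i) hi
  obtain ⟨k, hk, hkj, hjk⟩ := exists_mem_level hcn (hj.trans_le h0)
  rw [leafCount8_of_mem hc hk hkj hjk]
  refine le_of_forall_succ_lt ha ?_ hk
  by_contra! hki
  have := le_of_forall_succ_lt hc (Nat.le_of_lt_succ hki) hi
  omega

theorem leafCount8_le_top (ha : ∀ i, i < n → a (i + 1) < a i)
    (hc : ∀ i, i < n → c (i + 1) < c i) (hcn : c n = 0) {j : ℕ} (hj : j ≤ c 0) :
    leafCount8 a c j ≤ a 0 := by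
  rcases hj.eq_or_lt with rfl | hlt
  · exact leafCount8_top.le
  · obtain ⟨k, hk, hkj, hjk⟩ := exists_mem_level hcn hlt
    rw [leafCount8_of_mem hc hk hkj hjk]
    exact le_of_forall_succ_lt ha (Nat.zero_le _) hk

theorem sum_Ico_leafCount8 (hc : ∀ i, i < n → c (i + 1) < c i) {m : ℕ} (hm : m ≤ n) :
    ∑ j ∈ Finset.Ico (c m) (c 0), leafCount8 a c j =
      ∑ i ∈ Finset.Icc 1 m, (c (i - 1) - c i) * a i := by
  induction m with
  | zero => simp
  | succ m ih =>
    have h0 : c m ≤ c 0 := le_of_forall_succ_lt hc (Nat.zero_le m) (by omega)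
    rw [← Finset.sum_Ico_consecutive _ (hc m hm).le h0, ih (by omega),
      Finset.sum_Icc_succ_top (by omega), add_comm]
    congr 1
    rw [Finset.sum_congr rfl fun j hj => leafCount8_of_mem hc hm
      (Finset.mem_Ico.mp hj).1 (Finset.mem_Ico.mp hj).2]
    simp

theorem sum_leafCount8 (hc : ∀ i, i < n → c (i + 1) < c i) (hcn : c n = 0) :
    ∑ j : Fin (c 0 + 1), leafCount8 a c j.1 =
      a 0 + ∑ i ∈ Finset.Icc 1 n, (c (i - 1) - c i) * a i := by
  rw [Fin.sum_univ_eq_sum_range (leafCount8 a c), Finset.sum_range_succ, leafCount8_top,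
    ← sum_Ico_leafCount8 hc le_rfl, hcn, Finset.range_eq_Ico, add_comm]

end LeafCount

/-- the disjoint union of stars described above, where
`p = a 0 + ∑_{i=1}^{n} (c (i-1) - c i) * a i` is its total number of leaves, satisfies:
(1) it has maximum degree `a 0` and at most `(c 0 + 1) * (a 0 + 1)` vertices;
(2) for each `i ∈ {0, …, n}` there is a proper vertex subset `X` of size `p + c i` such
that the minimum over the remaining vertices of the number of their neighbours inside
`X` equals `a i`;
(3) for each `i ∈ {0, …, n}` and every proper vertex subset `X` of size `< p + c i`,
some remaining vertex has at most `a (i+1)` neighbours inside `X` (with `a (n+1) := 1`). -/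
theorem starForest_retention_table (n : ℕ) (hn : 1 ≤ n) (a c : ℕ → ℕ)
    (ha : ∀ i, i < n → a (i + 1) < a i) (han : 100 < a n)
    (hcn : c n = 0) (hc : ∀ i, i < n → c (i + 1) < c i)
    (p : ℕ) (hp : p = a 0 + ∑ i ∈ Finset.Icc 1 n, (c (i - 1) - c i) * a i) :
    (∀ v : V8 a c, ((G8 a c).neighborSet v).ncard ≤ a 0) ∧
    (∃ v : V8 a c, ((G8 a c).neighborSet v).ncard = a 0) ∧
    Fintype.card (V8 a c) ≤ (c 0 + 1) * (a 0 + 1) ∧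
    (∀ i, i ≤ n → ∃ X : Set (V8 a c), X ≠ Set.univ ∧ X.ncard = p + c i ∧
      (∀ v ∉ X, a i ≤ ((G8 a c).neighborSet v ∩ X).ncard) ∧
      (∃ v ∉ X, ((G8 a c).neighborSet v ∩ X).ncard = a i)) ∧
    (∀ i, i ≤ n → ∀ X : Set (V8 a c), X ≠ Set.univ → X.ncard < p + c i →
      ∃ v ∉ X, ((G8 a c).neighborSet v ∩ X).ncard ≤ (if i = n then 1 else a (i + 1))) := by
  have hsum : ∑ j : Fin (c 0 + 1), leafCount8 a c j.1 = p :=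
    (sum_leafCount8 hc hcn).trans hp.symm
  have hcard : ∀ i ≤ n, (leavesAndCenters (fun j : Fin (c 0 + 1) => leafCount8 a c j.1)
      (c i)).ncard = p + c i := fun i hi => by
    rw [ncard_leavesAndCenters
      ((le_of_forall_succ_lt hc (Nat.zero_le i) hi).trans (Nat.le_succ _)), hsum]
  have hL : ∀ j : Fin (c 0 + 1), leafCount8 a c j.1 ≤ a 0 := fun j =>
    leafCount8_le_top ha hc hcn (Nat.le_of_lt_succ j.2)
  have ha0 : 100 < a 0 := han.trans_le (le_of_forall_succ_lt ha (Nat.zero_le n) le_rfl)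
  refine ⟨?_, ⟨⟨Fin.last (c 0), 0⟩, ?_⟩, ?_, fun i hi => ?_, fun i hi X _ hX => ?_⟩
  · rintro ⟨j, b⟩
    by_cases hb : b = 0
    · subst hb
      exact (ncard_neighborSet_starForest_center j).trans_le (hL j)
    · exact (ncard_neighborSet_starForest_leaf_le j hb).trans (by omega)
  · exact (ncard_neighborSet_starForest_center _).trans leafCount8_top
  · rw [Fintype.card_sigma]
    calc ∑ j : Fin (c 0 + 1), Fintype.card (Fin (leafCount8 a c j.1 + 1))
        ≤ ∑ _j : Fin (c 0 + 1), (a 0 + 1) :=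
          Finset.sum_le_sum fun j _ => by simpa using hL j
      _ = (c 0 + 1) * (a 0 + 1) := by simp
  · have hci : c i < c 0 + 1 := Nat.lt_succ_of_le (le_of_forall_succ_lt hc (Nat.zero_le i) hi)
    have hmem : (⟨⟨c i, hci⟩, 0⟩ : V8 a c) ∉ leavesAndCenters
        (fun j : Fin (c 0 + 1) => leafCount8 a c j.1) (c i) := by
      simp [leavesAndCenters]
    refine ⟨leavesAndCenters _ (c i), fun h => hmem (h ▸ Set.mem_univ _), hcard i hi, ?_,
      ⟨⟨c i, hci⟩, 0⟩, hmem, ?_⟩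
    · rintro ⟨j, b⟩ hv
      obtain ⟨hb, hj⟩ := not_or.mp hv
      obtain rfl : b = 0 := not_not.mp hb
      exact (le_leafCount8 ha hc hcn hi (not_lt.mp hj) (Nat.le_of_lt_succ j.2)).trans_eq
        (ncard_neighborSet_starForest_inter_leavesAndCenters
          (L := fun j : Fin (c 0 + 1) => leafCount8 a c j.1) j (c i)).symm
    · exact (ncard_neighborSet_starForest_inter_leavesAndCenters _ (c i)).trans
        (leafCount8_of_eq hc hi)
  · by_contra! hcon
    refine absurd hX (not_lt.mpr ((hcard i hi).symm.trans_le
      (Set.ncard_le_ncard ?_ (Set.toFinite _))))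
    rintro ⟨j, b⟩ hv
    by_contra hvX
    have hlt := (hcon _ hvX).trans_le (Set.ncard_le_ncard Set.inter_subset_left (Set.toFinite _))
    by_cases hb : b = 0
    · subst hb
      have hj : j.1 < c i := hv.resolve_left fun h => h rfl
      have hin : i ≠ n := by
        rintro rfl
        omega
      rw [if_neg hin] at hlt
      exact absurd (hlt.trans_eq (ncard_neighborSet_starForest_center j))
        (not_lt.mpr (leafCount8_le ha hc hcn hi hj))
    · have hone : 1 ≤ if i = n then 1 else a (i + 1) := by
        split_ifs with h
        · exact le_rfl
        · have := le_of_forall_succ_lt ha (show i + 1 ≤ n by omega) le_rfl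
          omega
      exact absurd (hlt.trans_le (ncard_neighborSet_starForest_leaf_le j hb)) (not_lt.mpr hone)

end Stmt8
end

section
/- Let n ≥ 1 and let a_0 > a_1 > … > a_n > 1 and 0 = c_0 < c_1 < … < c_n be integers. Let G be a finite graph each of whose connected components is a star, with maximum degree a_0, such that: for every i ∈ {1, …, n} there exists X ⊆ V(G) with |X| = c_i and Δ(G − X) ≤ a_i, and for every i ∈ {1, …, n} and every X ⊆ V(G) with |X| < c_i one has Δ(G − X) ≥ a_{i−1}. Then for each i ∈ {1, …, n}, the number of connected components of G having exactly a_{i−1} leaves is c_i − c_{i−1}; moreover, every connected component of G has either at most a_n leaves or exactly a_{i−1} leaves for some i ∈ {1, …, n}. -/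
namespace Stmt9

/-- A star forest: every connected component is a star, i.e. the component of every
vertex contains a center incident to all edges of that component. -/
def IsStarForest {α : Type} (G : SimpleGraph α) : Prop :=
  ∀ v : α, ∃ u : α, G.Reachable v u ∧
    ∀ x y : α, G.Adj x y → G.Reachable x u → (x = u ∨ y = u)

/-- Every component of a star forest has a center: a vertex of the component incident to all of
its edges, hence adjacent to all its other vertices. -/
theorem IsStarForest.exists_center {V : Type} {G : SimpleGraph V} (h : IsStarForest G)
    (C : G.ConnectedComponent) :
    ∃ u ∈ C.supp, (∀ x y, G.Adj x y → x ∈ C.supp → x = u ∨ y = u) ∧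
      ∀ y ∈ C.supp, y ≠ u → G.Adj u y := by
  induction C using SimpleGraph.ConnectedComponent.ind with | _ v
  obtain ⟨u, hvu, hu⟩ := h v
  simp only [SimpleGraph.ConnectedComponent.mem_supp_iff, SimpleGraph.ConnectedComponent.eq]
  refine ⟨u, hvu.symm, fun x y hxy hx => hu x y hxy (hx.trans hvu), fun y hy hne => ?_⟩
  have hyu : G.Reachable y u := hy.trans hvu
  obtain ⟨p⟩ := id hyu
  cases p with
  | nil => exact absurd rfl hne
  | cons hadj _ =>
    rcases hu _ _ hadj hyu with rfl | rfl
    · exact absurd rfl hne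
    · exact hadj.symm

/-- The components with more than `t + 1` vertices. -/
def largeComponents {V : Type} (G : SimpleGraph V) (t : ℕ) : Set G.ConnectedComponent :=
  {C | t + 1 < C.supp.ncard}

theorem largeComponents_anti {V : Type} (G : SimpleGraph V) : Antitone (largeComponents G) :=
  fun _ _ hst _ hC => (Nat.add_le_add_right hst 1).trans_lt hC

theorem ncard_largeComponents_le {V : Type} [Finite V] {G : SimpleGraph V} (h : IsStarForest G)
    {t : ℕ} (X : Set V) (hX : ∀ v, ((G.induce Xᶜ).neighborSet v).ncard ≤ t) :
    (largeComponents G t).ncard ≤ X.ncard := by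
  have hsub : largeComponents G t ⊆ G.connectedComponentMk '' X := by
    intro C hC
    by_contra hCX
    have hdisj : ∀ x ∈ C.supp, x ∈ Xᶜ := fun x hx hxX => hCX ⟨x, hxX, hx⟩
    obtain ⟨u, huC, -, hu⟩ := h.exists_center C
    let w : (Xᶜ : Set V) := ⟨u, hdisj u huC⟩
    have hsupp : C.supp ⊆ insert u (Subtype.val '' (G.induce Xᶜ).neighborSet w) := by
      intro y hy
      by_cases hyu : y = u
      · exact Or.inl hyu
      · exact Or.inr ⟨⟨y, hdisj y hy⟩, hu y hy hyu, rfl⟩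
    have hle := (Set.ncard_le_ncard hsupp (Set.toFinite _)).trans (Set.ncard_insert_le _ _)
    rw [Set.ncard_image_of_injective _ Subtype.val_injective] at hle
    exact absurd (hle.trans (Nat.add_le_add_right (hX w) 1)) (not_le.mpr hC)
  exact (Set.ncard_le_ncard hsub (Set.toFinite _)).trans (Set.ncard_image_le (Set.toFinite _))

theorem exists_ncard_le_ncard_largeComponents {V : Type} [Finite V] {G : SimpleGraph V}
    (h : IsStarForest G) (t : ℕ) :
    ∃ X : Set V, X.ncard ≤ (largeComponents G t).ncard ∧
      ∀ v, ((G.induce Xᶜ).neighborSet v).ncard ≤ t := by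
  choose center hmem hedge _ using h.exists_center
  refine ⟨center '' largeComponents G t, Set.ncard_image_le (Set.toFinite _), ?_⟩
  rintro ⟨v, hv⟩
  rw [← Set.ncard_image_of_injective _ Subtype.val_injective]
  by_cases hC : G.connectedComponentMk v ∈ largeComponents G t
  · rw [(Set.ncard_eq_zero (Set.toFinite _)).mpr]
    · exact Nat.zero_le t
    · rw [Set.image_eq_empty, Set.eq_empty_iff_forall_notMem]
      rintro ⟨y, hy⟩ hvy
      rcases hedge _ v y hvy rfl with hvc | hyc
      · exact hv ⟨_, hC, hvc.symm⟩
      · exact hy ⟨_, hC, hyc.symm⟩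
  · have hsub : insert v (Subtype.val '' (G.induce (center '' largeComponents G t)ᶜ).neighborSet
        ⟨v, hv⟩) ⊆ (G.connectedComponentMk v).supp := by
      rintro _ (rfl | ⟨y, hvy, rfl⟩)
      · rfl
      · exact SimpleGraph.ConnectedComponent.sound (SimpleGraph.Adj.reachable hvy).symm
    have hle := Set.ncard_le_ncard hsub (Set.toFinite _)
    rw [Set.ncard_insert_of_notMem _ (Set.toFinite _)] at hle
    · exact Nat.le_of_succ_le_succ (hle.trans (not_lt.mp hC))
    · rintro ⟨y, hvy, rfl⟩
      exact G.loopless.irrefl _ hvy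

/-- let `G` be a finite disjoint union of stars with maximum degree `a 0`
such that for every `i ∈ {1, …, n}` one can delete `c i` vertices reaching maximum
degree at most `a i`, while fewer than `c i` deletions always leave maximum degree at
least `a (i-1)`.  Then for each `i ∈ {1, …, n}` the number of components with exactly
`a (i-1)` leaves (i.e. `a (i-1) + 1` vertices) is `c i - c (i-1)`; moreover every
component has at most `a n` leaves or exactly `a (i-1)` leaves for some `i`. -/
theorem degree_deletion_star_structure (V : Type) [Fintype V] (G : SimpleGraph V)
    (n : ℕ) (hn : 1 ≤ n) (a c : ℕ → ℕ)
    (ha : ∀ i, i < n → a (i + 1) < a i) (han : 1 < a n)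
    (hc0 : c 0 = 0) (hc : ∀ i, i < n → c i < c (i + 1))
    (hstar : IsStarForest G)
    (hmax1 : ∀ v : V, (G.neighborSet v).ncard ≤ a 0)
    (hmax2 : ∃ v : V, (G.neighborSet v).ncard = a 0)
    (hdel : ∀ i, 1 ≤ i → i ≤ n → ∃ X : Set V, X.ncard = c i ∧
        ∀ v, ((G.induce Xᶜ).neighborSet v).ncard ≤ a i)
    (hlow : ∀ i, 1 ≤ i → i ≤ n → ∀ X : Set V, X.ncard < c i →
        ∃ v, a (i - 1) ≤ ((G.induce Xᶜ).neighborSet v).ncard) :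
    (∀ i, 1 ≤ i → i ≤ n →
      Nat.card {comp : G.ConnectedComponent // comp.supp.ncard = a (i - 1) + 1} =
        c i - c (i - 1)) ∧
    (∀ comp : G.ConnectedComponent,
      comp.supp.ncard ≤ a n + 1 ∨ ∃ i, 1 ≤ i ∧ i ≤ n ∧ comp.supp.ncard = a (i - 1) + 1) := by
  have hzero : largeComponents G (a 0) = ∅ := by
    rw [← Set.ncard_eq_zero (Set.toFinite _), ← Nat.le_zero]
    refine (ncard_largeComponents_le hstar ∅ fun v => ?_).trans (Set.ncard_empty V).le
    rw [← Set.ncard_image_of_injective _ Subtype.val_injective]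
    refine (Set.ncard_le_ncard ?_ (Set.toFinite _)).trans (hmax1 v)
    rintro _ ⟨y, hvy, rfl⟩
    exact hvy
  have hlower : ∀ i < n, ∀ t < a i, c (i + 1) ≤ (largeComponents G t).ncard := by
    intro i hi t ht
    by_contra! hlt
    obtain ⟨X, hXcard, hX⟩ := exists_ncard_le_ncard_largeComponents hstar t
    obtain ⟨v, hv⟩ := hlow (i + 1) (by lia) hi X (hXcard.trans_lt hlt)
    exact absurd (hv.trans (hX v)) (not_le.mpr ht)
  have hupper : ∀ i ≤ n, (largeComponents G (a i)).ncard ≤ c i := by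
    intro i hi
    rcases Nat.eq_zero_or_pos i with rfl | hpos
    · simp [hzero]
    · obtain ⟨X, hXcard, hX⟩ := hdel i hpos hi
      exact hXcard ▸ ncard_largeComponents_le hstar X hX
  have hcard : ∀ i ≤ n, (largeComponents G (a i)).ncard = c i := by
    intro i hi
    refine (hupper i hi).antisymm ?_
    cases i with
    | zero => simp [hc0]
    | succ j => exact hlower j hi _ (ha j hi)
  have hgap : ∀ i < n, largeComponents G (a i - 1) = largeComponents G (a (i + 1)) := by
    intro i hi
    have hlt := ha i hi
    refine Set.eq_of_subset_of_ncard_le (largeComponents_anti G (by lia)) ?_ (Set.toFinite _)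
    rw [hcard (i + 1) hi]
    exact hlower i hi _ (by lia)
  constructor
  · rintro (_ | i) hi hin
    · lia
    have hlt := ha i hin
    have hset : {C : G.ConnectedComponent | C.supp.ncard = a i + 1} =
        largeComponents G (a (i + 1)) \ largeComponents G (a i) := by
      rw [← hgap i hin]
      ext C
      simp only [largeComponents, Set.mem_sdiff, Set.mem_ofPred_eq]
      lia
    change Nat.card ↑{C : G.ConnectedComponent | C.supp.ncard = a i + 1} = _
    rw [Nat.card_coe_set_eq, hset,
      Set.ncard_sdiff (largeComponents_anti G hlt.le) (Set.toFinite _),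
      hcard _ hin, hcard _ (by lia), Nat.add_sub_cancel]
  · intro C
    by_contra! hC
    obtain ⟨hlarge, hne⟩ := hC
    have hnot : ∀ i ≤ n, C ∉ largeComponents G (a i) := by
      intro i
      induction i with
      | zero => simp [hzero]
      | succ i ih =>
        intro hin hmem
        have hCi := ih (by lia)
        have hCne := hne (i + 1) (by lia) hin
        rw [← hgap i hin] at hmem
        simp only [largeComponents, Set.mem_ofPred_eq, Nat.add_sub_cancel] at hmem hCi hCne
        lia
    exact hnot n le_rfl hlarge

end Stmt9
end

section
/- Let G be a finite simple graph, β ∈ ℤ, and M a module of G such that the induced subgraph G[M] is a disjoint union of k ≥ 2 stars with centers v_1, …, v_k satisfying deg_{G[M]}(v_1) ≥ … ≥ deg_{G[M]}(v_k) ≥ 2. Let N be the set of vertices of V(G) \ M adjacent to M (each such vertex is adjacent to every vertex of M). Let r ∈ {1, …, k−1} and let X ⊆ V(G) satisfy |X ∩ M| = r and |X ∩ N| ≥ β. Then, setting X' = (X \ M) ∪ {v_1, …, v_r}, one has Λ(M \ X, G, X) ≤ Λ(M \ X', G, X'). -/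
namespace Stmt10

/-- A module of a graph: every outside vertex is adjacent to all or none of its vertices. -/
def IsModule {α : Type} (G : SimpleGraph α) (M : Set α) : Prop :=
  ∀ v ∉ M, (∀ u ∈ M, G.Adj v u) ∨ (∀ u ∈ M, ¬ G.Adj v u)

/-- The dominating coefficient of a vertex `u` with respect to `(G, X)`:
`(|N(u) ∩ X| - β) / |N(u)|`. -/
noncomputable def lam {α : Type} (G : SimpleGraph α) (β : ℤ) (X : Set α) (u : α) : ℝ :=
  (((G.neighborSet u ∩ X).ncard : ℝ) - (β : ℝ)) / ((G.neighborSet u).ncard : ℝ)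

open Classical in
/-- The dominating coefficient of a set `W` with respect to `(G, X)`: the minimum of the
dominating coefficients of its vertices (`1` when `W` is empty). -/
noncomputable def Lam {α : Type} (G : SimpleGraph α) (β : ℤ) (X : Set α) (W : Set α) : ℝ :=
  if W.Nonempty then sInf (lam G β X '' W) else 1

/-- For a vertex `u` of a module `M`, the neighbors of `u` in `Y` split into `Y ∩ N` and those
inside `M`, where `N` is the set of outside vertices adjacent to `M`. -/
theorem ncard_neighborSet_inter {V : Type} [Finite V] {G : SimpleGraph V} {M : Set V}
    (hM : IsModule G M) {u : V} (hu : u ∈ M) (Y : Set V) :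
    (G.neighborSet u ∩ Y).ncard =
      (Y ∩ {w | w ∉ M ∧ ∃ u ∈ M, G.Adj w u}).ncard + (G.neighborSet u ∩ M ∩ Y).ncard := by
  rw [← Set.ncard_union_eq ?_ (Set.toFinite _) (Set.toFinite _)]
  · congr 1
    ext w
    simp only [Set.mem_inter_iff, SimpleGraph.mem_neighborSet, Set.mem_union, Set.mem_ofPred_eq]
    constructor
    · rintro ⟨h, hY⟩
      by_cases hw : w ∈ M
      · exact Or.inr ⟨⟨h, hw⟩, hY⟩
      · exact Or.inl ⟨hY, hw, u, hu, h.symm⟩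
    · rintro (⟨hY, hw, x, hx, hwx⟩ | ⟨⟨h, -⟩, hY⟩)
      · rcases hM w hw with h | h
        · exact ⟨(h u hu).symm, hY⟩
        · exact absurd hwx (h x hx)
      · exact ⟨h, hY⟩
  · rw [Set.disjoint_left]
    rintro w ⟨-, hw, -⟩ ⟨⟨-, hw'⟩, -⟩
    exact hw hw'

/-- The dominating coefficient of a vertex of a module. -/
theorem lam_eq_of_mem {V : Type} [Finite V] {G : SimpleGraph V} {M : Set V}
    (hM : IsModule G M) {u : V} (hu : u ∈ M) (β : ℤ) (Y : Set V) :
    lam G β Y u =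
      ((Y ∩ {w | w ∉ M ∧ ∃ u ∈ M, G.Adj w u}).ncard + (G.neighborSet u ∩ M ∩ Y).ncard - β : ℝ) /
        (({w | w ∉ M ∧ ∃ u ∈ M, G.Adj w u} : Set V).ncard + (G.neighborSet u ∩ M).ncard) := by
  have h := ncard_neighborSet_inter hM hu Set.univ
  simp only [Set.inter_univ, Set.univ_inter] at h
  rw [lam, ncard_neighborSet_inter hM hu Y, h]
  push_cast
  rfl

/-- If `X` meets `M` in `r` vertices, then it misses one of the first `r + 1` stars. -/
theorem exists_star_disjoint {V : Type} [Finite V] {G : SimpleGraph V} {M : Set V}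
    {k : ℕ} {v : Fin k → V} (hvM : ∀ i, v i ∈ M) (hvinj : Function.Injective v)
    (hcent : ∀ i j : Fin k, ¬ G.Adj (v i) (v j))
    (hleaf : ∀ x ∈ M, x ∉ Set.range v → ∃! i : Fin k, G.Adj x (v i))
    {r : ℕ} (hrk : r < k) {X : Set V} (hXM : (X ∩ M).ncard = r) :
    ∃ i : Fin k, (i : ℕ) ≤ r ∧ v i ∉ X ∧ G.neighborSet (v i) ∩ M ∩ X = ∅ := by
  by_contra! hcon
  have key : ∀ i : Fin (r + 1), ∃ x ∈ X ∩ M,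
      x = v ⟨i, by omega⟩ ∨ G.Adj x (v ⟨i, by omega⟩) := by
    intro i
    by_cases hx : v ⟨i, by omega⟩ ∈ X
    · exact ⟨_, ⟨hx, hvM _⟩, Or.inl rfl⟩
    · obtain ⟨x, ⟨hadj, hxM⟩, hxX⟩ := hcon ⟨i, by omega⟩ (Nat.lt_succ_iff.mp i.2) hx
      exact ⟨x, ⟨hxX, hxM⟩, Or.inr hadj.symm⟩
  choose f hf hfv using key
  have hinj : Function.Injective f := by
    intro i j hij
    have hi := hfv i
    have hj := hfv j
    rw [← hij] at hj
    have : (⟨i, by omega⟩ : Fin k) = ⟨j, by omega⟩ := by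
      rcases hi with hi | hi <;> rcases hj with hj | hj
      · exact hvinj (hi.symm.trans hj)
      · exact absurd (hi ▸ hj) (hcent _ _)
      · exact absurd (hj ▸ hi) (hcent _ _)
      · refine (hleaf (f i) (hf i).2 ?_).unique hi hj
        rintro ⟨l, hl⟩
        exact hcent _ _ (hl ▸ hi)
    exact Fin.ext (Fin.mk.inj_iff.mp this)
  have hcard : (Set.range f).ncard ≤ (X ∩ M).ncard :=
    Set.ncard_le_ncard (Set.range_subset_iff.mpr hf) (Set.toFinite _)
  rw [← Set.image_univ, Set.ncard_image_of_injective _ hinj, Set.ncard_univ, Nat.card_fin,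
    hXM] at hcard
  omega

/-- greedy lemma: let `M` be a module of `G` inducing a disjoint union of
`k ≥ 2` stars with centers `v 0, …, v (k-1)` of non-increasing within-`M` degrees, all at
least `2`.  Let `N` be the set of outside vertices adjacent to `M`.  If `|X ∩ M| = r`
with `1 ≤ r ≤ k - 1` and `|X ∩ N| ≥ β`, then replacing `X ∩ M` by the `r` largest-degree
centers does not decrease the dominating coefficient of the surviving part of `M`. -/
theorem greedy_centers (V : Type) [Fintype V] (G : SimpleGraph V) (β : ℤ)
    (M : Set V) (hM : IsModule G M)
    (k : ℕ) (hk : 2 ≤ k) (v : Fin k → V)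
    (hvM : ∀ i, v i ∈ M) (hvinj : Function.Injective v)
    (hdeg2 : ∀ i : Fin k, 2 ≤ (G.neighborSet (v i) ∩ M).ncard)
    (hmono : ∀ i j : Fin k, i ≤ j →
        (G.neighborSet (v j) ∩ M).ncard ≤ (G.neighborSet (v i) ∩ M).ncard)
    (hcent : ∀ i j : Fin k, ¬ G.Adj (v i) (v j))
    (hleaf : ∀ x ∈ M, x ∉ Set.range v →
        (∃! i : Fin k, G.Adj x (v i)) ∧ ∀ y ∈ M, G.Adj x y → y ∈ Set.range v)
    (N : Set V) (hN : N = {w | w ∉ M ∧ ∃ u ∈ M, G.Adj w u})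
    (r : ℕ) (hr1 : 1 ≤ r) (hrk : r ≤ k - 1)
    (X : Set V) (hXM : (X ∩ M).ncard = r)
    (hXN : (β : ℤ) ≤ ((X ∩ N).ncard : ℤ))
    (X' : Set V) (hX' : X' = (X \ M) ∪ (v '' {i : Fin k | (i : ℕ) < r})) :
    Lam G β X (M \ X) ≤ Lam G β X' (M \ X') := by
  subst hN
  have hrk' : r < k := by omega
  obtain ⟨i, hir, hiX, hi⟩ :=
    exists_star_disjoint hvM hvinj hcent (fun x hx h => (hleaf x hx h).1) hrk' hXM
  set N : Set V := {w | w ∉ M ∧ ∃ u ∈ M, G.Adj w u} with hN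
  have hXN' : X' ∩ N = X ∩ N := by
    subst hX'
    ext w
    simp only [Set.mem_inter_iff, Set.mem_union, Set.mem_sdiff]
    constructor
    · rintro ⟨⟨hw, -⟩ | ⟨j, -, rfl⟩, hwN⟩
      · exact ⟨hw, hwN⟩
      · exact absurd (hvM j) hwN.1
    · rintro ⟨hw, hwN⟩
      exact ⟨Or.inl ⟨hw, hwN.1⟩, hwN⟩
  have hmem : v ⟨r, hrk'⟩ ∈ M \ X' := by
    refine ⟨hvM _, ?_⟩
    rw [hX']
    rintro (⟨-, h⟩ | ⟨j, hj, hjr⟩)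
    · exact h (hvM _)
    · rw [hvinj hjr] at hj
      exact lt_irrefl r hj
  have hdeg : ∀ y ∈ M \ X', 1 ≤ (G.neighborSet y ∩ M).ncard ∧
      (G.neighborSet y ∩ M).ncard ≤ (G.neighborSet (v i) ∩ M).ncard := by
    rintro y ⟨hyM, hyX⟩
    by_cases hy : y ∈ Set.range v
    · obtain ⟨j, rfl⟩ := hy
      have hj : r ≤ (j : ℕ) := by
        by_contra! hlt
        exact hyX (hX' ▸ Or.inr ⟨j, hlt, rfl⟩)
      exact ⟨one_le_two.trans (hdeg2 j), hmono i j (Fin.le_def.mpr (hir.trans hj))⟩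
    · obtain ⟨⟨j, hj, huniq⟩, honly⟩ := hleaf y hyM hy
      have : G.neighborSet y ∩ M = {v j} := by
        ext w
        simp only [Set.mem_inter_iff, SimpleGraph.mem_neighborSet, Set.mem_singleton_iff]
        constructor
        · rintro ⟨hadj, hw⟩
          obtain ⟨l, rfl⟩ := honly w hw hadj
          rw [huniq l hadj]
        · rintro rfl
          exact ⟨hj, hvM j⟩
      rw [this, Set.ncard_singleton]
      exact ⟨le_rfl, one_le_two.trans (hdeg2 i)⟩
  rw [Lam, Lam, if_pos ⟨_, hvM i, hiX⟩, if_pos ⟨_, hmem⟩]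
  refine le_csInf (Set.Nonempty.image _ ⟨_, hmem⟩) ?_
  rintro _ ⟨y, hy, rfl⟩
  refine (csInf_le (Set.toFinite (lam G β X '' (M \ X))).bddBelow
    (Set.mem_image_of_mem _ ⟨hvM i, hiX⟩)).trans ?_
  rw [lam_eq_of_mem hM (hvM i), lam_eq_of_mem hM hy.1, ← hN, hXN', hi, Set.ncard_empty]
  obtain ⟨hpos, hle⟩ := hdeg y hy
  have hpos' : (1 : ℝ) ≤ (G.neighborSet y ∩ M).ncard := by exact_mod_cast hpos
  have hle' : ((G.neighborSet y ∩ M).ncard : ℝ) ≤ (G.neighborSet (v i) ∩ M).ncard := by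
    exact_mod_cast hle
  have hβ : (β : ℝ) ≤ (X ∩ N).ncard := by exact_mod_cast hXN
  push_cast
  gcongr
  · have : (0 : ℝ) ≤ (G.neighborSet y ∩ M ∩ X').ncard := Nat.cast_nonneg _
    linarith
  · positivity

end Stmt10
end

section
/- For every integer n ≥ 1 there exists a set I of n positive integers with max(I) ≤ n^4 such that for all a, b, a', b' ∈ I, if a + b = a' + b' then {a, b} = {a', b'}. -/
namespace Stmt11

/-- At most `#I ^ 3 + #I ^ 2` values `x` satisfy `x + c = a + b` or `x + x = a + b` for some
`a, b, c` in `I`, so any longer interval `[1, N]` contains an `x` which does not. -/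
lemma exists_forall_add_ne (I : Finset ℕ) {N : ℕ} (hN : I.card ^ 3 + I.card ^ 2 < N) :
    ∃ x, 0 < x ∧ x ≤ N ∧ (∀ a ∈ I, ∀ b ∈ I, ∀ c ∈ I, x + c ≠ a + b) ∧
      ∀ a ∈ I, ∀ b ∈ I, x + x ≠ a + b := by
  let F : Finset ℕ := (I ×ˢ I ×ˢ I).image (fun p => p.1 + p.2.1 - p.2.2) ∪
    (I ×ˢ I).image (fun p => (p.1 + p.2) / 2)
  have hF : F.card < (Finset.Icc 1 N).card := by
    calc F.card ≤ (I ×ˢ I ×ˢ I).card + (I ×ˢ I).card :=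
          (Finset.card_union_le _ _).trans
            (Nat.add_le_add Finset.card_image_le Finset.card_image_le)
      _ = I.card ^ 3 + I.card ^ 2 := by simp only [Finset.card_product]; ring
      _ < (Finset.Icc 1 N).card := by simpa using hN
  obtain ⟨x, hx, hxF⟩ := Finset.exists_mem_notMem_of_card_lt_card hF
  rw [Finset.mem_Icc] at hx
  refine ⟨x, hx.1, hx.2, fun a ha b hb c hc h => hxF ?_, fun a ha b hb h => hxF ?_⟩
  · refine Finset.mem_union_left _ (Finset.mem_image.2 ⟨(a, b, c), ?_, ?_⟩)
    · simp [ha, hb, hc]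
    · simp only
      omega
  · refine Finset.mem_union_right _ (Finset.mem_image.2 ⟨(a, b), ?_, ?_⟩)
    · simp [ha, hb]
    · simp only
      omega

/-- for every `n ≥ 1` there is a 2-sumfree set of `n` positive integers
whose maximum is at most `n ^ 4`: all pairwise sums (with repetition) are distinct. -/
theorem exists_two_sumfree (n : ℕ) (hn : 1 ≤ n) :
    ∃ I : Finset ℕ, I.card = n ∧ (∀ a ∈ I, 0 < a ∧ a ≤ n ^ 4) ∧
      ∀ a ∈ I, ∀ b ∈ I, ∀ a' ∈ I, ∀ b' ∈ I,
        a + b = a' + b' → (a = a' ∧ b = b') ∨ (a = b' ∧ b = a') := by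
  clear hn
  induction n with
  | zero => exact ⟨∅, by simp⟩
  | succ n ih =>
    obtain ⟨I, hcard, hbound, hsum⟩ := ih
    have hlt : I.card ^ 3 + I.card ^ 2 < (n + 1) ^ 4 := by
      rw [hcard]
      ring_nf
      nlinarith [Nat.zero_le (n ^ 4), Nat.zero_le (n ^ 3), Nat.zero_le (n ^ 2)]
    obtain ⟨x, hpos, hle, hx, hxx⟩ := exists_forall_add_ne I hlt
    have hxI : x ∉ I := fun h => hx x h x h x h rfl
    refine ⟨insert x I, by rw [Finset.card_insert_of_notMem hxI, hcard], ?_, ?_⟩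
    · intro a ha
      rcases Finset.mem_insert.1 ha with rfl | ha
      · exact ⟨hpos, hle⟩
      · exact ⟨(hbound a ha).1, (hbound a ha).2.trans (Nat.pow_le_pow_left n.le_succ 4)⟩
    · intro a ha b hb c hc d hd h
      rw [Finset.mem_insert] at ha hb hc hd
      grind

end Stmt11
end

section
/- With the notation of the context: if G contains a multicolored clique of size k, then there exists X ⊆ V(H) with |X| ≤ q = k·s + (k(k−1)/2)·s such that the maximum degree of H − X is at most d. -/
namespace Stmt12

/-- `W` has maximum degree at most `m`. -/
def maxDegLE {α : Type} (W : SimpleGraph α) (m : ℕ) : Prop :=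
  ∀ v : α, (W.neighborSet v).ncard ≤ m

/-- `W` has maximum degree exactly `m` (the maximum degree of the empty graph is `0`). -/
def maxDegEq {α : Type} (W : SimpleGraph α) (m : ℕ) : Prop :=
  maxDegLE W m ∧ (m = 0 ∨ ∃ v : α, (W.neighborSet v).ncard = m)

/-- The predecessor of `x` in the decreasing order `a₀ > α_1 > … > α_m` on `J ∪ {a₀}`:
the least element of `J ∪ {a₀}` that is greater than `x`. -/
noncomputable def predVal (a₀ : ℕ) (J : Finset ℕ) (x : ℕ) : ℕ :=
  sInf {y | (y ∈ J ∨ y = a₀) ∧ x < y}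

/-- `W` is an `(a₀, J, c)`-degree deletion graph:
(1) it has maximum degree `a₀` and at most `(a₀ * c (min J)) ^ 10` vertices;
(2) for each `x ∈ J` there is a vertex set of size `c x` whose deletion leaves maximum
degree exactly `x`;
(3) for each `x ∈ J`, deleting fewer than `c x` vertices leaves maximum degree at least
the predecessor of `x` in `J ∪ {a₀}`. -/
def IsDegDel {α : Type} (W : SimpleGraph α) (a₀ : ℕ) (J : Finset ℕ) (c : ℕ → ℕ) : Prop :=
  maxDegEq W a₀ ∧
  Nat.card α ≤ (a₀ * c (sInf {x | x ∈ J})) ^ 10 ∧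
  (∀ x ∈ J, ∃ X : Set α, X.ncard = c x ∧ maxDegEq (W.induce Xᶜ) x) ∧
  (∀ x ∈ J, ∀ X : Set α, X.ncard < c x →
    ∃ v, predVal a₀ J x ≤ ((W.induce Xᶜ).neighborSet v).ncard)

/-- Index type for the parts of the construction `H`. -/
inductive PIdx (k : ℕ) : Type where
  | r : Fin k → PIdx k
  | s : Fin k → PIdx k
  | t : Fin k → PIdx k
  | rr : Fin k → Fin k → PIdx k
  | uu : Fin k → Fin k → PIdx k

/-- The part of `H` corresponding to an index. -/
def PIdx.toSet {k : ℕ} {VH : Type} (R S T : Fin k → Set VH)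
    (RR UU : Fin k → Fin k → Set VH) : PIdx k → Set VH
  | .r i => R i
  | .s i => S i
  | .t i => T i
  | .rr i j => RR i j
  | .uu i j => UU i j

section Auxiliary

theorem ncard_neighborSet_induce {V : Type} (H : SimpleGraph V) (A : Set V) (v : A) :
    ((H.induce A).neighborSet v).ncard = (H.neighborSet v ∩ A).ncard := by
  rw [← Set.ncard_image_of_injective _ Subtype.val_injective]
  congr 1
  ext u
  simp [and_comm]

theorem maxDegLE_induce_iff {V : Type} (H : SimpleGraph V) (A : Set V) (m : ℕ) :
    maxDegLE (H.induce A) m ↔ ∀ v ∈ A, (H.neighborSet v ∩ A).ncard ≤ m := by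
  simp only [maxDegLE, ncard_neighborSet_induce, Subtype.forall]

/-- A deletion set of an induced subgraph, viewed as a set of vertices of the ambient graph. -/
theorem IsDegDel.exists_subset {V : Type} {H : SimpleGraph V} {A : Set V} {a₀ : ℕ}
    {J : Finset ℕ} {c : ℕ → ℕ} (h : IsDegDel (H.induce A) a₀ J c) {x : ℕ} (hx : x ∈ J) :
    ∃ Y ⊆ A, Y.ncard = c x ∧
      ∀ v ∈ A, v ∉ Y → (H.neighborSet v ∩ (A \ Y)).ncard ≤ x := by
  obtain ⟨X, hXc, hXd, -⟩ := h.2.2.1 x hx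
  refine ⟨Subtype.val '' X, by simp, ?_, fun v hv hvY => ?_⟩
  · rw [Set.ncard_image_of_injective _ Subtype.val_injective, hXc]
  · have hvX : (⟨v, hv⟩ : A) ∈ Xᶜ := fun hmem => hvY ⟨_, hmem, rfl⟩
    have key := (maxDegLE_induce_iff (H.induce A) Xᶜ x).1 hXd ⟨v, hv⟩ hvX
    rw [← Set.ncard_image_of_injective _ Subtype.val_injective] at key
    convert key using 2
    ext u
    simp only [Set.mem_inter_iff, Set.mem_sdiff, Set.mem_image, Subtype.exists,
      SimpleGraph.mem_neighborSet, SimpleGraph.comap_adj, Set.mem_compl_iff,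
      Function.Embedding.subtype_apply, exists_and_right, exists_eq_right]
    grind

theorem IsDegDel.card_le {V : Type} {H : SimpleGraph V} {A : Set V} {a₀ : ℕ}
    {J : Finset ℕ} {c : ℕ → ℕ} (h : IsDegDel (H.induce A) a₀ J c) (hc : ∀ x, c x ≤ a₀) :
    A.ncard ≤ (a₀ * a₀) ^ 10 :=
  h.2.1.trans (Nat.pow_le_pow_left (Nat.mul_le_mul_left _ (hc _)) 10)

/-- Summing `b i + b j` over all pairs `i < j` counts each `b i` exactly `k - 1` times. -/
theorem sum_pairs_lt {k : ℕ} (b : Fin k → ℤ) :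
    ∑ i, ∑ j, (if i < j then b i + b j else 0) = (k - 1) * ∑ i, b i := by
  have h1 : ∑ i, ∑ j, (if i < j then b i + b j else 0)
      = ∑ i, ∑ j, (if i < j then b i else 0) + ∑ i, ∑ j, (if j < i then b i else 0) := by
    rw [Finset.sum_comm (f := fun i j => if j < i then b i else 0)]
    simp only [← Finset.sum_add_distrib]
    refine Finset.sum_congr rfl fun i _ => Finset.sum_congr rfl fun j _ => ?_
    split_ifs <;> simp
  have h2 : ∀ i j : Fin k, (if i < j then b i else 0) + (if j < i then b i else 0)
      = b i - if i = j then b i else 0 := by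
    intro i j
    rcases lt_trichotomy i j with h | h | h
    · simp [h, h.not_gt, h.ne]
    · simp [h]
    · simp [h, h.not_gt, h.ne']
  rw [h1]
  simp only [← Finset.sum_add_distrib, h2]
  simp [Finset.mul_sum, sub_mul]

theorem deletion_budget {k s : ℕ} (hk : 2 ≤ k) (b : Fin k → ℕ)
    (hb : ∀ i, 2 * ((k - 1) * b i) ≤ s) :
    ∑ i, (s - (k - 1) * b i) + ∑ i, 2 * ((k - 1) * b i)
      + ∑ i, ∑ j, (if i < j then s - (b i + b j) else 0)
      ≤ k * s + k * (k - 1) / 2 * s := by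
  have hbs : ∀ i, 2 * b i ≤ s := fun i =>
    (Nat.mul_le_mul_left 2 (Nat.le_mul_of_pos_left _ (by omega))).trans (hb i)
  obtain ⟨p, hp⟩ : 2 ∣ k * (k - 1) := (Nat.even_mul_pred_self k).two_dvd
  rw [hp, Nat.mul_div_cancel_left _ (by norm_num)]
  have h1 : ((∑ i, (s - (k - 1) * b i) : ℕ) : ℤ) = k * s - (k - 1) * ∑ i, (b i : ℤ) := by
    have : ∀ i, ((s - (k - 1) * b i : ℕ) : ℤ) = s - (k - 1) * b i := by
      intro i
      have := hb i
      rw [Nat.cast_sub (by omega)]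
      push_cast [show 1 ≤ k by omega]
      ring
    push_cast only [this, Nat.cast_sum]
    simp [Finset.mul_sum]
  have h2 : ((∑ i, 2 * ((k - 1) * b i) : ℕ) : ℤ) = 2 * ((k - 1) * ∑ i, (b i : ℤ)) := by
    push_cast [show 1 ≤ k by omega]
    simp [Finset.mul_sum]
  have hpz : (k : ℤ) * (k - 1) = 2 * p := by
    have := congrArg (Nat.cast : ℕ → ℤ) hp
    push_cast [show 1 ≤ k by omega] at this
    exact this
  have hs : ∑ i : Fin k, ∑ j : Fin k, (if i < j then (s : ℤ) else 0) = p * s := by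
    have h := sum_pairs_lt (k := k) (fun _ => (s : ℤ))
    have h' : ∑ i : Fin k, ∑ j : Fin k, (if i < j then (s : ℤ) + s else 0)
        = 2 * ∑ i : Fin k, ∑ j : Fin k, (if i < j then (s : ℤ) else 0) := by
      simp only [Finset.mul_sum]
      refine Finset.sum_congr rfl fun i _ => Finset.sum_congr rfl fun j _ => ?_
      split_ifs <;> ring
    rw [h'] at h
    simp only [Finset.sum_const, Finset.card_univ, Fintype.card_fin, nsmul_eq_mul] at h
    refine mul_left_cancel₀ (two_ne_zero (α := ℤ)) ?_
    linear_combination h + (s : ℤ) * hpz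
  have h3 : ((∑ i, ∑ j, (if i < j then s - (b i + b j) else 0) : ℕ) : ℤ)
      = p * s - (k - 1) * ∑ i, (b i : ℤ) := by
    rw [← hs, ← sum_pairs_lt (fun i => (b i : ℤ))]
    push_cast only [Nat.cast_sum]
    simp only [← Finset.sum_sub_distrib]
    refine Finset.sum_congr rfl fun i _ => Finset.sum_congr rfl fun j _ => ?_
    have := hbs i
    have := hbs j
    split_ifs
    · rw [Nat.cast_sub (by omega)]
      push_cast
      ring
    · simp
  zify at h1 h2 h3 ⊢
  rw [h1, h2, h3]
  apply le_of_eq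
  ring

theorem label_bound {k n : ℕ} (hk : 100 ≤ k) (hkn : k ≤ n) :
    n ^ 4 * (2 * (k - 1) ^ 2 * k ^ 3) ≤ n ^ 10 := by
  calc n ^ 4 * (2 * (k - 1) ^ 2 * k ^ 3) ≤ n ^ 4 * (n * n ^ 2 * n ^ 3) := by
        gcongr <;> omega
    _ = n ^ 10 := by ring

theorem degree_bound {k n N : ℕ} (hk : 100 ≤ k) (hkn : k ≤ n) (hN : 3 + 26 * 10 ≤ N) {a : ℕ}
    (ha : a = k * n ^ 10 + k * (k - 1) / 2 * n ^ 10 + 1) :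
    (k + k * k) * (a * a) ^ 10 ≤ (n * k) ^ N := by
  have ha' : a ≤ n ^ 13 := by
    have h1 : k * (k - 1) / 2 ≤ n * n :=
      (Nat.div_le_self _ _).trans (Nat.mul_le_mul hkn (by omega))
    calc a ≤ (n * n) * n ^ 10 + (n * n) * n ^ 10 + (n * n) * n ^ 10 := by
          rw [ha]
          gcongr
          · nlinarith
          · have : 0 < n := by omega
            exact Nat.succ_le_of_lt (by positivity)
      _ = 3 * n ^ 12 := by ring
      _ ≤ n * n ^ 12 := by gcongr; omega
      _ = n ^ 13 := by ring
  calc (k + k * k) * (a * a) ^ 10 ≤ (n * (n * n)) * (n ^ 13 * n ^ 13) ^ 10 := by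
        gcongr
        nlinarith
    _ = n ^ (3 + 26 * 10) := by ring
    _ ≤ (n * k) ^ (3 + 26 * 10) :=
        Nat.pow_le_pow_left (Nat.le_mul_of_pos_right _ (by omega)) _
    _ ≤ (n * k) ^ N := Nat.pow_le_pow_right (Nat.mul_pos (by omega) (by omega)) hN

theorem two_mul_pow_le {k n N : ℕ} (hk : 100 ≤ k) (hkn : k ≤ n) (hN : 11 ≤ N) :
    2 * n ^ 10 ≤ (n * k) ^ N := by
  calc 2 * n ^ 10 ≤ n * n ^ 10 := by gcongr; omega
    _ = n ^ 11 := by ring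
    _ ≤ (n * k) ^ 11 := by gcongr; exact Nat.le_mul_of_pos_right _ (by omega)
    _ ≤ (n * k) ^ N := Nat.pow_le_pow_right (Nat.mul_pos (by omega) (by omega)) hN

end Auxiliary

/-- forward direction of the reduction for `α = 1`, i.e. Bounded Degree
Deletion: in the construction `H` built from a symmetric multicolored graph `G`, if `G`
contains a multicolored clique of size `k`, then there is a set `X` of at most
`q = k·s + (k(k-1)/2)·s` vertices of `H` whose deletion leaves maximum degree at most
`d = (nk)^10000`. -/
theorem clique_to_deletion
    (k n : ℕ) (hk : 100 ≤ k) (hkn : k ≤ n)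
    (G : SimpleGraph (Fin k × Fin n))
    (hGind : ∀ (i : Fin k) (σ τ : Fin n), ¬ G.Adj (i, σ) (i, τ))
    (hGsym : ∀ (i j : Fin k) (σ τ : Fin n), G.Adj (i, σ) (j, τ) → G.Adj (i, τ) (j, σ))
    (r0 s0 q0 a0 d0 : ℕ)
    (hr0 : r0 = 2 * (k - 1) ^ 2 * k ^ 3)
    (hs0 : s0 = n ^ 10)
    (hq0 : q0 = k * s0 + (k * (k - 1) / 2) * s0)
    (ha0 : a0 = q0 + 1)
    (hd0 : d0 = (n * k) ^ 10000)
    (a : Fin n → ℕ)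
    (haanti : ∀ σ τ : Fin n, σ < τ → a τ < a σ)
    (hamult : ∀ σ : Fin n, ∃ m : ℕ, 1 ≤ m ∧ a σ = m * r0)
    (hamax : ∀ σ : Fin n, a σ ≤ n ^ 4 * r0)
    (hsumfree : ∀ σ τ σ' τ' : Fin n,
      a σ + a τ = a σ' + a τ' → (σ = σ' ∧ τ = τ') ∨ (σ = τ' ∧ τ = σ'))
    (Iij : Fin k → Fin k → Finset ℕ)
    (hIij : ∀ (i j : Fin k) (x : ℕ), x ∈ Iij i j ↔
      ∃ σ τ : Fin n, G.Adj (i, σ) (j, τ) ∧ G.Adj (i, τ) (j, σ) ∧ x = a σ + a τ)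
    (hIne : ∀ i j : Fin k, i < j → (Iij i j).Nonempty)
    (VH : Type) [Fintype VH] (H : SimpleGraph VH)
    (R S T : Fin k → Set VH) (RR UU : Fin k → Fin k → Set VH)
    (hvoid : ∀ i j : Fin k, ¬ i < j → RR i j = ∅ ∧ UU i j = ∅)
    (hcover : ∀ v : VH, ∃ p : PIdx k, v ∈ PIdx.toSet R S T RR UU p)
    (hdisj : ∀ p q : PIdx k, p ≠ q →
      Disjoint (PIdx.toSet R S T RR UU p) (PIdx.toSet R S T RR UU q))
    (hRcard : ∀ i, (R i).ncard = d0 - s0)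
    (hTcard : ∀ i, (T i).ncard = s0)
    (hRRcard : ∀ i j, i < j → (RR i j).ncard = d0 - 2 * s0)
    (hRind : ∀ i, ∀ x ∈ R i, ∀ y ∈ R i, ¬ H.Adj x y)
    (hTind : ∀ i, ∀ x ∈ T i, ∀ y ∈ T i, ¬ H.Adj x y)
    (hRRind : ∀ i j, ∀ x ∈ RR i j, ∀ y ∈ RR i j, ¬ H.Adj x y)
    (hS : ∀ i, IsDegDel (H.induce (S i)) a0
      (Finset.univ.image a ∪ {sInf (Set.range a) - 1})
      (fun x => if x = sInf (Set.range a) - 1 then a0 else s0 - x / 2))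
    (hU : ∀ i j, i < j → IsDegDel (H.induce (UU i j)) a0
      (Iij i j ∪ {sInf {x | x ∈ Iij i j} - 1})
      (fun w => if w = sInf {x | x ∈ Iij i j} - 1 then a0 else s0 - w / (2 * (k - 1))))
    (hSR : ∀ i, ∀ x ∈ S i, ∀ y ∈ R i, H.Adj x y)
    (hST : ∀ i, ∀ x ∈ S i, ∀ y ∈ T i, H.Adj x y)
    (hURR : ∀ i j, i < j → ∀ x ∈ UU i j, ∀ y ∈ RR i j, H.Adj x y)
    (hUTi : ∀ i j, i < j → ∀ x ∈ UU i j, ∀ y ∈ T i, H.Adj x y)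
    (hUTj : ∀ i j, i < j → ∀ x ∈ UU i j, ∀ y ∈ T j, H.Adj x y)
    (hcross : ∀ x y : VH, H.Adj x y →
      (∃ p : PIdx k, x ∈ PIdx.toSet R S T RR UU p ∧ y ∈ PIdx.toSet R S T RR UU p) ∨
      (∃ i, (x ∈ S i ∧ (y ∈ R i ∨ y ∈ T i)) ∨ (y ∈ S i ∧ (x ∈ R i ∨ x ∈ T i))) ∨
      (∃ i j, i < j ∧
        ((x ∈ UU i j ∧ (y ∈ RR i j ∨ y ∈ T i ∨ y ∈ T j)) ∨
         (y ∈ UU i j ∧ (x ∈ RR i j ∨ x ∈ T i ∨ x ∈ T j)))))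
    (hclique : ∃ g : Fin k → Fin n, ∀ i j : Fin k, i ≠ j → G.Adj (i, g i) (j, g j)) :
    ∃ X : Set VH, X.ncard ≤ q0 ∧
      ∀ v, ((H.induce Xᶜ).neighborSet v).ncard ≤ d0 := by
  obtain ⟨g, hg⟩ := hclique
  have hb : ∀ σ, ∃ b, 0 < b ∧ a σ = 2 * ((k - 1) * b) := by
    intro σ
    obtain ⟨m, hm, e⟩ := hamult σ
    refine ⟨m * ((k - 1) * k ^ 3), ?_, by rw [e, hr0]; ring⟩
    have h1 : 0 < k := by omega
    have h2 : 0 < k - 1 := by omega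
    positivity
  choose b hbpos hab using hb
  have hapos : ∀ σ, 0 < a σ := by
    intro σ
    rw [hab]
    have := hbpos σ
    have h2 : 0 < k - 1 := by omega
    positivity
  have hale : ∀ σ, a σ ≤ s0 := fun σ =>
    (hamax σ).trans (by rw [hr0, hs0]; exact label_bound hk hkn)
  have h2s : 2 * s0 ≤ d0 := by
    rw [hs0, hd0]
    exact two_mul_pow_le hk hkn (by norm_num)
  have hM : (k + k * k) * (a0 * a0) ^ 10 ≤ d0 := by
    rw [hd0]
    exact degree_bound hk hkn (by norm_num) (by rw [ha0, hq0, hs0])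
  have hs0a : s0 ≤ a0 := by
    have : s0 ≤ k * s0 := Nat.le_mul_of_pos_left _ (by omega)
    omega
  have hSn : ∀ i, (S i).ncard ≤ (a0 * a0) ^ 10 := fun i =>
    (hS i).card_le fun x => by split_ifs <;> omega
  have hUn : ∀ i j, (UU i j).ncard ≤ (a0 * a0) ^ 10 := by
    intro i j
    by_cases hij : i < j
    · exact (hU i j hij).card_le fun x => by
        split_ifs
        · exact le_rfl
        · exact (Nat.sub_le _ _).trans hs0a
    · simp [(hvoid i j hij).2]
  clear hd0 hs0 hr0 hamult hamax
  have hSX : ∀ i, ∃ Y ⊆ S i, Y.ncard = s0 - (k - 1) * b (g i) ∧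
      ∀ v ∈ S i, v ∉ Y → (H.neighborSet v ∩ (S i \ Y)).ncard ≤ a (g i) := by
    intro i
    obtain ⟨Y, hY, hc, hd⟩ := (hS i).exists_subset (x := a (g i)) (by simp)
    refine ⟨Y, hY, ?_, hd⟩
    have hle : sInf (Set.range a) ≤ a (g i) := Nat.sInf_le ⟨_, rfl⟩
    have := hapos (g i)
    rw [hc, if_neg (by omega), hab, Nat.mul_div_cancel_left _ (by norm_num)]
  have hUX : ∀ i j, ∃ Y ⊆ UU i j,
      Y.ncard ≤ (if i < j then s0 - (b (g i) + b (g j)) else 0) ∧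
      (i < j → ∀ v ∈ UU i j, v ∉ Y →
        (H.neighborSet v ∩ (UU i j \ Y)).ncard ≤ a (g i) + a (g j)) := by
    intro i j
    by_cases hij : i < j
    · have hmem : a (g i) + a (g j) ∈ Iij i j :=
        (hIij i j _).2 ⟨g i, g j, hg i j hij.ne, hGsym _ _ _ _ (hg i j hij.ne), rfl⟩
      obtain ⟨Y, hY, hc, hd⟩ := (hU i j hij).exists_subset
        (Finset.mem_union_left _ hmem)
      refine ⟨Y, hY, ?_, fun _ => hd⟩
      have hle : sInf {x | x ∈ Iij i j} ≤ a (g i) + a (g j) := Nat.sInf_le hmem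
      have := hapos (g i)
      have hdiv : (a (g i) + a (g j)) / (2 * (k - 1)) = b (g i) + b (g j) := by
        rw [hab, hab]
        exact Nat.div_eq_of_eq_mul_right (by omega) (by ring)
      rw [hc, if_neg (by omega), if_pos hij, hdiv]
    · exact ⟨∅, by simp, by simp, fun h => absurd h hij⟩
  have hTX : ∀ i, ∃ Y ⊆ T i, Y.ncard = a (g i) := fun i =>
    Set.exists_subset_card_eq (by rw [hTcard]; exact hale _)
  choose XS hXSsub hXSc hXSd using hSX
  choose XU hXUsub hXUc hXUd using hUX
  choose XT hXTsub hXTc using hTX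
  have hTrest : ∀ i, (T i \ XT i).ncard = s0 - a (g i) := fun i => by
    rw [Set.ncard_sdiff (hXTsub i), hTcard, hXTc]
  set X : Set VH := (⋃ i, XS i) ∪ (⋃ i, XT i) ∪ ⋃ i, ⋃ j, XU i j with hX
  have hXS : ∀ i, XS i ⊆ X := fun i => by
    rw [hX]; intro v hv; simp only [Set.mem_union, Set.mem_iUnion]; exact .inl (.inl ⟨i, hv⟩)
  have hXT : ∀ i, XT i ⊆ X := fun i => by
    rw [hX]; intro v hv; simp only [Set.mem_union, Set.mem_iUnion]; exact .inl (.inr ⟨i, hv⟩)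
  have hXU : ∀ i j, XU i j ⊆ X := fun i j => by
    rw [hX]; intro v hv; simp only [Set.mem_union, Set.mem_iUnion]; exact .inr ⟨i, j, hv⟩
  have huniq : ∀ (v : VH) (p q : PIdx k), v ∈ PIdx.toSet R S T RR UU p →
      v ∈ PIdx.toSet R S T RR UU q → p = q := fun v p q hp hq =>
    by_contra fun hne => Set.disjoint_left.1 (hdisj p q hne) hp hq
  refine ⟨X, ?_, fun v => ?_⟩
  · have hXcard : X.ncard ≤ ∑ i, (s0 - (k - 1) * b (g i)) + ∑ i, 2 * ((k - 1) * b (g i))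
        + ∑ i, ∑ j, (if i < j then s0 - (b (g i) + b (g j)) else 0) := by
      refine (Set.ncard_union_le _ _).trans (add_le_add ((Set.ncard_union_le _ _).trans
        (add_le_add ?_ ?_)) ?_)
      · exact (Set.ncard_iUnion_le_of_fintype _).trans
          (Finset.sum_le_sum fun i _ => (hXSc i).le)
      · exact (Set.ncard_iUnion_le_of_fintype _).trans
          (Finset.sum_le_sum fun i _ => by rw [hXTc, hab])
      · exact (Set.ncard_iUnion_le_of_fintype _).trans (Finset.sum_le_sum fun i _ =>
          (Set.ncard_iUnion_le_of_fintype _).trans (Finset.sum_le_sum fun j _ => hXUc i j))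
    rw [hq0]
    exact hXcard.trans (deletion_budget (by omega) (fun i => b (g i))
      fun i => by rw [← hab]; exact hale _)
  · obtain ⟨v, hvX⟩ := v
    rw [ncard_neighborSet_induce]
    simp only
    by_cases hvS : ∃ i, v ∈ S i
    · obtain ⟨i, hvi⟩ := hvS
      have hsub : H.neighborSet v ∩ Xᶜ ⊆
          (H.neighborSet v ∩ (S i \ XS i)) ∪ R i ∪ (T i \ XT i) := by
        rintro u ⟨hvu, huX⟩
        have huS : u ∉ XS i := fun h => huX (hXS i h)
        have huT : u ∉ XT i := fun h => huX (hXT i h)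
        have hpart : u ∈ S i ∨ u ∈ R i ∨ u ∈ T i := by
          rcases hcross v u hvu with ⟨p, hp, hq⟩ |
            ⟨i', ⟨h1, h2⟩ | ⟨h1, h2 | h2⟩⟩ | ⟨i', j', hij, ⟨h1, h2⟩ | ⟨h1, h2 | h2 | h2⟩⟩
          · obtain rfl := huniq v p (.s i) hp hvi
            exact .inl hq
          · cases huniq v (.s i) (.s i') hvi h1
            exact .inr h2
          · cases huniq v (.s i) (.r i') hvi h2
          · cases huniq v (.s i) (.t i') hvi h2
          · cases huniq v (.s i) (.uu i' j') hvi h1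
          · cases huniq v (.s i) (.rr i' j') hvi h2
          · cases huniq v (.s i) (.t i') hvi h2
          · cases huniq v (.s i) (.t j') hvi h2
        rcases hpart with h | h | h
        · exact .inl (.inl ⟨hvu, h, huS⟩)
        · exact .inl (.inr h)
        · exact .inr ⟨h, huT⟩
      have h1 := Set.ncard_le_ncard hsub (Set.toFinite _)
      have h2 := Set.ncard_union_le ((H.neighborSet v ∩ (S i \ XS i)) ∪ R i) (T i \ XT i)
      have h3 := Set.ncard_union_le (H.neighborSet v ∩ (S i \ XS i)) (R i)
      have h4 := hXSd i v hvi fun h => hvX (hXS i h)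
      have h5 := hTrest i
      have h6 := hRcard i
      have h7 := hale (g i)
      omega
    · by_cases hvU : ∃ i j, v ∈ UU i j
      · obtain ⟨i, j, hvij⟩ := hvU
        have hij : i < j := by
          by_contra h
          rw [(hvoid i j h).2] at hvij
          exact hvij
        have hsub : H.neighborSet v ∩ Xᶜ ⊆
            (H.neighborSet v ∩ (UU i j \ XU i j)) ∪ RR i j ∪
              ((T i \ XT i) ∪ (T j \ XT j)) := by
          rintro u ⟨hvu, huX⟩
          have huU : u ∉ XU i j := fun h => huX (hXU i j h)
          have huT : ∀ i, u ∉ XT i := fun i h => huX (hXT i h)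
          have hpart : u ∈ UU i j ∨ u ∈ RR i j ∨ u ∈ T i ∨ u ∈ T j := by
            rcases hcross v u hvu with ⟨p, hp, hq⟩ |
              ⟨i', ⟨h1, h2⟩ | ⟨h1, h2 | h2⟩⟩ | ⟨i', j', hij, ⟨h1, h2⟩ | ⟨h1, h2 | h2 | h2⟩⟩
            · obtain rfl := huniq v p (.uu i j) hp hvij
              exact .inl hq
            · cases huniq v (.uu i j) (.s i') hvij h1
            · cases huniq v (.uu i j) (.r i') hvij h2
            · cases huniq v (.uu i j) (.t i') hvij h2
            · cases huniq v (.uu i j) (.uu i' j') hvij h1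
              exact .inr h2
            · cases huniq v (.uu i j) (.rr i' j') hvij h2
            · cases huniq v (.uu i j) (.t i') hvij h2
            · cases huniq v (.uu i j) (.t j') hvij h2
          rcases hpart with h | h | h | h
          · exact .inl (.inl ⟨hvu, h, huU⟩)
          · exact .inl (.inr h)
          · exact .inr (.inl ⟨h, huT i⟩)
          · exact .inr (.inr ⟨h, huT j⟩)
        have h1 := Set.ncard_le_ncard hsub (Set.toFinite _)
        have h2 := Set.ncard_union_le ((H.neighborSet v ∩ (UU i j \ XU i j)) ∪ RR i j)
          ((T i \ XT i) ∪ (T j \ XT j))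
        have h3 := Set.ncard_union_le (H.neighborSet v ∩ (UU i j \ XU i j)) (RR i j)
        have h4 := Set.ncard_union_le (T i \ XT i) (T j \ XT j)
        have h5 := hXUd i j hij v hvij fun h => hvX (hXU i j h)
        have h6 := hTrest i
        have h7 := hTrest j
        have h8 := hRRcard i j hij
        have h9 := hale (g i)
        have h10 := hale (g j)
        omega
      · push Not at hvS hvU
        have hsub : H.neighborSet v ∩ Xᶜ ⊆ (⋃ i, S i) ∪ ⋃ i, ⋃ j, UU i j := by
          rintro u ⟨hvu, -⟩
          simp only [Set.mem_union, Set.mem_iUnion]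
          rcases hcross v u hvu with ⟨p, hp, hq⟩ |
            ⟨i, ⟨h1, -⟩ | ⟨h1, -⟩⟩ | ⟨i, j, -, ⟨h1, -⟩ | ⟨h1, -⟩⟩
          · cases p with
            | r i => exact absurd hvu (hRind i v hp u hq)
            | s i => exact absurd hp (hvS i)
            | t i => exact absurd hvu (hTind i v hp u hq)
            | rr i j => exact absurd hvu (hRRind i j v hp u hq)
            | uu i j => exact absurd hp (hvU i j)
          · exact absurd h1 (hvS i)
          · exact .inl ⟨i, h1⟩
          · exact absurd h1 (hvU i j)
          · exact .inr ⟨i, j, h1⟩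
        have hSsum : (⋃ i, S i).ncard ≤ ∑ _i : Fin k, (a0 * a0) ^ 10 :=
          (Set.ncard_iUnion_le_of_fintype _).trans (Finset.sum_le_sum fun i _ => hSn i)
        have hUsum : (⋃ i, ⋃ j, UU i j).ncard ≤ ∑ _i : Fin k, ∑ _j : Fin k, (a0 * a0) ^ 10 :=
          (Set.ncard_iUnion_le_of_fintype _).trans (Finset.sum_le_sum fun i _ =>
            (Set.ncard_iUnion_le_of_fintype _).trans (Finset.sum_le_sum fun j _ => hUn i j))
        calc (H.neighborSet v ∩ Xᶜ).ncard
            ≤ ((⋃ i, S i) ∪ ⋃ i, ⋃ j, UU i j).ncard := Set.ncard_le_ncard hsub (Set.toFinite _)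
          _ ≤ _ := Set.ncard_union_le _ _
          _ ≤ _ := add_le_add hSsum hUsum
          _ = (k + k * k) * (a0 * a0) ^ 10 := by
            simp only [Finset.sum_const, Finset.card_univ, Fintype.card_fin, smul_eq_mul]
            ring
          _ ≤ d0 := hM

end Stmt12
end

section
/- With the notation of the context: if there exists X ⊆ V(H) with |X| ≤ q = k·s + (k(k−1)/2)·s such that the maximum degree of H − X is at most d, then G contains a multicolored clique of size k. -/
namespace Stmt13

/-- `W` has maximum degree at most `m`. -/
def maxDegLE {α : Type} (W : SimpleGraph α) (m : ℕ) : Prop :=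
  ∀ v : α, (W.neighborSet v).ncard ≤ m

/-- `W` has maximum degree exactly `m` (the maximum degree of the empty graph is `0`). -/
def maxDegEq {α : Type} (W : SimpleGraph α) (m : ℕ) : Prop :=
  maxDegLE W m ∧ (m = 0 ∨ ∃ v : α, (W.neighborSet v).ncard = m)

/-- The predecessor of `x` in the decreasing order `a₀ > α_1 > … > α_m` on `J ∪ {a₀}`:
the least element of `J ∪ {a₀}` that is greater than `x`. -/
noncomputable def predVal (a₀ : ℕ) (J : Finset ℕ) (x : ℕ) : ℕ :=
  sInf {y | (y ∈ J ∨ y = a₀) ∧ x < y}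

/-- `W` is an `(a₀, J, c)`-degree deletion graph:
(1) it has maximum degree `a₀` and at most `(a₀ * c (min J)) ^ 10` vertices;
(2) for each `x ∈ J` there is a vertex set of size `c x` whose deletion leaves maximum
degree exactly `x`;
(3) for each `x ∈ J`, deleting fewer than `c x` vertices leaves maximum degree at least
the predecessor of `x` in `J ∪ {a₀}`. -/
def IsDegDel {α : Type} (W : SimpleGraph α) (a₀ : ℕ) (J : Finset ℕ) (c : ℕ → ℕ) : Prop :=
  maxDegEq W a₀ ∧
  Nat.card α ≤ (a₀ * c (sInf {x | x ∈ J})) ^ 10 ∧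
  (∀ x ∈ J, ∃ X : Set α, X.ncard = c x ∧ maxDegEq (W.induce Xᶜ) x) ∧
  (∀ x ∈ J, ∀ X : Set α, X.ncard < c x →
    ∃ v, predVal a₀ J x ≤ ((W.induce Xᶜ).neighborSet v).ncard)

/-- Index type for the parts of the construction `H`. -/
inductive PIdx (k : ℕ) : Type where
  | r : Fin k → PIdx k
  | s : Fin k → PIdx k
  | t : Fin k → PIdx k
  | rr : Fin k → Fin k → PIdx k
  | uu : Fin k → Fin k → PIdx k

/-- The part of `H` corresponding to an index. -/
def PIdx.toSet {k : ℕ} {VH : Type} (R S T : Fin k → Set VH)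
    (RR UU : Fin k → Fin k → Set VH) : PIdx k → Set VH
  | .r i => R i
  | .s i => S i
  | .t i => T i
  | .rr i j => RR i j
  | .uu i j => UU i j

/-- Among the admissible degrees not exceeding the remaining degree bound, the largest one
forces a lower bound on the number of deleted vertices. -/
theorem IsDegDel.exists_cost_le {α : Type} {W : SimpleGraph α} {a₀ z D : ℕ} {J : Finset ℕ}
    {c : ℕ → ℕ} (h : IsDegDel W a₀ (J ∪ {z}) c) (hz : z < a₀) (hzJ : ∀ x ∈ J, z < x)
    (hJ : ∀ x ∈ J, x < a₀) {X : Set α} (hX : X.ncard < c z) (hDa : D < a₀)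
    (hD : ∀ v, ((W.induce Xᶜ).neighborSet v).ncard ≤ D) :
    ∃ x ∈ J, x ≤ D ∧ c x ≤ X.ncard := by
  have step : ∀ x ∈ J ∪ {z}, z ≤ x → X.ncard < c x → ∃ y ∈ J, x < y ∧ y ≤ D := by
    intro x hx hzx hXx
    obtain ⟨v, hv⟩ := h.2.2.2 x hx X hXx
    have hlt : x < a₀ := by
      rcases Finset.mem_union.1 hx with hx | hx
      · exact hJ x hx
      · rwa [Finset.mem_singleton.1 hx]
    have hmem := Nat.sInf_mem (s := {y | (y ∈ J ∪ {z} ∨ y = a₀) ∧ x < y}) ⟨a₀, Or.inr rfl, hlt⟩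
    have hle : predVal a₀ (J ∪ {z}) x ≤ D := hv.trans (hD v)
    unfold predVal at hle
    obtain ⟨hy, hxy⟩ := hmem
    refine ⟨_, ?_, hxy, hle⟩
    rcases hy with hy | hy
    · rcases Finset.mem_union.1 hy with hy | hy
      · exact hy
      · have := Finset.mem_singleton.1 hy
        omega
    · omega
  obtain ⟨y, hyJ, -, hyD⟩ := step z (by simp) le_rfl hX
  obtain ⟨x, hx, hmax⟩ := (J.filter (· ≤ D)).exists_max_image id
    ⟨y, Finset.mem_filter.2 ⟨hyJ, hyD⟩⟩
  obtain ⟨hxJ, hxD⟩ := Finset.mem_filter.1 hx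
  refine ⟨x, hxJ, hxD, ?_⟩
  by_contra! hlt
  obtain ⟨w, hwJ, hxw, hwD⟩ := step x (Finset.mem_union_left _ hxJ) (hzJ x hxJ).le hlt
  exact absurd (hmax w (Finset.mem_filter.2 ⟨hwJ, hwD⟩)) (not_le.2 hxw)

/-- If `S` is completely joined to a disjoint set `P` with at least `d` vertices and `H - X` has
maximum degree at most `d`, then `H[S] - X` has maximum degree at most `|P ∩ X|`. -/
theorem ncard_neighborSet_induce_le {V : Type} [Finite V] (H : SimpleGraph V) (S P X : Set V)
    (d : ℕ) (hSP : Disjoint S P) (hjoin : ∀ x ∈ S, ∀ y ∈ P, H.Adj x y) (hP : d ≤ P.ncard)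
    (hd : ∀ v, ((H.induce Xᶜ).neighborSet v).ncard ≤ d)
    (v : ((Subtype.val ⁻¹' X : Set S)ᶜ : Set S)) :
    (((H.induce S).induce (Subtype.val ⁻¹' X : Set S)ᶜ).neighborSet v).ncard ≤ (P ∩ X).ncard := by
  have hv := hd ⟨v.1.1, v.2⟩
  set N := ((H.induce S).induce (Subtype.val ⁻¹' X : Set S)ᶜ).neighborSet v
  set M := (H.induce Xᶜ).neighborSet ⟨v.1.1, v.2⟩
  have hsub : (fun w => w.1.1) '' N ∪ P \ X ⊆ Subtype.val '' M := by
    rintro w (⟨w, hw, rfl⟩ | ⟨hwP, hwX⟩)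
    · exact ⟨⟨w.1.1, w.2⟩, hw, rfl⟩
    · exact ⟨⟨w, hwX⟩, hjoin _ v.1.2 _ hwP, rfl⟩
  have hdis : Disjoint ((fun w => w.1.1) '' N) (P \ X) := by
    rw [Set.disjoint_left]
    rintro _ ⟨w, -, rfl⟩ h
    exact Set.disjoint_left.1 hSP w.1.2 h.1
  have h1 := Set.ncard_le_ncard hsub (Set.toFinite _)
  rw [Set.ncard_union_eq hdis (Set.toFinite _) (Set.toFinite _),
    Set.ncard_image_of_injective N (f := fun w => w.1.1)
      (Subtype.val_injective.comp Subtype.val_injective),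
    Set.ncard_image_of_injective _ Subtype.val_injective] at h1
  have h2 := Set.ncard_inter_add_ncard_sdiff_eq_ncard P X (Set.toFinite _)
  omega

theorem sum_ncard_inter_le {ι V : Type} [Fintype ι] [Finite V] (f : ι → Set V)
    (hf : ∀ p q, p ≠ q → Disjoint (f p) (f q)) (X : Set V) :
    ∑ p, (f p ∩ X).ncard ≤ X.ncard := by
  classical
  rw [← finsum_eq_sum_of_fintype, ← Set.ncard_iUnion_of_finite (fun _ => Set.toFinite _)
    (fun p q hpq => (hf p q hpq).mono Set.inter_subset_left Set.inter_subset_left)]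
  exact Set.ncard_le_ncard (Set.iUnion_subset fun _ => Set.inter_subset_right) (Set.toFinite _)

/-- The pairs of indices in increasing order. -/
def ltPairs (k : ℕ) : Finset (Fin k × Fin k) := Finset.univ.filter fun p => p.1 < p.2

theorem mem_ltPairs {k : ℕ} {p : Fin k × Fin k} : p ∈ ltPairs k ↔ p.1 < p.2 := by
  simp [ltPairs]

theorem sum_ltPairs_add {k : ℕ} (x : Fin k → ℕ) :
    ∑ p ∈ ltPairs k, (x p.1 + x p.2) = (k - 1) * ∑ i, x i := by
  have h1 : ∑ p ∈ ltPairs k, x p.1 = ∑ i, ∑ j, if i < j then x i else 0 := by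
    rw [ltPairs, Finset.sum_filter, Fintype.sum_prod_type]
  have h2 : ∑ p ∈ ltPairs k, x p.2 = ∑ i, ∑ j, if j < i then x i else 0 := by
    rw [ltPairs, Finset.sum_filter, Fintype.sum_prod_type, Finset.sum_comm]
  rw [Finset.sum_add_distrib, h1, h2, ← Finset.sum_add_distrib, Finset.mul_sum]
  refine Finset.sum_congr rfl fun i _ => ?_
  rw [← Finset.sum_add_distrib]
  have h3 : ∀ j, ((if i < j then x i else 0) + if j < i then x i else 0)
      = if j ≠ i then x i else 0 := by
    intro j
    rcases lt_trichotomy i j with h | h | h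
    · simp [h, h.ne', h.not_gt]
    · simp [h]
    · simp [h, h.ne, h.not_gt]
  rw [Finset.sum_congr rfl fun j _ => h3 j, ← Finset.sum_filter, Finset.sum_const,
    Finset.filter_ne', Finset.card_erase_of_mem (Finset.mem_univ i)]
  simp

theorem card_ltPairs (k : ℕ) : (ltPairs k).card = k * (k - 1) / 2 := by
  have h := sum_ltPairs_add (k := k) fun _ => 1
  simp only [Finset.sum_const, Finset.card_univ, Fintype.card_fin, smul_eq_mul, mul_one] at h
  rw [mul_comm k, ← h]
  omega

theorem sum_parts_inter_le {k : ℕ} {V : Type} [Finite V] (R S T : Fin k → Set V)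
    (RR UU : Fin k → Fin k → Set V)
    (hdisj : ∀ p q : PIdx k, p ≠ q →
      Disjoint (PIdx.toSet R S T RR UU p) (PIdx.toSet R S T RR UU q)) (X : Set V) :
    ∑ i, (R i ∩ X).ncard + ∑ i, (S i ∩ X).ncard + ∑ i, (T i ∩ X).ncard
      + ∑ p ∈ ltPairs k, (RR p.1 p.2 ∩ X).ncard + ∑ p ∈ ltPairs k, (UU p.1 p.2 ∩ X).ncard
      ≤ X.ncard := by
  let e : Fin k ⊕ Fin k ⊕ Fin k ⊕ (Fin k × Fin k) ⊕ (Fin k × Fin k) → PIdx k :=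
    Sum.elim .r <| Sum.elim .s <| Sum.elim .t <|
      Sum.elim (fun p => .rr p.1 p.2) fun p => .uu p.1 p.2
  have he : Function.Injective e := by
    rintro (x | x | x | ⟨x, x'⟩ | ⟨x, x'⟩) (y | y | y | ⟨y, y'⟩ | ⟨y, y'⟩) h <;> cases h <;> rfl
  have h := sum_ncard_inter_le (fun p => PIdx.toSet R S T RR UU (e p))
    (fun p q hpq => hdisj _ _ (he.ne hpq)) X
  simp only [Fintype.sum_sum_type, e, Sum.elim_inl, Sum.elim_inr, PIdx.toSet] at h
  have h1 := Finset.sum_le_sum_of_subset (f := fun p : Fin k × Fin k => (RR p.1 p.2 ∩ X).ncard)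
    (Finset.subset_univ (ltPairs k))
  have h2 := Finset.sum_le_sum_of_subset (f := fun p : Fin k × Fin k => (UU p.1 p.2 ∩ X).ncard)
    (Finset.subset_univ (ltPairs k))
  omega

/-- In the budget estimate every inequality is tight. -/
theorem budget_tight {k s : ℕ} (hk : 2 ≤ k) (A D σ : Fin k → ℕ) (B ρ u : Fin k × Fin k → ℕ)
    (hAD : ∀ i, A i ≤ D i) (hσ : ∀ i, s - A i / 2 ≤ σ i)
    (hB : ∀ p ∈ ltPairs k, B p ≤ ρ p + (D p.1 + D p.2))
    (hu : ∀ p ∈ ltPairs k, s - B p / (2 * (k - 1)) ≤ u p)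
    (hq : ∑ i, σ i + ∑ i, D i + ∑ p ∈ ltPairs k, ρ p + ∑ p ∈ ltPairs k, u p
      ≤ k * s + k * (k - 1) / 2 * s) :
    ∀ p ∈ ltPairs k, B p = A p.1 + A p.2 := by
  obtain ⟨K, rfl⟩ : ∃ K, k = K + 1 := ⟨k - 1, by omega⟩
  simp only [Nat.add_sub_cancel] at *
  have e1 : ∑ i : Fin (K + 1), 2 * K * s ≤ ∑ i, (2 * K * σ i + K * A i) := by
    refine Finset.sum_le_sum fun i _ => ?_
    have : 2 * s ≤ 2 * σ i + A i := by have := hσ i; omega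
    nlinarith
  have e2 : ∑ p ∈ ltPairs (K + 1), 2 * K * s ≤ ∑ p ∈ ltPairs (K + 1), (2 * K * u p + B p) := by
    refine Finset.sum_le_sum fun p hp => ?_
    have h1 : s ≤ u p + B p / (2 * K) := by have := hu p hp; omega
    have h2 := Nat.mul_div_le (B p) (2 * K)
    nlinarith
  have e3 := Finset.sum_le_sum hB
  have e4 : ∑ i, A i ≤ ∑ i, D i := Finset.sum_le_sum fun i _ => hAD i
  have e5 := sum_ltPairs_add D
  have hcard : (ltPairs (K + 1)).card = (K + 1) * K / 2 := card_ltPairs _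
  rw [← hcard] at hq
  simp only [Finset.sum_add_distrib, ← Finset.mul_sum, Finset.sum_const, Finset.card_univ,
    Fintype.card_fin, smul_eq_mul, Nat.add_sub_cancel] at e1 e2 e3 e5
  have hKD : K * ∑ i, A i ≤ K * ∑ i, D i := Nat.mul_le_mul_left K e4
  have hK : 1 ≤ K := by omega
  have hq' := Nat.mul_le_mul_left (2 * K) hq
  have hρ : ∑ p ∈ ltPairs (K + 1), ρ p = 0 := by
    have h1 : 2 * K * ∑ p ∈ ltPairs (K + 1), ρ p ≤ ∑ p ∈ ltPairs (K + 1), ρ p := by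
      linarith
    have h2 := Nat.mul_le_mul_right (∑ p ∈ ltPairs (K + 1), ρ p) (Nat.mul_le_mul_left 2 hK)
    omega
  rw [hρ] at e3 hq'
  have hA : ∑ i, A i = ∑ i, D i := by nlinarith
  have hAeq : ∀ i, A i = D i := fun i =>
    (Finset.sum_eq_sum_iff_of_le fun i _ => hAD i).1 hA i (Finset.mem_univ i)
  have hB' : ∀ p ∈ ltPairs (K + 1), B p ≤ A p.1 + A p.2 := fun p hp => by
    have h1 := hB p hp
    have h2 := Finset.sum_eq_zero_iff.1 hρ p hp
    rw [hAeq, hAeq]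
    omega
  refine (Finset.sum_eq_sum_iff_of_le hB').1 (le_antisymm (Finset.sum_le_sum hB') ?_)
  rw [sum_ltPairs_add, Nat.add_sub_cancel]
  nlinarith

/-- reverse direction of the reduction for `α = 1`, i.e. Bounded Degree
Deletion: in the construction `H` built from a symmetric multicolored graph `G`, if
there is a set `X` of at most `q = k·s + (k(k-1)/2)·s` vertices of `H` whose deletion
leaves maximum degree at most `d = (nk)^10000`, then `G` contains a multicolored clique
of size `k`. -/
theorem deletion_to_clique
    (k n : ℕ) (hk : 100 ≤ k) (hkn : k ≤ n)
    (G : SimpleGraph (Fin k × Fin n))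
    (hGind : ∀ (i : Fin k) (σ τ : Fin n), ¬ G.Adj (i, σ) (i, τ))
    (hGsym : ∀ (i j : Fin k) (σ τ : Fin n), G.Adj (i, σ) (j, τ) → G.Adj (i, τ) (j, σ))
    (r0 s0 q0 a0 d0 : ℕ)
    (hr0 : r0 = 2 * (k - 1) ^ 2 * k ^ 3)
    (hs0 : s0 = n ^ 10)
    (hq0 : q0 = k * s0 + (k * (k - 1) / 2) * s0)
    (ha0 : a0 = q0 + 1)
    (hd0 : d0 = (n * k) ^ 10000)
    (a : Fin n → ℕ)
    (haanti : ∀ σ τ : Fin n, σ < τ → a τ < a σ)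
    (hamult : ∀ σ : Fin n, ∃ m : ℕ, 1 ≤ m ∧ a σ = m * r0)
    (hamax : ∀ σ : Fin n, a σ ≤ n ^ 4 * r0)
    (hsumfree : ∀ σ τ σ' τ' : Fin n,
      a σ + a τ = a σ' + a τ' → (σ = σ' ∧ τ = τ') ∨ (σ = τ' ∧ τ = σ'))
    (Iij : Fin k → Fin k → Finset ℕ)
    (hIij : ∀ (i j : Fin k) (x : ℕ), x ∈ Iij i j ↔
      ∃ σ τ : Fin n, G.Adj (i, σ) (j, τ) ∧ G.Adj (i, τ) (j, σ) ∧ x = a σ + a τ)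
    (hIne : ∀ i j : Fin k, i < j → (Iij i j).Nonempty)
    (VH : Type) [Fintype VH] (H : SimpleGraph VH)
    (R S T : Fin k → Set VH) (RR UU : Fin k → Fin k → Set VH)
    (hvoid : ∀ i j : Fin k, ¬ i < j → RR i j = ∅ ∧ UU i j = ∅)
    (hcover : ∀ v : VH, ∃ p : PIdx k, v ∈ PIdx.toSet R S T RR UU p)
    (hdisj : ∀ p q : PIdx k, p ≠ q →
      Disjoint (PIdx.toSet R S T RR UU p) (PIdx.toSet R S T RR UU q))
    (hRcard : ∀ i, (R i).ncard = d0 - s0)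
    (hTcard : ∀ i, (T i).ncard = s0)
    (hRRcard : ∀ i j, i < j → (RR i j).ncard = d0 - 2 * s0)
    (hRind : ∀ i, ∀ x ∈ R i, ∀ y ∈ R i, ¬ H.Adj x y)
    (hTind : ∀ i, ∀ x ∈ T i, ∀ y ∈ T i, ¬ H.Adj x y)
    (hRRind : ∀ i j, ∀ x ∈ RR i j, ∀ y ∈ RR i j, ¬ H.Adj x y)
    (hS : ∀ i, IsDegDel (H.induce (S i)) a0
      (Finset.univ.image a ∪ {sInf (Set.range a) - 1})
      (fun x => if x = sInf (Set.range a) - 1 then a0 else s0 - x / 2))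
    (hU : ∀ i j, i < j → IsDegDel (H.induce (UU i j)) a0
      (Iij i j ∪ {sInf {x | x ∈ Iij i j} - 1})
      (fun w => if w = sInf {x | x ∈ Iij i j} - 1 then a0 else s0 - w / (2 * (k - 1))))
    (hSR : ∀ i, ∀ x ∈ S i, ∀ y ∈ R i, H.Adj x y)
    (hST : ∀ i, ∀ x ∈ S i, ∀ y ∈ T i, H.Adj x y)
    (hURR : ∀ i j, i < j → ∀ x ∈ UU i j, ∀ y ∈ RR i j, H.Adj x y)
    (hUTi : ∀ i j, i < j → ∀ x ∈ UU i j, ∀ y ∈ T i, H.Adj x y)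
    (hUTj : ∀ i j, i < j → ∀ x ∈ UU i j, ∀ y ∈ T j, H.Adj x y)
    (hcross : ∀ x y : VH, H.Adj x y →
      (∃ p : PIdx k, x ∈ PIdx.toSet R S T RR UU p ∧ y ∈ PIdx.toSet R S T RR UU p) ∨
      (∃ i, (x ∈ S i ∧ (y ∈ R i ∨ y ∈ T i)) ∨ (y ∈ S i ∧ (x ∈ R i ∨ x ∈ T i))) ∨
      (∃ i j, i < j ∧
        ((x ∈ UU i j ∧ (y ∈ RR i j ∨ y ∈ T i ∨ y ∈ T j)) ∨
         (y ∈ UU i j ∧ (x ∈ RR i j ∨ x ∈ T i ∨ x ∈ T j)))))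
    (hX : ∃ X : Set VH, X.ncard ≤ q0 ∧
      ∀ v, ((H.induce Xᶜ).neighborSet v).ncard ≤ d0) :
    ∃ g : Fin k → Fin n, ∀ i j : Fin k, i ≠ j → G.Adj (i, g i) (j, g j) := by
  obtain ⟨X, hXq, hXd⟩ := hX
  have hn : 100 ≤ n := hk.trans hkn
  have hr_pos : 0 < r0 := by
    rw [hr0]
    have : 0 < k - 1 := by omega
    positivity
  have ha_pos : ∀ σ, 0 < a σ := by
    intro σ
    obtain ⟨m, hm, h⟩ := hamult σ
    rw [h]
    positivity
  have hbound : 2 * (n ^ 4 * r0) < a0 := by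
    have h1 : r0 ≤ 2 * n ^ 2 * n ^ 3 := by
      rw [hr0]
      gcongr
      omega
    have h2 : 2 * (n ^ 4 * r0) ≤ 4 * n ^ 9 := by nlinarith [Nat.mul_le_mul_left (n ^ 4) h1]
    have h3 : 4 * n ^ 9 ≤ k * n ^ 10 := by
      have h4 : n ^ 9 ≤ n ^ 10 := Nat.pow_le_pow_right (by omega) (by omega)
      exact Nat.mul_le_mul (by omega) h4
    rw [ha0, hq0, hs0]
    omega
  have hXsub : ∀ Y : Set VH, (Y ∩ X).ncard < a0 := fun Y => by
    have := Set.ncard_le_ncard (Set.inter_subset_right (s := Y) (t := X)) (Set.toFinite _)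
    omega
  have hpre : ∀ Y : Set VH, (Subtype.val ⁻¹' X : Set Y).ncard = (Y ∩ X).ncard := fun Y => by
    rw [← Set.ncard_image_of_injective _ Subtype.val_injective, Subtype.image_preimage_coe]
  have hne : ∀ p q : PIdx k, p ≠ q →
      ∀ v, v ∈ PIdx.toSet R S T RR UU p → v ∉ PIdx.toSet R S T RR UU q :=
    fun p q hpq v hp hq => Set.disjoint_left.1 (hdisj p q hpq) hp hq
  have hsel : ∀ i, ∃ σ, a σ ≤ (R i ∩ X).ncard + (T i ∩ X).ncard ∧
      s0 - a σ / 2 ≤ (S i ∩ X).ncard := by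
    intro i
    have hlow : ∀ σ, sInf (Set.range a) - 1 < a σ := fun σ => by
      have h1 := Nat.sInf_le (Set.mem_range_self (f := a) σ)
      have := ha_pos σ
      omega
    have hRT : Disjoint (R i) (T i) := hdisj (.r i) (.t i) (by simp)
    have hlt : ∀ σ, a σ < a0 := fun σ => by have := hamax σ; omega
    have hSP : Disjoint (S i) (R i ∪ T i) := Set.disjoint_union_right.2
      ⟨hdisj (.s i) (.r i) (by simp), hdisj (.s i) (.t i) (by simp)⟩
    obtain ⟨x, hxJ, hxD, hxc⟩ := (hS i).exists_cost_le (X := Subtype.val ⁻¹' X)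
      ((hlow ⟨0, by omega⟩).trans (hlt _)) (by simpa using hlow) (by simpa using hlt)
      (by simpa [hpre] using hXsub (S i)) (hXsub (R i ∪ T i))
      (ncard_neighborSet_induce_le H (S i) (R i ∪ T i) X d0 hSP
        (fun x hx y hy => hy.elim (hSR i x hx y) (hST i x hx y))
        (by rw [Set.ncard_union_eq hRT (Set.toFinite _) (Set.toFinite _), hRcard, hTcard]; omega)
        hXd)
    obtain ⟨σ, -, rfl⟩ := Finset.mem_image.1 hxJ
    refine ⟨σ, ?_, ?_⟩
    · rw [Set.union_inter_distrib_right] at hxD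
      exact hxD.trans (Set.ncard_union_le _ _)
    · simpa only [if_neg (hlow σ).ne', hpre] using hxc
  have hselU : ∀ p : Fin k × Fin k, ∃ x, p ∈ ltPairs k → x ∈ Iij p.1 p.2 ∧
      x ≤ (RR p.1 p.2 ∩ X).ncard + ((T p.1 ∩ X).ncard + (T p.2 ∩ X).ncard) ∧
      s0 - x / (2 * (k - 1)) ≤ (UU p.1 p.2 ∩ X).ncard := by
    rintro ⟨i, j⟩
    by_cases hp : (i, j) ∈ ltPairs k
    swap
    · exact ⟨0, fun h => absurd h hp⟩
    have hij : i < j := mem_ltPairs.1 hp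
    have hlow : ∀ x ∈ Iij i j, sInf {x | x ∈ Iij i j} - 1 < x := fun x hx => by
      have h1 := Nat.sInf_le (s := {x | x ∈ Iij i j}) hx
      obtain ⟨σ, τ, -, -, rfl⟩ := (hIij i j x).1 hx
      have := ha_pos σ
      omega
    have hlt : ∀ x ∈ Iij i j, x < a0 := fun x hx => by
      obtain ⟨σ, τ, -, -, rfl⟩ := (hIij i j x).1 hx
      have := hamax σ
      have := hamax τ
      omega
    have hTT : Disjoint (T i) (T j) := hdisj (.t i) (.t j) (by simpa using hij.ne)
    have hRT : Disjoint (RR i j) (T i ∪ T j) := Set.disjoint_union_right.2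
      ⟨hdisj (.rr i j) (.t i) (by simp), hdisj (.rr i j) (.t j) (by simp)⟩
    have hSP : Disjoint (UU i j) (RR i j ∪ (T i ∪ T j)) := Set.disjoint_union_right.2
      ⟨hdisj (.uu i j) (.rr i j) (by simp), Set.disjoint_union_right.2
      ⟨hdisj (.uu i j) (.t i) (by simp), hdisj (.uu i j) (.t j) (by simp)⟩⟩
    obtain ⟨y, hy⟩ := hIne i j hij
    obtain ⟨x, hxJ, hxD, hxc⟩ := (hU i j hij).exists_cost_le (X := Subtype.val ⁻¹' X)
      ((hlow y hy).trans (hlt y hy)) hlow hlt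
      (by simpa [hpre] using hXsub (UU i j)) (hXsub (RR i j ∪ (T i ∪ T j)))
      (ncard_neighborSet_induce_le H (UU i j) (RR i j ∪ (T i ∪ T j)) X d0 hSP
        (fun x hx y hy => hy.elim (hURR i j hij x hx y)
          fun hy => hy.elim (hUTi i j hij x hx y) (hUTj i j hij x hx y))
        (by
          rw [Set.ncard_union_eq hRT (Set.toFinite _) (Set.toFinite _),
            Set.ncard_union_eq hTT (Set.toFinite _) (Set.toFinite _), hRRcard i j hij, hTcard,
            hTcard]
          omega)
        hXd)
    refine ⟨x, fun _ => ⟨hxJ, ?_, ?_⟩⟩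
    · rw [Set.union_inter_distrib_right, Set.union_inter_distrib_right] at hxD
      exact hxD.trans ((Set.ncard_union_le _ _).trans
        (Nat.add_le_add_left (Set.ncard_union_le _ _) _))
    · simpa only [if_neg (hlow x hxJ).ne', hpre] using hxc
  choose g hgD hgc using hsel
  choose B hB using hselU
  have htotal : ∑ i, (S i ∩ X).ncard + ∑ i, ((R i ∩ X).ncard + (T i ∩ X).ncard)
      + ∑ p ∈ ltPairs k, (RR p.1 p.2 ∩ X).ncard + ∑ p ∈ ltPairs k, (UU p.1 p.2 ∩ X).ncard
      ≤ k * s0 + k * (k - 1) / 2 * s0 := by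
    have h := sum_parts_inter_le R S T RR UU hdisj X
    rw [Finset.sum_add_distrib]
    omega
  have htight := budget_tight (by omega) (fun i => a (g i))
    (fun i => (R i ∩ X).ncard + (T i ∩ X).ncard) (fun i => (S i ∩ X).ncard) B
    (fun p => (RR p.1 p.2 ∩ X).ncard) (fun p => (UU p.1 p.2 ∩ X).ncard) hgD hgc
    (fun p hp => by have := (hB p hp).2.1; omega)
    (fun p hp => (hB p hp).2.2) htotal
  have hadj : ∀ i j, i < j → G.Adj (i, g i) (j, g j) := by
    intro i j hij
    have hp : (i, j) ∈ ltPairs k := mem_ltPairs.2 hij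
    obtain ⟨σ, τ, h1, h2, h3⟩ := (hIij i j _).1 (hB _ hp).1
    rcases hsumfree _ _ _ _ ((htight _ hp).symm.trans h3) with ⟨hi, hj⟩ | ⟨hi, hj⟩
    · simpa only [hi, hj] using h1
    · simpa only [hi, hj] using h2
  refine ⟨g, fun i j hij => ?_⟩
  rcases hij.lt_or_gt with h | h
  · exact hadj i j h
  · exact (hadj j i h).symm

end Stmt13
end

section
/- Let G be a finite simple graph, d, q ∈ ℕ, and M_1, …, M_k a partition of V(G) into modules of G. Then there exists X ⊆ V(G) with |X| ≤ q and Δ(G − X) ≤ d if and only if there exist integers x_1, …, x_k with 0 ≤ x_i ≤ |M_i| for all i, Σ_{i=1}^{k} x_i ≤ q, and, for every i with x_i < |M_i|, Σ_{j ∈ N(M_i)} (|M_j| − x_j) + f_i(x_i) ≤ d. -/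
namespace Stmt14

/-- A module of a graph: every outside vertex is adjacent to all or none of its vertices. -/
def IsModule {α : Type} (G : SimpleGraph α) (M : Set α) : Prop :=
  ∀ v ∉ M, (∀ u ∈ M, G.Adj v u) ∨ (∀ u ∈ M, ¬ G.Adj v u)

/-- The degree deletion function of `W`: the minimum possible maximum degree of the
graph obtained from `W` by deleting a set of `x` vertices. -/
noncomputable def fdel {α : Type} (W : SimpleGraph α) (x : ℕ) : ℕ :=
  sInf {m | ∃ Y : Set α, Y.ncard = x ∧ ∀ v, ((W.induce Yᶜ).neighborSet v).ncard ≤ m}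

/-- The indices of the modules adjacent to the module `M i`. -/
def NbrIdx {V : Type} {k : ℕ} (G : SimpleGraph V) (M : Fin k → Set V) (i : Fin k) :
    Set (Fin k) :=
  {j | j ≠ i ∧ ∃ u ∈ M i, ∃ w ∈ M j, G.Adj u w}

theorem ncard_neighborSet_induce {α : Type} (G : SimpleGraph α) (s : Set α) (v : s) :
    ((G.induce s).neighborSet v).ncard = (G.neighborSet v ∩ s).ncard := by
  rw [← Set.ncard_image_of_injective _ Subtype.val_injective]
  congr 1
  ext w
  simp only [Set.mem_image, SimpleGraph.mem_neighborSet, SimpleGraph.comap_adj, Subtype.exists,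
    Set.mem_inter_iff, Function.Embedding.subtype_apply]
  constructor
  · rintro ⟨a, ha, h, rfl⟩
    exact ⟨h, ha⟩
  · rintro ⟨h, hw⟩
    exact ⟨w, hw, h, rfl⟩

theorem ncard_neighborSet_induce_induce {α : Type} (G : SimpleGraph α) (s : Set α) (Y : Set s)
    (v : (Yᶜ : Set s)) :
    (((G.induce s).induce Yᶜ).neighborSet v).ncard =
      ((G.neighborSet v \ (Subtype.val '' Y)) ∩ s).ncard := by
  rw [ncard_neighborSet_induce, ← Set.ncard_image_of_injective _ Subtype.val_injective]
  congr 1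
  ext w
  simp only [Set.mem_image, SimpleGraph.mem_neighborSet, SimpleGraph.comap_adj, Subtype.exists,
    Set.mem_inter_iff, Function.Embedding.subtype_apply, Set.mem_compl_iff, Set.mem_sdiff]
  constructor
  · rintro ⟨a, ha, ⟨h, hY⟩, rfl⟩
    refine ⟨⟨h, ?_⟩, ha⟩
    rintro ⟨b, hb, hbY, rfl⟩
    exact hY hbY
  · rintro ⟨⟨h, hY⟩, hw⟩
    exact ⟨w, hw, ⟨h, fun hY' => hY ⟨w, hw, hY', rfl⟩⟩, rfl⟩

theorem ncard_eq_sum_ncard_inter {V : Type} [Finite V] {k : ℕ} {M : Fin k → Set V}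
    (hcover : ∀ v : V, ∃! i : Fin k, v ∈ M i) (S : Set V) :
    S.ncard = ∑ i, (S ∩ M i).ncard := by
  have hS : S = ⋃ i, S ∩ M i := by
    ext v
    obtain ⟨i, hi, -⟩ := hcover v
    simp only [Set.mem_iUnion, Set.mem_inter_iff]
    exact ⟨fun h => ⟨i, h, hi⟩, fun ⟨_, h, _⟩ => h⟩
  have hdisj : Pairwise (Function.onFun Disjoint fun i => S ∩ M i) := by
    intro i j hij
    refine Set.disjoint_left.2 fun v hi hj => hij ?_
    exact (hcover v).unique hi.2 hj.2
  conv_lhs => rw [hS]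
  rw [Set.ncard_iUnion_of_finite (fun _ => Set.toFinite _) hdisj,
    finsum_eq_sum_of_fintype]

/-- The degree of a vertex `v ∈ M i` after deleting `X` splits into its degree inside `M i` and
the number of remaining vertices in the modules adjacent to `M i`. -/
theorem ncard_neighborSet_diff {V : Type} [Finite V] {G : SimpleGraph V} {k : ℕ}
    {M : Fin k → Set V} (hcover : ∀ v : V, ∃! i : Fin k, v ∈ M i)
    (hmod : ∀ i, IsModule G (M i)) (X : Set V) {i : Fin k} {v : V} (hv : v ∈ M i) :
    (G.neighborSet v \ X).ncard =
      (∑ᶠ j ∈ NbrIdx G M i, ((M j).ncard - (X ∩ M j).ncard)) +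
        ((G.neighborSet v \ X) ∩ M i).ncard := by
  classical
  rw [ncard_eq_sum_ncard_inter hcover, finsum_mem_def, finsum_eq_sum_of_fintype,
    ← Finset.sum_erase_add _ _ (Finset.mem_univ i)]
  congr 1
  rw [← Finset.sum_erase (a := i) Finset.univ (Set.indicator_of_notMem (fun h => h.1 rfl) _)]
  refine Finset.sum_congr rfl fun j hj => ?_
  have hji : j ≠ i := (Finset.mem_erase.1 hj).1
  have hvj : v ∉ M j := fun h => hji ((hcover v).unique h hv)
  by_cases hN : j ∈ NbrIdx G M i
  · rw [Set.indicator_of_mem hN]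
    obtain ⟨-, u, hu, w, hw, huw⟩ := hN
    have hwi : w ∉ M i := fun h => hji ((hcover w).unique hw h)
    have hvw : G.Adj v w :=
      ((hmod i w hwi).resolve_right fun h => h u hu huw.symm) v hv |>.symm
    have hall := (hmod j v hvj).resolve_right fun h => h w hw hvw
    have : (G.neighborSet v \ X) ∩ M j = M j \ (X ∩ M j) := by
      ext y
      simp only [Set.mem_inter_iff, Set.mem_sdiff, SimpleGraph.mem_neighborSet]
      have := hall y
      tauto
    rw [this, Set.ncard_sdiff Set.inter_subset_right]
  · rw [Set.indicator_of_notMem hN, Set.ncard_eq_zero, Set.eq_empty_iff_forall_notMem]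
    rintro w ⟨⟨hw, -⟩, hwj⟩
    exact hN ⟨hji, v, hv, w, hwj, hw⟩

theorem exists_ncard_eq_forall_ncard_le_fdel {α : Type} [Finite α] (W : SimpleGraph α) {x : ℕ}
    (hx : x ≤ Nat.card α) :
    ∃ Y : Set α, Y.ncard = x ∧ ∀ v, ((W.induce Yᶜ).neighborSet v).ncard ≤ fdel W x := by
  refine Nat.sInf_mem (s := {m | ∃ Y : Set α, Y.ncard = x ∧
    ∀ v, ((W.induce Yᶜ).neighborSet v).ncard ≤ m}) ?_
  rw [← Set.ncard_univ] at hx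
  obtain ⟨Y, -, hY⟩ := Set.exists_subset_card_eq hx
  refine ⟨Nat.card α, Y, hY, fun v => ?_⟩
  rw [ncard_neighborSet_induce, ← Set.ncard_univ]
  exact Set.ncard_le_ncard (Set.subset_univ _)

/-- for a partition `M 0, …, M (k-1)` of the vertices of `G` into modules,
there is a set `X` of at most `q` vertices with `Δ(G - X) ≤ d` if and only if there are
integers `x i ≤ |M i|` with `∑ x i ≤ q` such that, whenever `x i < |M i|`,
`∑_{j ∈ N(M i)} (|M j| - x j) + f_i (x i) ≤ d`, where `f_i` is the degree deletion
function of the factor `G[M i]`. -/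
theorem bdd_module_ilp (V : Type) [Fintype V] (G : SimpleGraph V) (d q k : ℕ)
    (M : Fin k → Set V)
    (hcover : ∀ v : V, ∃! i : Fin k, v ∈ M i)
    (hne : ∀ i, (M i).Nonempty)
    (hmod : ∀ i, IsModule G (M i)) :
    (∃ X : Set V, X.ncard ≤ q ∧ ∀ v, ((G.induce Xᶜ).neighborSet v).ncard ≤ d) ↔
    (∃ x : Fin k → ℕ,
      (∀ i, x i ≤ (M i).ncard) ∧
      (∑ i, x i) ≤ q ∧
      (∀ i, x i < (M i).ncard →
        (∑ᶠ j ∈ NbrIdx G M i, ((M j).ncard - x j)) + fdel (G.induce (M i)) (x i) ≤ d)) := by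
  constructor
  · rintro ⟨X, hXq, hX⟩
    refine ⟨fun i => (X ∩ M i).ncard, fun i => Set.ncard_le_ncard Set.inter_subset_right,
      (ncard_eq_sum_ncard_inter hcover X).symm.trans_le hXq, fun i hi => ?_⟩
    have hdeg : ∀ v ∈ M i, v ∉ X → (∑ᶠ j ∈ NbrIdx G M i, ((M j).ncard - (X ∩ M j).ncard)) +
        ((G.neighborSet v \ X) ∩ M i).ncard ≤ d := by
      intro v hv hvX
      rw [← ncard_neighborSet_diff hcover hmod X hv, Set.sdiff_eq]
      exact (ncard_neighborSet_induce G Xᶜ ⟨v, hvX⟩).symm.trans_le (hX ⟨v, hvX⟩)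
    obtain ⟨v, hv, hvX⟩ := Set.exists_mem_notMem_of_ncard_lt_ncard hi
    have h := hdeg v hv fun h => hvX ⟨h, hv⟩
    refine (Nat.add_le_add_left (Nat.sInf_le (m := d - _) ?_) _).trans_eq
      (Nat.add_sub_cancel' (le_of_add_le_left h))
    have himage : Subtype.val '' (Subtype.val ⁻¹' X : Set (M i)) = X ∩ M i := by
      rw [Subtype.image_preimage_coe, Set.inter_comm]
    refine ⟨Subtype.val ⁻¹' X, ?_, fun w => ?_⟩
    · rw [← Set.ncard_image_of_injective _ Subtype.val_injective, himage]
    · rw [ncard_neighborSet_induce_induce, himage]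
      have hset : (G.neighborSet w \ (X ∩ M i)) ∩ M i = (G.neighborSet w \ X) ∩ M i := by
        ext y
        simp only [Set.mem_inter_iff, Set.mem_sdiff]
        tauto
      rw [hset]
      exact Nat.le_sub_of_add_le' (hdeg w w.1.2 w.2)
  · rintro ⟨x, hxM, hxq, hx⟩
    choose Y hYx hY using fun i =>
      exists_ncard_eq_forall_ncard_le_fdel (G.induce (M i)) (x := x i) (hxM i)
    have hXM : ∀ i, (⋃ j, Subtype.val '' Y j) ∩ M i = Subtype.val '' Y i := by
      intro i
      ext v
      constructor
      · rintro ⟨hv, hvi⟩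
        obtain ⟨j, w, hw, rfl⟩ := Set.mem_iUnion.1 hv
        obtain rfl := (hcover w).unique w.2 hvi
        exact ⟨w, hw, rfl⟩
      · rintro ⟨w, hw, rfl⟩
        exact ⟨Set.mem_iUnion.2 ⟨i, w, hw, rfl⟩, w.2⟩
    have hcard : ∀ i, ((⋃ j, Subtype.val '' Y j) ∩ M i).ncard = x i := by
      intro i
      rw [hXM, Set.ncard_image_of_injective _ Subtype.val_injective, hYx]
    refine ⟨⋃ j, Subtype.val '' Y j, ?_, ?_⟩
    · rw [ncard_eq_sum_ncard_inter hcover]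
      simpa only [hcard] using hxq
    · rintro ⟨v, hvX⟩
      obtain ⟨i, hvi, -⟩ := hcover v
      have hlt : x i < (M i).ncard := by
        rw [← hcard i]
        exact Set.ncard_lt_ncard ⟨Set.inter_subset_right, fun h => hvX (h hvi).1⟩
      rw [ncard_neighborSet_induce, ← Set.sdiff_eq,
        ncard_neighborSet_diff hcover hmod _ hvi]
      simp only [hcard]
      refine (Nat.add_le_add_left ?_ _).trans (hx i hlt)
      have hvY : (⟨v, hvi⟩ : M i) ∈ (Y i)ᶜ := fun h =>
        hvX (Set.mem_iUnion.2 ⟨i, ⟨v, hvi⟩, h, rfl⟩)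
      refine le_trans (Set.ncard_le_ncard ?_)
        ((ncard_neighborSet_induce_induce G (M i) (Y i) ⟨⟨v, hvi⟩, hvY⟩).symm.trans_le
          (hY i ⟨⟨v, hvi⟩, hvY⟩))
      rw [← hXM i]
      rintro y ⟨⟨hy, hyX⟩, hyi⟩
      exact ⟨⟨hy, fun h => hyX h.1⟩, hyi⟩

end Stmt14
end

section
/- Let G be a finite simple graph, α ∈ [0,1] a real number, β ∈ ℤ, and q ∈ ℕ. Let M_1, …, M_k be a partition of V(G) into modules of G such that each induced subgraph G[M_i] is either a complete graph or an edgeless graph. Then G has an (α, β)-linear degree dominating set of size at most q if and only if there exist integers x_1, …, x_k with 0 ≤ x_i ≤ |M_i| for all i, Σ_{i=1}^{k} x_i ≤ q, and, for every i with x_i < |M_i|: if G[M_i] is a complete graph then x_i + Σ_{j ∈ N(M_i)} x_j ≥ ⌈α·(|M_i| − 1 + Σ_{j ∈ N(M_i)} |M_j|)⌉ + β, and if G[M_i] is an edgeless graph then Σ_{j ∈ N(M_i)} x_j ≥ ⌈α·Σ_{j ∈ N(M_i)} |M_j|⌉ + β. -/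
namespace Stmt15

/-- A module of a graph: every outside vertex is adjacent to all or none of its vertices. -/
def IsModule {α : Type} (G : SimpleGraph α) (M : Set α) : Prop :=
  ∀ v ∉ M, (∀ u ∈ M, G.Adj v u) ∨ (∀ u ∈ M, ¬ G.Adj v u)

/-- The indices of the modules adjacent to the module `M i`. -/
def NbrIdx {V : Type} {k : ℕ} (G : SimpleGraph V) (M : Fin k → Set V) (i : Fin k) :
    Set (Fin k) :=
  {j | j ≠ i ∧ ∃ u ∈ M i, ∃ w ∈ M j, G.Adj u w}

theorem ncard_eq_sum_inter {V ι : Type*} [Finite V] [Fintype ι] {M : ι → Set V}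
    (hcover : ∀ v : V, ∃! i, v ∈ M i) (S : Set V) :
    S.ncard = ∑ i, (M i ∩ S).ncard := by
  classical
  choose f hf huniq using hcover
  have hmem : ∀ i v, v ∈ M i ↔ f v = i :=
    fun i v => ⟨fun h => (huniq v i h).symm, fun h => h ▸ hf v⟩
  have hS := S.toFinite
  rw [Set.ncard_eq_toFinset_card S hS,
    Finset.card_eq_sum_card_fiberwise (f := f) (t := Finset.univ) (fun _ _ => by simp)]
  refine Finset.sum_congr rfl fun i _ => ?_
  rw [← Set.ncard_coe_finset]
  congr 1
  ext v
  simp [hmem, and_comm]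

section NeighborCount

variable {V : Type} {k : ℕ} {G : SimpleGraph V} {M : Fin k → Set V}

theorem IsModule.inter_neighborSet (hcover : ∀ v : V, ∃! i : Fin k, v ∈ M i)
    (hmod : ∀ i, IsModule G (M i)) {i j : Fin k} (hji : j ≠ i) {v : V} (hv : v ∈ M i) :
    M j ∩ G.neighborSet v = {w ∈ M j | j ∈ NbrIdx G M i} := by
  have hout : ∀ {a b : Fin k} {u : V}, a ≠ b → u ∈ M a → u ∉ M b :=
    fun hab ha hb => hab ((hcover _).unique ha hb)
  ext w
  simp only [Set.mem_inter_iff, SimpleGraph.mem_neighborSet, Set.mem_ofPred_eq]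
  refine and_congr_right fun hw => ⟨fun h => ⟨hji, v, hv, w, hw, h⟩, ?_⟩
  rintro ⟨-, u, hu, w', hw', huw⟩
  have hvw' : G.Adj w' v := by
    rcases hmod i w' (hout hji hw') with h | h
    · exact h v hv
    · exact absurd huw.symm (h u hu)
  rcases hmod j v (hout hji.symm hv) with h | h
  · exact h w hw
  · exact absurd hvw'.symm (h w' hw')

theorem ncard_neighborSet_inter [Finite V] (hcover : ∀ v : V, ∃! i : Fin k, v ∈ M i)
    (hmod : ∀ i, IsModule G (M i)) {i : Fin k} {v : V} (hv : v ∈ M i) (X : Set V) :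
    (G.neighborSet v ∩ X).ncard =
      (M i ∩ (G.neighborSet v ∩ X)).ncard + ∑ᶠ j ∈ NbrIdx G M i, (M j ∩ X).ncard := by
  classical
  rw [ncard_eq_sum_inter hcover, ← Finset.add_sum_erase _ _ (Finset.mem_univ i),
    finsum_mem_def, finsum_eq_sum_of_fintype,
    ← Finset.add_sum_erase (s := Finset.univ) (a := i) (f := Set.indicator _ _)
      (Finset.mem_univ i),
    Set.indicator_of_notMem (fun h : i ∈ NbrIdx G M i => h.1 rfl), zero_add]
  congr 1
  refine Finset.sum_congr rfl fun j hj => ?_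
  rw [← Set.inter_assoc, IsModule.inter_neighborSet hcover hmod (Finset.ne_of_mem_erase hj) hv]
  by_cases h : j ∈ NbrIdx G M i <;> simp [h]

theorem natCast_finsum_mem {ι R : Type*} [Finite ι] [AddCommMonoidWithOne R] (s : Set ι)
    (f : ι → ℕ) : ((∑ᶠ j ∈ s, f j : ℕ) : R) = ∑ᶠ j ∈ s, (f j : R) :=
  (Nat.castAddMonoidHom R).map_finsum_mem f s.toFinite

theorem mul_add_intCast_le_natCast_iff {a b c : ℝ} {β : ℤ} {m n : ℕ} (hab : a = b) :
    c * a + (β : ℝ) ≤ ((m + n : ℕ) : ℝ) ↔ ⌈c * b⌉ + β ≤ (m : ℤ) + (n : ℤ) := by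
  rw [hab, ← le_sub_iff_add_le, ← le_sub_iff_add_le, Int.ceil_le]
  push_cast
  rfl

theorem degree_condition_iff_of_complete [Finite V] (hcover : ∀ v : V, ∃! i : Fin k, v ∈ M i)
    (hmod : ∀ i, IsModule G (M i)) {i : Fin k} {v : V} (hv : v ∈ M i)
    (hc : ∀ u ∈ M i, ∀ w ∈ M i, u ≠ w → G.Adj u w) {X : Set V} (hX : v ∉ X) (α : ℝ) (β : ℤ) :
    α * ((G.neighborSet v).ncard : ℝ) + (β : ℝ) ≤ ((G.neighborSet v ∩ X).ncard : ℝ) ↔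
      ⌈α * (((M i).ncard : ℝ) - 1 + ∑ᶠ j ∈ NbrIdx G M i, ((M j).ncard : ℝ))⌉ + β ≤
        ((M i ∩ X).ncard : ℤ) + ∑ᶠ j ∈ NbrIdx G M i, ((M j ∩ X).ncard : ℤ) := by
  have hdeg := ncard_neighborSet_inter hcover hmod hv Set.univ
  simp only [Set.inter_univ] at hdeg
  have hown : M i ∩ G.neighborSet v = M i \ {v} := by
    ext w
    refine and_congr_right fun hw => ⟨fun h => (G.ne_of_adj h).symm, fun h => hc v hv w hw ?_⟩
    exact Ne.symm h
  have hownX : M i ∩ (G.neighborSet v ∩ X) = M i ∩ X := by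
    rw [← Set.inter_assoc, hown]
    ext w
    simp only [Set.mem_inter_iff, Set.mem_sdiff, Set.mem_singleton_iff]
    exact ⟨fun h => ⟨h.1.1, h.2⟩, fun h => ⟨⟨h.1, fun e => hX (e ▸ h.2)⟩, h.2⟩⟩
  rw [ncard_neighborSet_inter hcover hmod hv X, hownX, ← natCast_finsum_mem (R := ℤ)]
  refine mul_add_intCast_le_natCast_iff ?_
  rw [hdeg, hown, ← Set.ncard_sdiff_singleton_add_one hv, ← natCast_finsum_mem (R := ℝ)]
  push_cast
  ring

theorem degree_condition_iff_of_edgeless [Finite V] (hcover : ∀ v : V, ∃! i : Fin k, v ∈ M i)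
    (hmod : ∀ i, IsModule G (M i)) {i : Fin k} {v : V} (hv : v ∈ M i)
    (hc : ∀ u ∈ M i, ∀ w ∈ M i, ¬ G.Adj u w) (X : Set V) (α : ℝ) (β : ℤ) :
    α * ((G.neighborSet v).ncard : ℝ) + (β : ℝ) ≤ ((G.neighborSet v ∩ X).ncard : ℝ) ↔
      ⌈α * (∑ᶠ j ∈ NbrIdx G M i, ((M j).ncard : ℝ))⌉ + β ≤
        ∑ᶠ j ∈ NbrIdx G M i, ((M j ∩ X).ncard : ℤ) := by
  have hdeg := ncard_neighborSet_inter hcover hmod hv Set.univ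
  simp only [Set.inter_univ] at hdeg
  have hown : M i ∩ G.neighborSet v = ∅ :=
    Set.eq_empty_of_forall_notMem fun w hw => hc v hv w hw.1 hw.2
  rw [ncard_neighborSet_inter hcover hmod hv X, ← Set.inter_assoc, hown, Set.empty_inter,
    Set.ncard_empty, ← natCast_finsum_mem (R := ℤ), ← zero_add ((_ : ℕ) : ℤ), ← Nat.cast_zero]
  refine mul_add_intCast_le_natCast_iff ?_
  rw [hdeg, hown, Set.ncard_empty, zero_add, natCast_finsum_mem]

end NeighborCount

theorem exists_ncard_inter_eq {V ι : Type*} [Finite V] {M : ι → Set V}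
    (hcover : ∀ v : V, ∃! i, v ∈ M i) {x : ι → ℕ} (hx : ∀ i, x i ≤ (M i).ncard) :
    ∃ X : Set V, ∀ i, (M i ∩ X).ncard = x i := by
  choose T hTM hT using fun i => Set.exists_subset_card_eq (hx i)
  refine ⟨⋃ i, T i, fun i => ?_⟩
  rw [← hT i]
  congr 1
  ext v
  simp only [Set.mem_inter_iff, Set.mem_iUnion]
  refine ⟨fun ⟨hv, j, hj⟩ => ?_, fun h => ⟨hTM i h, i, h⟩⟩
  rwa [(hcover v).unique hv (hTM j hj)]

/-- for a neighborhood partition `M 0, …, M (k-1)` of `G` (each part a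
module inducing a complete or edgeless graph), `G` has an `(α, β)`-linear degree
dominating set of size at most `q` iff the associated integer program is feasible. -/
theorem ldd_nd_ilp (V : Type) [Fintype V] (G : SimpleGraph V)
    (α : ℝ) (hα0 : 0 ≤ α) (hα1 : α ≤ 1) (β : ℤ) (q : ℕ) (k : ℕ)
    (M : Fin k → Set V)
    (hcover : ∀ v : V, ∃! i : Fin k, v ∈ M i)
    (hne : ∀ i, (M i).Nonempty)
    (hmod : ∀ i, IsModule G (M i))
    (htype : ∀ i, (∀ u ∈ M i, ∀ w ∈ M i, u ≠ w → G.Adj u w) ∨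
        (∀ u ∈ M i, ∀ w ∈ M i, ¬ G.Adj u w)) :
    (∃ X : Set V, X.ncard ≤ q ∧ ∀ v ∉ X,
        α * ((G.neighborSet v).ncard : ℝ) + (β : ℝ) ≤ ((G.neighborSet v ∩ X).ncard : ℝ)) ↔
    (∃ x : Fin k → ℕ,
      (∀ i, x i ≤ (M i).ncard) ∧
      (∑ i, x i) ≤ q ∧
      (∀ i, x i < (M i).ncard →
        ((∀ u ∈ M i, ∀ w ∈ M i, u ≠ w → G.Adj u w) →
          ⌈α * (((M i).ncard : ℝ) - 1 + ∑ᶠ j ∈ NbrIdx G M i, ((M j).ncard : ℝ))⌉ + β ≤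
            (x i : ℤ) + ∑ᶠ j ∈ NbrIdx G M i, ((x j : ℤ))) ∧
        ((∀ u ∈ M i, ∀ w ∈ M i, ¬ G.Adj u w) →
          ⌈α * (∑ᶠ j ∈ NbrIdx G M i, ((M j).ncard : ℝ))⌉ + β ≤
            ∑ᶠ j ∈ NbrIdx G M i, ((x j : ℤ))))) := by
  constructor
  · rintro ⟨X, hXq, hX⟩
    refine ⟨fun i => (M i ∩ X).ncard, fun i => Set.ncard_le_ncard Set.inter_subset_left,
      (ncard_eq_sum_inter hcover X).symm.trans_le hXq, fun i hi => ?_⟩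
    obtain ⟨v, hv, hvX⟩ : ∃ v ∈ M i, v ∉ X := by
      by_contra! h
      exact hi.ne (congrArg Set.ncard (Set.inter_eq_left.2 h))
    exact ⟨fun hc => (degree_condition_iff_of_complete hcover hmod hv hc hvX α β).1 (hX v hvX),
      fun hc => (degree_condition_iff_of_edgeless hcover hmod hv hc X α β).1 (hX v hvX)⟩
  · rintro ⟨x, hx, hxq, hcond⟩
    obtain ⟨X, hX⟩ := exists_ncard_inter_eq hcover hx
    obtain rfl : (fun i => (M i ∩ X).ncard) = x := funext hX
    refine ⟨X, (ncard_eq_sum_inter hcover X).trans_le hxq, fun v hvX => ?_⟩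
    obtain ⟨i, hv, -⟩ := hcover v
    have hlt : (M i ∩ X).ncard < (M i).ncard :=
      Set.ncard_lt_ncard ⟨Set.inter_subset_left, fun h => hvX (h hv).2⟩
    rcases htype i with hc | hc
    · exact (degree_condition_iff_of_complete hcover hmod hv hc hvX α β).2 ((hcond i hlt).1 hc)
    · exact (degree_condition_iff_of_edgeless hcover hmod hv hc X α β).2 ((hcond i hlt).2 hc)

end Stmt15
end
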